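/- Let k_2/k_1 be a finite extension of p-adic fields with residual degree f, with uniformizers π_2, π_1. Then π_1^{-f} Nr_{k_2/k_1}(π_2) is a root of unity if and only if there exists a finite extension M of the Lubin-Tate extension k_{2,π_2} such that k_{1,π_1} ⊆ M. Moreover, in that case M can be taken to be the subextension of the maximal abelian extension of k_2 over k_{2,π_2} of degree equal to the number of roots of unity in k_1. -/

import Mathlib

noncomputable def resCard (p : ℕ) [Fact p.Prime] (k : Type*) [Field k] [Algebra ℤ_[p] k] : ℕ :=
  Nat.card ((integralClosure ℤ_[p] k) ⧸ ((⊥ : Ideal (integralClosure ℤ_[p] k)).jacobson))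

def IsUniformizer (p : ℕ) [Fact p.Prime] (k : Type*) [Field k] [Algebra ℤ_[p] k] (π : k) :
    Prop :=
  ∃ h : π ∈ integralClosure ℤ_[p] k, Irreducible (⟨π, h⟩ : integralClosure ℤ_[p] k)

/-- Lubin-Tate extension (see stmt_7): the union of all finite abelian `L/k` inside `Ω`
with `π` a norm from `L`. -/
noncomputable def lubinTateExt (k Ω : Type*) [Field k] [Field Ω] [Algebra k Ω] (π : k) :
    IntermediateField k Ω :=
  ⨆ L ∈ {L : IntermediateField k Ω | FiniteDimensional k L ∧ IsGalois k L ∧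
      (∀ σ τ : L ≃ₐ[k] L, σ * τ = τ * σ) ∧ ∃ x : L, Algebra.norm k x = π}, L

set_option linter.all false

namespace LCFT
open Module

/-! ### Basics on the spectral norm -/
section basics
variable (p : ℕ) [Fact p.Prime] (k : Type) [Field k] [Algebra ℚ_[p] k] [FiniteDimensional ℚ_[p] k]

noncomputable def nu (x : k) : ℝ := spectralNorm ℚ_[p] k x

variable {k}
lemma nu_nonneg (x : k) : 0 ≤ nu p k x := spectralNorm_nonneg x
@[simp] lemma nu_zero : nu p k 0 = 0 := spectralNorm_zero
@[simp] lemma nu_one : nu p k 1 = 1 := spectralNorm_one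
@[simp] lemma nu_mul (x y : k) : nu p k (x * y) = nu p k x * nu p k y :=
  (spectralMulAlgNorm ℚ_[p] k).map_mul' x y
lemma nu_add (x y : k) : nu p k (x + y) ≤ max (nu p k x) (nu p k y) :=
  isNonarchimedean_spectralNorm x y
lemma nu_pos {x : k} (hx : x ≠ 0) : 0 < nu p k x :=
  spectralNorm_zero_lt hx (Algebra.IsAlgebraic.isAlgebraic x)
@[simp] lemma nu_neg (x : k) : nu p k (-x) = nu p k x :=
  spectralNorm_neg (Algebra.IsAlgebraic.isAlgebraic x)
lemma nu_sub (x y : k) : nu p k (x - y) ≤ max (nu p k x) (nu p k y) := by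
  rw [sub_eq_add_neg]; simpa using nu_add p x (-y)
lemma nu_eq_zero {x : k} : nu p k x = 0 ↔ x = 0 :=
  ⟨fun h => by by_contra hx; exact (nu_pos p hx).ne' h, fun h => by simp [h]⟩
@[simp] lemma nu_pow (x : k) (n : ℕ) : nu p k (x ^ n) = nu p k x ^ n := by
  induction n with
  | zero => simp
  | succ n ih => simp [pow_succ, ih]
@[simp] lemma nu_inv (x : k) : nu p k x⁻¹ = (nu p k x)⁻¹ := by
  by_cases hx : x = 0
  · simp [hx]
  · apply eq_inv_of_mul_eq_one_left
    rw [← nu_mul, inv_mul_cancel₀ hx, nu_one]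
@[simp] lemma nu_div (x y : k) : nu p k (x / y) = nu p k x / nu p k y := by
  rw [div_eq_mul_inv, nu_mul, nu_inv, div_eq_mul_inv]
lemma nu_base (x : ℚ_[p]) : nu p k (algebraMap _ k x) = ‖x‖ := spectralNorm_extends x
@[simp] lemma nu_p : nu p k (p : k) = (p : ℝ)⁻¹ := by
  have := nu_base p (k := k) (p : ℚ_[p])
  simpa using this
lemma nu_natCast_le (n : ℕ) : nu p k (n : k) ≤ 1 := by
  have := nu_base p (k := k) (n : ℚ_[p])
  rw [map_natCast] at this
  rw [this]; simpa using Padic.norm_int_le_one (p := p) (n : ℤ)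
lemma nu_sum_le {ι : Type*} (s : Finset ι) (f : ι → k) {C : ℝ} (hC : 0 ≤ C)
    (h : ∀ i ∈ s, nu p k (f i) ≤ C) : nu p k (∑ i ∈ s, f i) ≤ C := by
  classical
  induction s using Finset.induction_on with
  | empty => simpa
  | insert a s ha ih =>
    rw [Finset.sum_insert ha]
    exact (nu_add p _ _).trans (max_le (h a (by simp)) (ih fun i hi => h i (by simp [hi])))
lemma nu_prod {ι : Type*} (s : Finset ι) (f : ι → k) :
    nu p k (∏ i ∈ s, f i) = ∏ i ∈ s, nu p k (f i) := by
  classical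
  induction s using Finset.induction_on with
  | empty => simp
  | insert a s ha ih => simp [Finset.prod_insert ha, ih]

lemma nu_pow_finrank (x : k) : nu p k x ^ (finrank ℚ_[p] k) = ‖Algebra.norm ℚ_[p] x‖ := by
  rw [Algebra.norm_eq_norm_adjoin, norm_pow]
  rw [nu, spectralNorm.spectralNorm_eq_norm_coeff_zero_rpow]
  have hx : IsIntegral ℚ_[p] x := Algebra.IsIntegral.isIntegral x
  have h1 := Algebra.PowerBasis.norm_gen_eq_coeff_zero_minpoly (IntermediateField.adjoin.powerBasis hx)
  rw [IntermediateField.adjoin.powerBasis_gen, IntermediateField.minpoly_gen] at h1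
  rw [h1, norm_mul, norm_pow, norm_neg, norm_one, one_pow, one_mul]
  have h2 : finrank ℚ_[p] k = (minpoly ℚ_[p] x).natDegree *
      finrank (IntermediateField.adjoin ℚ_[p] {x}) k := by
    rw [← IntermediateField.adjoin.finrank hx, finrank_mul_finrank]
  rw [h2, pow_mul, ← Real.rpow_natCast (_ ^ (1 / _ : ℝ)), ← Real.rpow_mul (norm_nonneg _)]
  have : ((minpoly ℚ_[p] x).natDegree : ℝ) ≠ 0 := by
    exact_mod_cast (minpoly.natDegree_pos hx).ne'
  rw [one_div_mul_cancel this, Real.rpow_one]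

variable {L : Type} [Field L] [Algebra ℚ_[p] L] [FiniteDimensional ℚ_[p] L] [Algebra k L]
  [IsScalarTower ℚ_[p] k L]

lemma nu_algebraMap (x : k) : nu p L (algebraMap k L x) = nu p k x :=
  (spectralNorm.eq_of_tower (K := ℚ_[p]) (L := L) x).symm
lemma nu_algEquiv (σ : L ≃ₐ[k] L) (x : L) : nu p L (σ x) = nu p L x := by
  have := spectralNorm_eq_of_equiv (σ.restrictScalars ℚ_[p]) x
  exact this.symm

/-- the normalized (absolute) valuation -/
noncomputable def w (x : k) : ℤ := (Algebra.norm ℚ_[p] x).valuation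

lemma norm_ne_zero' {x : k} (hx : x ≠ 0) : Algebra.norm ℚ_[p] x ≠ 0 := by
  simpa [Algebra.norm_eq_zero_iff] using hx

@[simp] lemma w_one : w p (1 : k) = 0 := by simp [w]
lemma w_mul {x y : k} (hx : x ≠ 0) (hy : y ≠ 0) : w p (x * y) = w p x + w p y := by
  simp only [w, map_mul]
  exact Padic.valuation_mul (norm_ne_zero' p hx) (norm_ne_zero' p hy)
@[simp] lemma w_inv (x : k) : w p (x⁻¹) = - w p x := by
  by_cases hx : x = 0
  · subst hx; simp [w, Algebra.norm_zero]
  have := w_mul p hx (inv_ne_zero hx)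
  rw [mul_inv_cancel₀ hx, w_one] at this
  linarith
lemma w_zpow {x : k} (hx : x ≠ 0) (n : ℤ) : w p (x ^ n) = n * w p x := by
  obtain ⟨m, rfl | rfl⟩ := n.eq_nat_or_neg
  · simp only [w, zpow_natCast, map_pow, Padic.valuation_pow]
  · rw [zpow_neg, w_inv]
    simp only [w, zpow_natCast, map_pow, Padic.valuation_pow]
    ring
lemma w_pow {x : k} (n : ℕ) : w p (x ^ n) = n * w p x := by
  simp only [w, map_pow]
  rw [Padic.valuation_pow]
lemma w_div {x y : k} (hx : x ≠ 0) (hy : y ≠ 0) : w p (x / y) = w p x - w p y := by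
  rw [div_eq_mul_inv, w_mul p hx (inv_ne_zero hy), w_inv]; ring

lemma nu_pow_eq {x : k} (hx : x ≠ 0) : nu p k x ^ (finrank ℚ_[p] k) = (p : ℝ) ^ (- w p x) := by
  rw [nu_pow_finrank, Padic.norm_eq_zpow_neg_valuation (norm_ne_zero' p hx), w]

lemma one_lt_p : (1 : ℝ) < p := by exact_mod_cast (Fact.out : p.Prime).one_lt

lemma nu_le_one_iff {x : k} (hx : x ≠ 0) : nu p k x ≤ 1 ↔ 0 ≤ w p x := by
  have hd : finrank ℚ_[p] k ≠ 0 := finrank_pos.ne'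
  rw [← pow_le_one_iff_of_nonneg (nu_nonneg p x) hd, nu_pow_eq p hx,
    zpow_le_one_iff_right₀ (one_lt_p p)]
  omega
lemma nu_lt_one_iff {x : k} (hx : x ≠ 0) : nu p k x < 1 ↔ 0 < w p x := by
  have hd : finrank ℚ_[p] k ≠ 0 := finrank_pos.ne'
  rw [← pow_lt_one_iff_of_nonneg (nu_nonneg p x) hd, nu_pow_eq p hx,
    zpow_lt_one_iff_right₀ (one_lt_p p)]
  omega
lemma nu_eq_one_iff {x : k} (hx : x ≠ 0) : nu p k x = 1 ↔ w p x = 0 := by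
  have h1 := nu_le_one_iff p hx
  have h2 := nu_lt_one_iff p hx
  constructor
  · intro h
    have a := h1.1 h.le
    have b := h2.not.1 (by simp [h])
    omega
  · intro h
    have a := h1.2 h.ge
    have b := h2.not.2 (by simp [h])
    exact le_antisymm a (not_lt.1 b)

lemma w_norm (x : L) : w p (Algebra.norm k x) = w p x := by
  haveI : FiniteDimensional k L := FiniteDimensional.right ℚ_[p] k L
  simp only [w, Algebra.norm_norm]

lemma w_algebraMap {x : k} : w p (algebraMap k L x) = finrank k L * w p x := by
  haveI : FiniteDimensional k L := FiniteDimensional.right ℚ_[p] k L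
  rw [← w_norm p (k := k), Algebra.norm_algebraMap, w_pow]

lemma w_p : w p (p : k) = finrank ℚ_[p] k := by
  have := w_algebraMap p (k := ℚ_[p]) (L := k) (x := (p : ℚ_[p]))
  rw [map_natCast] at this
  rw [this]
  have : w p (p : ℚ_[p]) = 1 := by
    simp [w, Algebra.norm_self]
  rw [this, mul_one]

lemma p_ne_zero : (p : k) ≠ 0 := by
  have := (nu_p p (k := k))
  intro h
  rw [h, nu_zero] at this
  have := one_lt_p p
  have h3 : (p:ℝ)⁻¹ ≠ 0 := by positivity
  exact h3 (by linarith)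

variable (k)
lemma exists_w_pos : ∃ n : ℕ, 0 < n ∧ ∃ x : k, x ≠ 0 ∧ w p x = n :=
  ⟨finrank ℚ_[p] k, finrank_pos, p, p_ne_zero p, w_p p⟩

open Classical in
/-- absolute residue degree (as the positive generator of the value group of `w`) -/
noncomputable def fdeg : ℕ := Nat.find (exists_w_pos p k)

lemma fdeg_pos : 0 < fdeg p k := by
  classical exact (Nat.find_spec (exists_w_pos p k)).1
lemma exists_unif : ∃ x : k, x ≠ 0 ∧ w p x = fdeg p k := by
  classical exact (Nat.find_spec (exists_w_pos p k)).2
variable {k}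
lemma fdeg_dvd {x : k} (hx : x ≠ 0) : (fdeg p k : ℤ) ∣ w p x := by
  classical
  obtain ⟨π, hπ, hw⟩ := exists_unif p k
  have hf := fdeg_pos p k
  rw [Int.dvd_iff_emod_eq_zero]
  by_contra hne
  have hpos : 0 < w p x % (fdeg p k : ℤ) :=
    lt_of_le_of_ne (Int.emod_nonneg _ (by omega)) (Ne.symm hne)
  have hlt : w p x % (fdeg p k : ℤ) < fdeg p k := Int.emod_lt_of_pos _ (by omega)
  have hy : x / π ^ (w p x / (fdeg p k : ℤ)) ≠ 0 := div_ne_zero hx (zpow_ne_zero _ hπ)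
  have hwy : w p (x / π ^ (w p x / (fdeg p k : ℤ))) = w p x % (fdeg p k : ℤ) := by
    rw [w_div p hx (zpow_ne_zero _ hπ), w_zpow p hπ, hw, Int.emod_def, mul_comm]
  have := Nat.find_min (exists_w_pos p k) (m := (w p x % (fdeg p k : ℤ)).toNat)
    (by change _ < fdeg p k; omega)
  exact this ⟨by omega, _, hy, by rw [hwy]; omega⟩

/-- relative residue degree divides -/
lemma fdeg_dvd_fdeg : fdeg p k ∣ fdeg p L := by
  obtain ⟨π, hπ, hw⟩ := exists_unif p L
  have h := fdeg_dvd p (k := k) (x := Algebra.norm k π) (by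
    haveI : FiniteDimensional k L := FiniteDimensional.right ℚ_[p] k L
    simpa [Algebra.norm_eq_zero_iff] using hπ)
  rw [w_norm, hw] at h
  exact_mod_cast h
lemma fdeg_dvd_mul : fdeg p L ∣ finrank k L * fdeg p k := by
  obtain ⟨π, hπ, hw⟩ := exists_unif p k
  have h := fdeg_dvd p (k := L) (x := algebraMap k L π) (by simpa using hπ)
  rw [w_algebraMap, hw] at h
  exact_mod_cast h
end basics
end LCFT

namespace LCFT
open Module

section integers
variable (p : ℕ) [Fact p.Prime] (k : Type) [Field k] [Algebra ℚ_[p] k] [FiniteDimensional ℚ_[p] k]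

/-- the valuation ring -/
noncomputable def 𝒪 : ValuationSubring k where
  carrier := {x | nu p k x ≤ 1}
  mul_mem' {x y} hx hy := by
    simp only [Set.mem_setOf_eq, nu_mul] at *
    exact mul_le_one₀ hx (nu_nonneg p y) hy
  one_mem' := by simp
  add_mem' {x y} hx hy := (nu_add p x y).trans (max_le hx hy)
  zero_mem' := by simp
  neg_mem' {x} hx := by simpa using hx
  mem_or_inv_mem' x := by
    simp only [Set.mem_setOf_eq, nu_inv]
    rcases le_total (nu p k x) 1 with h | h
    · exact Or.inl h
    · exact Or.inr (inv_le_one_of_one_le₀ h)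

variable {k}
lemma mem_𝒪 {x : k} : x ∈ 𝒪 p k ↔ nu p k x ≤ 1 := Iff.rfl

lemma integral_iff [Algebra ℤ_[p] k] [IsScalarTower ℤ_[p] ℚ_[p] k] (x : k) :
    IsIntegral ℤ_[p] x ↔ nu p k x ≤ 1 := by
  constructor
  · intro h
    by_cases hx0 : x = 0
    · simp [hx0]
    rw [nu_le_one_iff p hx0, w, ← Padic.norm_le_one_iff_val_nonneg]
    have h1 : IsIntegral ℤ_[p] (Algebra.norm ℚ_[p] x) := Algebra.isIntegral_norm ℚ_[p] h
    obtain ⟨y, hy⟩ := IsIntegrallyClosed.isIntegral_iff.1 h1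
    rw [← hy]
    exact y.2
  · intro h
    set P := minpoly ℚ_[p] x
    have hP : P.Monic := minpoly.monic (Algebra.IsIntegral.isIntegral x)
    have hcoef : ∀ n, ‖P.coeff n‖ ≤ 1 := by
      intro n
      rcases lt_trichotomy n P.natDegree with hn | hn | hn
      · have h1 : spectralValueTerms P n ≤ 1 :=
          (le_ciSup (spectralValueTerms_bddAbove P) n).trans h
        rw [spectralValueTerms_of_lt_natDegree _ hn] at h1
        by_contra hlt
        push Not at hlt
        have : (0:ℝ) < 1 / (P.natDegree - n : ℝ) := by
          apply one_div_pos.2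
          have : (n:ℝ) < P.natDegree := by exact_mod_cast hn
          linarith
        exact absurd (Real.one_lt_rpow hlt this) (not_lt.2 h1)
      · subst hn
        rw [hP.coeff_natDegree]; simp
      · rw [Polynomial.coeff_eq_zero_of_natDegree_lt hn]; simp
    have hl : P ∈ Polynomial.lifts (algebraMap ℤ_[p] ℚ_[p]) := by
      rw [Polynomial.lifts_iff_coeff_lifts]
      intro n
      exact ⟨⟨P.coeff n, hcoef n⟩, rfl⟩
    obtain ⟨Q, hQ, -, hQm⟩ := Polynomial.lifts_and_natDegree_eq_and_monic hl hP
    refine ⟨Q, hQm, ?_⟩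
    have : Polynomial.aeval x (Q.map (algebraMap ℤ_[p] ℚ_[p])) = 0 := by
      rw [hQ]; exact minpoly.aeval _ _
    rw [Polynomial.aeval_map_algebraMap] at this
    exact this

lemma card_padicInt_quot {a : ℤ_[p]} (ha : a ≠ 0) :
    Nat.card (ℤ_[p] ⧸ Ideal.span {a}) = p ^ a.valuation := by
  have h1 : Ideal.span {a} = Ideal.span {(p : ℤ_[p]) ^ a.valuation} := by
    rw [Ideal.span_singleton_eq_span_singleton]
    have h := PadicInt.unitCoeff_spec ha
    generalize PadicInt.unitCoeff ha = u at h
    refine Associated.symm ⟨u, ?_⟩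
    rw [mul_comm]; exact h.symm
  rw [h1, ← PadicInt.ker_toZModPow]
  have e := RingHom.quotientKerEquivOfSurjective
    (ZMod.ringHom_surjective (PadicInt.toZModPow (p := p) a.valuation))
  rw [Nat.card_congr e.toEquiv, Nat.card_zmod]

lemma card_quot_aux {S : Type} [CommRing S] [IsDomain S] [Algebra ℤ_[p] S] [Module.Free ℤ_[p] S]
    [Module.Finite ℤ_[p] S] {x : S} (hx : x ≠ 0) :
    Nat.card (S ⧸ Ideal.span {x}) = p ^ (Algebra.norm ℤ_[p] x).valuation := by
  let b := Module.Free.chooseBasis ℤ_[p] S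
  have hI := Ideal.span_singleton_eq_bot.not.2 hx
  rw [Nat.card_congr (Ideal.quotientEquivPiSpan (Ideal.span {x}) b hI).toEquiv, Nat.card_pi]
  have hc : ∀ i, Ideal.smithCoeffs b (Ideal.span {x}) hI i ≠ 0 := fun i =>
    Ideal.smithCoeffs_ne_zero b _ hI i
  simp_rw [fun i => card_padicInt_quot p (hc i)]
  rw [Finset.prod_pow_eq_pow_sum]
  congr 1
  have ha := associated_norm_prod_smith b hx
  have hval : ∀ {a c : ℤ_[p]}, a ≠ 0 → Associated a c → a.valuation = c.valuation := by
    rintro a c ha0 ⟨u, rfl⟩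
    have hn : ‖a * u‖ = ‖a‖ := by rw [norm_mul, PadicInt.norm_units, mul_one]
    have hc0 : a * (u : ℤ_[p]) ≠ 0 := by simp [ha0]
    rw [PadicInt.norm_eq_zpow_neg_valuation ha0, PadicInt.norm_eq_zpow_neg_valuation hc0] at hn
    have := zpow_right_injective₀ (by linarith [one_lt_p p] : (0:ℝ) < p) (one_lt_p p).ne' hn
    simp at this
    omega
  have h0 : ∏ i, Ideal.smithCoeffs b (Ideal.span {x}) hI i ≠ 0 :=
    Finset.prod_ne_zero_iff.2 fun i _ => hc i
  rw [← hval h0 ha.symm]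
  have : ∀ s : Finset (Module.Free.ChooseBasisIndex ℤ_[p] S),
      ∑ i ∈ s, (Ideal.smithCoeffs b (Ideal.span {x}) hI i).valuation
        = (∏ i ∈ s, Ideal.smithCoeffs b (Ideal.span {x}) hI i).valuation := by
    classical
    intro s
    induction s using Finset.induction_on with
    | empty => simp
    | insert a s ha ih =>
      rw [Finset.sum_insert ha, Finset.prod_insert ha, PadicInt.valuation_mul (hc a)
        (Finset.prod_ne_zero_iff.2 fun i _ => hc i), ih]
  exact this _

/-- size of quotients of the valuation ring -/
lemma card_quot {x : 𝒪 p k} (hx : x ≠ 0) :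
    (Nat.card (𝒪 p k ⧸ Ideal.span {x}) : ℤ) = (p : ℤ) ^ (w p (x : k)).toNat ∧ 0 ≤ w p (x : k) := by
  letI : Algebra ℤ_[p] k := ((algebraMap ℚ_[p] k).comp (algebraMap ℤ_[p] ℚ_[p])).toAlgebra
  haveI : IsScalarTower ℤ_[p] ℚ_[p] k := IsScalarTower.of_algebraMap_eq fun _ => rfl
  let S := integralClosure ℤ_[p] k
  haveI : Module.Free ℤ_[p] S := by
    haveI : IsTorsionFree ℤ_[p] k := IsTorsionFree.trans_faithfulSMul ℤ_[p] ℚ_[p] k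
    exact IsIntegralClosure.module_free ℤ_[p] ℚ_[p] k S
  haveI : Module.Finite ℤ_[p] S := IsIntegralClosure.finite ℤ_[p] ℚ_[p] k S
  have hS : S.toSubring = (𝒪 p k).toSubring := by
    ext y
    exact integral_iff p y
  let e : S ≃+* 𝒪 p k := RingEquiv.subringCongr hS
  have he : ∀ y, ((e y : 𝒪 p k) : k) = y := fun y => rfl
  obtain ⟨y, rfl⟩ := e.surjective x
  have hy : y ≠ 0 := by rintro rfl; simp at hx
  have hq : (S ⧸ Ideal.span {y}) ≃+* (𝒪 p k ⧸ Ideal.span {e y}) :=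
    Ideal.quotientEquiv _ _ e (by rw [Ideal.map_span]; simp)
  rw [← Nat.card_congr hq.toEquiv, card_quot_aux p hy, he]
  haveI : IsLocalization (Algebra.algebraMapSubmonoid S (nonZeroDivisors ℤ_[p])) k :=
    IsIntegralClosure.isLocalization ℤ_[p] ℚ_[p] k S
  have hnorm : Algebra.norm ℚ_[p] (y : k) = ((Algebra.norm ℤ_[p] y : ℤ_[p]) : ℚ_[p]) :=
    Algebra.norm_localization ℤ_[p] (nonZeroDivisors ℤ_[p]) (Rₘ := ℚ_[p]) (Sₘ := k) y
  have : w p (y : k) = (Algebra.norm ℤ_[p] y : ℤ_[p]).valuation := by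
    rw [w, hnorm, PadicInt.valuation_coe]
  rw [this]
  simp
end integers
end LCFT

namespace LCFT
open Module

section resid
variable (p : ℕ) [Fact p.Prime] {k : Type} [Field k] [Algebra ℚ_[p] k] [FiniteDimensional ℚ_[p] k]

lemma isUnit_𝒪 {x : 𝒪 p k} : IsUnit x ↔ nu p k (x : k) = 1 := by
  constructor
  · rintro ⟨u, rfl⟩
    have h1 : nu p k ((u : 𝒪 p k) : k) ≤ 1 := (u : 𝒪 p k).2
    have h2 : nu p k ((↑u⁻¹ : 𝒪 p k) : k) ≤ 1 := ((u⁻¹ : (𝒪 p k)ˣ) : 𝒪 p k).2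
    have h3 : nu p k ((u : 𝒪 p k) : k) * nu p k ((↑u⁻¹ : 𝒪 p k) : k) = 1 := by
      rw [← nu_mul, ← MulMemClass.coe_mul, Units.mul_inv]; simp
    have := nu_nonneg p ((u : 𝒪 p k) : k)
    have := nu_nonneg p ((↑u⁻¹ : 𝒪 p k) : k)
    nlinarith
  · intro h
    have hx : (x : k) ≠ 0 := by
      intro h0; rw [h0] at h; simp at h
    refine IsUnit.of_mul_eq_one ⟨(x : k)⁻¹, ?_⟩ ?_
    · rw [mem_𝒪, nu_inv, h]; simp
    · ext; simp [hx]

lemma mem_max {x : 𝒪 p k} : x ∈ IsLocalRing.maximalIdeal (𝒪 p k) ↔ nu p k (x : k) < 1 := by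
  rw [IsLocalRing.mem_maximalIdeal, mem_nonunits_iff, isUnit_𝒪]
  have h : nu p k (x : k) ≤ 1 := x.2
  constructor
  · intro h1; exact lt_of_le_of_ne h h1
  · intro h1; exact h1.ne

lemma nu_le_of_w_le {x y : k} (hx : x ≠ 0) (hy : y ≠ 0) (h : w p y ≤ w p x) :
    nu p k x ≤ nu p k y := by
  have h1 : nu p k (x / y) ≤ 1 := by
    rw [nu_le_one_iff p (div_ne_zero hx hy), w_div p hx hy]; omega
  rw [nu_div, div_le_one (nu_pos p hy)] at h1
  exact h1

lemma max_eq_span {π : 𝒪 p k} (hπ0 : π ≠ 0) (hπ : w p (π : k) = fdeg p k) :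
    IsLocalRing.maximalIdeal (𝒪 p k) = Ideal.span {π} := by
  have hπ0' : (π : k) ≠ 0 := by simpa using hπ0
  have hf := fdeg_pos p k
  apply le_antisymm
  · intro x hx
    rw [mem_max] at hx
    rw [Ideal.mem_span_singleton]
    by_cases hx0 : x = 0
    · simp [hx0]
    have hx0' : (x : k) ≠ 0 := by simpa using hx0
    rw [nu_lt_one_iff p hx0'] at hx
    obtain ⟨c, hc⟩ := fdeg_dvd p hx0'
    have : 0 < c := by
      rw [hc] at hx
      exact pos_of_mul_pos_right hx (by positivity)
    refine ⟨⟨(x : k) / π, ?_⟩, ?_⟩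
    · rw [mem_𝒪, nu_le_one_iff p (div_ne_zero hx0' hπ0'), w_div p hx0' hπ0', hc, hπ]
      nlinarith
    · ext; push_cast; field_simp
  · rw [Ideal.span_singleton_le_iff_mem, mem_max, nu_lt_one_iff p hπ0', hπ]
    exact_mod_cast hf

variable (k)
/-- residue cardinality -/
noncomputable def qk : ℕ := p ^ fdeg p k
lemma card_resid : Nat.card (IsLocalRing.ResidueField (𝒪 p k)) = qk p k := by
  obtain ⟨π, hπ0, hπ⟩ := exists_unif p k
  have hf := fdeg_pos p k
  have hm : π ∈ 𝒪 p k := by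
    rw [mem_𝒪, nu_le_one_iff p hπ0, hπ]; positivity
  have h0 : (⟨π, hm⟩ : 𝒪 p k) ≠ 0 := by
    intro h; exact hπ0 (congrArg Subtype.val h)
  have h1 := card_quot p h0
  have h2 := max_eq_span p h0 hπ
  unfold IsLocalRing.ResidueField
  rw [h2]
  have := h1.1
  simp only [hπ] at this
  rw [qk]
  exact_mod_cast this

lemma one_lt_qk : 1 < qk p k := Nat.one_lt_pow (fdeg_pos p k).ne' (Fact.out : p.Prime).one_lt
instance finite_resid : Finite (IsLocalRing.ResidueField (𝒪 p k)) := by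
  apply Nat.finite_of_card_ne_zero
  rw [card_resid]
  have := one_lt_qk p k
  omega
lemma finite_quot (j : ℕ) : Finite (𝒪 p k ⧸ Ideal.span {((p : 𝒪 p k)) ^ j}) := by
  apply Nat.finite_of_card_ne_zero
  have h0 : ((p : 𝒪 p k)) ^ j ≠ 0 := by
    apply pow_ne_zero
    intro h
    apply p_ne_zero p (k := k)
    have := congrArg Subtype.val h
    simpa using this
  have := (card_quot p h0).1
  intro h
  rw [h] at this
  have hp := (Fact.out : p.Prime).pos
  have : (0 : ℤ) < (p : ℤ) ^ (w p (((p : 𝒪 p k) ^ j : 𝒪 p k) : k)).toNat := by positivity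
  omega
variable {k}

/-- the unit group -/
noncomputable def U (k : Type) [Field k] [Algebra ℚ_[p] k] [FiniteDimensional ℚ_[p] k] : Subgroup kˣ where
  carrier := {x | nu p k (x : k) = 1}
  mul_mem' {x y} hx hy := by
    simp only [Set.mem_setOf_eq] at *
    rw [Units.val_mul, nu_mul, hx, hy, one_mul]
  one_mem' := by simp
  inv_mem' {x} hx := by
    simp only [Set.mem_setOf_eq] at *
    rw [Units.val_inv_eq_inv_val, nu_inv, hx, inv_one]
lemma mem_U {x : kˣ} : x ∈ U p k ↔ nu p k (x : k) = 1 := Iff.rfl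
lemma mem_U_iff {x : kˣ} : x ∈ U p k ↔ w p (x : k) = 0 := nu_eq_one_iff p x.ne_zero

/-- `1 + p^j 𝒪` -/
noncomputable def Uj (k : Type) [Field k] [Algebra ℚ_[p] k] [FiniteDimensional ℚ_[p] k] (j : ℕ) :
    Subgroup kˣ where
  carrier := {x | nu p k (x : k) = 1 ∧ nu p k ((x : k) - 1) ≤ ((p : ℝ)⁻¹) ^ j}
  mul_mem' {x y} hx hy := by
    simp only [Set.mem_setOf_eq] at *
    refine ⟨by rw [Units.val_mul, nu_mul, hx.1, hy.1, one_mul], ?_⟩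
    have : ((x * y : kˣ) : k) - 1 = x * (y - 1) + (x - 1) := by push_cast; ring
    rw [this]
    refine (nu_add p _ _).trans (max_le ?_ hx.2)
    rw [nu_mul, hx.1, one_mul]; exact hy.2
  one_mem' := by simp
  inv_mem' {x} hx := by
    simp only [Set.mem_setOf_eq] at *
    refine ⟨by rw [Units.val_inv_eq_inv_val, nu_inv, hx.1, inv_one], ?_⟩
    have : ((x⁻¹ : kˣ) : k) - 1 = - ((x : k)⁻¹ * (x - 1)) := by
      have := x.ne_zero
      push_cast; field_simp; ring
    rw [this, nu_neg, nu_mul, nu_inv, hx.1]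
    simpa using hx.2
lemma mem_Uj {j : ℕ} {x : kˣ} : x ∈ Uj p k j ↔
  nu p k (x : k) = 1 ∧ nu p k ((x : k) - 1) ≤ ((p : ℝ)⁻¹) ^ j := Iff.rfl
lemma Uj_le_U (j : ℕ) : Uj p k j ≤ U p k := fun x hx => hx.1

lemma Uj_anti {i j : ℕ} (h : i ≤ j) : Uj p k j ≤ Uj p k i := fun x hx =>
  ⟨hx.1, hx.2.trans (pow_le_pow_of_le_one (by have := one_lt_p p; positivity)
    (inv_le_one_of_one_le₀ (one_lt_p p).le) h)⟩

lemma nu_eq_one_of_sub {x : k} (h : nu p k (x - 1) < 1) : nu p k x = 1 := by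
  have h1 : nu p k x ≤ 1 := by
    have := nu_add p (x - 1) 1
    rw [sub_add_cancel] at this
    exact this.trans (max_le h.le (by simp))
  by_contra hne
  have h2 : nu p k x < 1 := lt_of_le_of_ne h1 hne
  have := nu_sub p x (x - 1)
  rw [sub_sub_cancel, nu_one] at this
  exact absurd this (not_le.2 (max_lt h2 h))

lemma inv_p_pow_lt {j : ℕ} (hj : j ≠ 0) : ((p : ℝ)⁻¹) ^ j < 1 :=
  pow_lt_one₀ (by have := one_lt_p p; positivity) (inv_lt_one_of_one_lt₀ (one_lt_p p)) hj

lemma mem_Uj' {j : ℕ} (hj : j ≠ 0) {x : kˣ} : x ∈ Uj p k j ↔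
    nu p k ((x : k) - 1) ≤ ((p : ℝ)⁻¹) ^ j :=
  ⟨fun h => h.2, fun h => ⟨nu_eq_one_of_sub p (h.trans_lt (inv_p_pow_lt p hj)), h⟩⟩

lemma le_pow_iff {j : ℕ} {x : k} : nu p k x ≤ ((p : ℝ)⁻¹) ^ j ↔ ∃ y, nu p k y ≤ 1 ∧ x = p ^ j * y := by
  have hp : (p : k) ≠ 0 := p_ne_zero p
  have hp' : (0:ℝ) < p := by linarith [one_lt_p p]
  constructor
  · intro h
    refine ⟨x / p ^ j, ?_, by field_simp⟩
    rw [nu_div, nu_pow, nu_p]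
    exact (div_le_one (by positivity)).2 h
  · rintro ⟨y, hy, rfl⟩
    rw [nu_mul, nu_pow, nu_p]
    exact mul_le_of_le_one_right (by positivity) hy

/-- `Uj` has finite index in `U` -/
lemma finiteIndex_Uj (j : ℕ) : (Uj p k j).relIndex (U p k) ≠ 0 := by
  haveI := finite_quot p k j
  let F : U p k → (𝒪 p k ⧸ Ideal.span {((p : 𝒪 p k)) ^ j}) := fun x =>
    Ideal.Quotient.mk _ ⟨((x : kˣ) : k), (show nu p k _ ≤ 1 from (x.2 : nu p k _ = 1).le)⟩
  have hF : ∀ x y, F x = F y → (x : kˣ)⁻¹ * y ∈ Uj p k j := by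
    intro x y h
    have hx : nu p k ((x : kˣ) : k) = 1 := x.2
    have hy : nu p k ((y : kˣ) : k) = 1 := y.2
    rw [eq_comm, Ideal.Quotient.eq, Ideal.mem_span_singleton] at h
    obtain ⟨z, hz⟩ := h
    have hz' : ((y : kˣ) : k) - ((x : kˣ) : k) = p ^ j * z := by
      have := congrArg Subtype.val hz
      simpa using this
    refine ⟨by rw [Units.val_mul, Units.val_inv_eq_inv_val, nu_mul, nu_inv, hx, hy]; simp, ?_⟩
    have h3 : (((x : kˣ)⁻¹ * (y : kˣ) : kˣ) : k) - 1 = p ^ j * (((x : kˣ) : k)⁻¹ * z) := by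
      have h0 := (x : kˣ).ne_zero
      rw [mul_left_comm, ← hz']
      push_cast
      field_simp
    rw [h3, le_pow_iff]
    refine ⟨_, ?_, rfl⟩
    rw [nu_mul, nu_inv, hx, inv_one, one_mul]; exact z.2
  have : Finite (U p k ⧸ (Uj p k j).subgroupOf (U p k)) := by
    have hsurj : Function.Injective (fun c : U p k ⧸ (Uj p k j).subgroupOf (U p k) => F c.out) := by
      intro a b hab
      have := hF _ _ hab
      rw [← Quotient.out_eq' a, ← Quotient.out_eq' b]
      apply QuotientGroup.eq.2
      exact this
    exact Finite.of_injective _ hsurj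
  rw [Subgroup.relIndex, Subgroup.index]
  exact Nat.card_ne_zero.2 ⟨⟨1⟩, this⟩
/-- deep roots -/
lemma deep_roots (n : ℕ) (hn : n ≠ 0) (m : ℕ) : ∃ j, ∀ x ∈ Uj p k j, ∃ z ∈ Uj p k m, z ^ n = x := by
  wlog hm : m ≠ 0 generalizing m
  · obtain ⟨j, hj⟩ := this 1 one_ne_zero
    refine ⟨j, fun x hx => ?_⟩
    obtain ⟨z, hz, h⟩ := hj x hx
    exact ⟨z, Uj_anti p (by omega) hz, h⟩
  letI : NontriviallyNormedField k := spectralNorm.nontriviallyNormedField ℚ_[p] k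
  haveI : CompleteSpace k := spectralNorm.completeSpace ℚ_[p] k
  have hnorm : ∀ x : k, ‖x‖ = nu p k x := fun x => rfl
  haveI : CharZero k := charZero_of_injective_algebraMap (algebraMap ℚ_[p] k).injective
  have hd : HasStrictDerivAt (fun x : k => x ^ n) (n * (1:k) ^ (n - 1)) 1 := by
    simpa using hasStrictDerivAt_pow n (1 : k)
  have hd0 : (n : k) * (1:k) ^ (n - 1) ≠ 0 := by simpa using hn
  have hmap := hd.map_nhds_eq hd0
  have hp' : (0:ℝ) < p := by linarith [one_lt_p p]
  have hV : Metric.closedBall (1 : k) (((p : ℝ)⁻¹) ^ m) ∈ nhds (1 : k) :=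
    Metric.closedBall_mem_nhds _ (by positivity)
  have h2 := Filter.image_mem_map (m := fun x : k => x ^ n) hV
  rw [hmap, one_pow, Metric.mem_nhds_iff] at h2
  obtain ⟨ε, hε, hsub⟩ := h2
  obtain ⟨j, hj⟩ := exists_pow_lt_of_lt_one hε (inv_lt_one_of_one_lt₀ (one_lt_p p))
  refine ⟨j, fun x hx => ?_⟩
  have hxb : (x : k) ∈ Metric.ball (1 : k) ε := by
    rw [Metric.mem_ball, dist_eq_norm, hnorm]
    exact hx.2.trans_lt hj
  obtain ⟨z, hz, hzx⟩ := hsub hxb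
  rw [Metric.mem_closedBall, dist_eq_norm, hnorm] at hz
  simp only at hzx
  have hz0 : z ≠ 0 := by
    rintro rfl
    rw [zero_pow hn] at hzx
    exact x.ne_zero hzx.symm
  refine ⟨Units.mk0 z hz0, (mem_Uj' p hm).2 hz, ?_⟩
  ext; simpa using hzx
end resid
end LCFT

namespace LCFT
open Module

section tors
variable (p : ℕ) [Fact p.Prime] {k : Type} [Field k] [Algebra ℚ_[p] k] [FiniteDimensional ℚ_[p] k]

lemma nu_prime_ge {l : ℕ} (hl : l.Prime) : (p : ℝ)⁻¹ ≤ nu p k (l : k) := by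
  by_cases h : l = p
  · rw [h, nu_p]
  have h1 : nu p k (l : k) = 1 := by
    have h2 := nu_base p (k := k) (l : ℚ_[p])
    rw [map_natCast] at h2
    rw [h2]
    apply Padic.norm_natCast_eq_one_iff.2
    exact (Nat.coprime_primes (Fact.out : p.Prime) hl).2 (Ne.symm h)
  rw [h1]
  exact inv_le_one_of_one_le₀ (one_lt_p p).le

lemma U2_torsion_prime {l : ℕ} (hl : l.Prime) {x : kˣ} (hx : x ∈ Uj p k 2) (h : x ^ l = 1) : x = 1 := by
  by_contra hne
  have hy : (x : k) - 1 ≠ 0 := by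
    intro h0; apply hne; ext; simpa [sub_eq_zero] using h0
  have hg : (∑ i ∈ Finset.range l, (x : k) ^ i) * ((x : k) - 1) = 0 := by
    rw [geom_sum_mul]
    have := congrArg Units.val h
    simpa [sub_eq_zero] using this
  have hs : ∑ i ∈ Finset.range l, (x : k) ^ i = 0 := (mul_eq_zero.1 hg).resolve_right hy
  have hl' : (l : k) = - ∑ i ∈ Finset.range l, ((x : k) ^ i - 1) := by
    rw [Finset.sum_sub_distrib, hs]; simp
  have hp' : (1:ℝ) < p := one_lt_p p
  have h1 : nu p k (l : k) ≤ ((p : ℝ)⁻¹) ^ 2 := by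
    rw [hl', nu_neg]
    apply nu_sum_le p _ _ (by positivity)
    intro i _
    have := (Uj p k 2).pow_mem hx i
    simpa using this.2
  have h2 := (nu_prime_ge p (k := k) hl).trans h1
  have h3 : ((p : ℝ)⁻¹) ^ 2 < (p : ℝ)⁻¹ := by
    rw [sq]
    have : (p : ℝ)⁻¹ < 1 := inv_lt_one_of_one_lt₀ hp'
    have h0 : 0 < (p : ℝ)⁻¹ := by positivity
    nlinarith
  linarith

lemma U2_torsion {n : ℕ} (hn : 0 < n) {x : kˣ} (hx : x ∈ Uj p k 2) (h : x ^ n = 1) : x = 1 := by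
  induction n using Nat.strong_induction_on generalizing x with
  | _ n ih =>
    by_cases h1 : n = 1
    · simpa [h1] using h
    obtain ⟨l, hl, m, rfl⟩ := Nat.exists_prime_and_dvd h1
    have hm : 0 < m := Nat.pos_of_mul_pos_left hn |> fun _ => by
      rcases Nat.eq_zero_or_pos m with h0 | h0
      · simp [h0] at hn
      · exact h0
    have := ih m (by have := hl.one_lt; nlinarith) hm ((Uj p k 2).pow_mem hx l) (by rw [← pow_mul]; exact h)
    exact U2_torsion_prime p hl hx this

lemma torsion_mem_U {n : ℕ} (hn : 0 < n) {x : kˣ} (h : x ^ n = 1) : x ∈ U p k := by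
  rw [mem_U]
  have h1 : nu p k (x : k) ^ n = 1 := by
    rw [← nu_pow, ← Units.val_pow_eq_pow_val, h]; simp
  exact (pow_eq_one_iff_of_nonneg (nu_nonneg p _) hn.ne').1 h1

lemma finite_torsion (p : ℕ) [Fact p.Prime] (k : Type) [Field k] [Algebra ℚ_[p] k] [FiniteDimensional ℚ_[p] k] : Finite {x : k // ∃ n : ℕ, 0 < n ∧ x ^ n = 1} := by
  have hfi := finiteIndex_Uj p (k := k) 2
  rw [Subgroup.relIndex] at hfi
  have hfin : Finite (U p k ⧸ (Uj p k 2).subgroupOf (U p k)) := by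
    exact Nat.finite_of_card_ne_zero hfi
  have hne : ∀ x : {x : k // ∃ n : ℕ, 0 < n ∧ x ^ n = 1}, (x : k) ≠ 0 := by
    rintro ⟨x, n, hn, hx⟩ h0
    simp only at h0
    rw [h0, zero_pow hn.ne'] at hx
    exact zero_ne_one hx
  let u : {x : k // ∃ n : ℕ, 0 < n ∧ x ^ n = 1} → kˣ := fun x => Units.mk0 x (hne x)
  have hu : ∀ x, ∃ n, 0 < n ∧ u x ^ n = 1 := fun x => by
    obtain ⟨n, hn, h⟩ := x.2
    exact ⟨n, hn, by ext; simpa [u] using h⟩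
  have huU : ∀ x, u x ∈ U p k := fun x => by
    obtain ⟨n, hn, h⟩ := hu x
    exact torsion_mem_U p hn h
  refine Finite.of_injective (fun x => (QuotientGroup.mk (⟨u x, huU x⟩ : U p k) :
    U p k ⧸ (Uj p k 2).subgroupOf (U p k))) ?_
  intro x y hxy
  have h1 := QuotientGroup.eq.1 hxy
  have h2 : (u x)⁻¹ * u y ∈ Uj p k 2 := h1
  obtain ⟨n, hn, hx⟩ := hu x
  obtain ⟨m, hm, hy⟩ := hu y
  have h3 : (u x)⁻¹ * u y = 1 := by
    apply U2_torsion p (Nat.mul_pos hn hm) h2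
    rw [mul_pow, inv_pow, pow_mul, hx, mul_comm n m, pow_mul, hy]; simp
  have h4 : u x = u y := by rw [inv_mul_eq_one] at h3; exact h3
  have := congrArg Units.val h4
  exact Subtype.ext this

lemma torsion_pow_card (p : ℕ) [Fact p.Prime] {k : Type} [Field k] [Algebra ℚ_[p] k] [FiniteDimensional ℚ_[p] k] {x : k} {n : ℕ} (hn : 0 < n) (h : x ^ n = 1) :
    x ^ (Nat.card {x : k // ∃ n : ℕ, 0 < n ∧ x ^ n = 1}) = 1 := by
  have hx0 : x ≠ 0 := by
    rintro rfl
    rw [zero_pow hn.ne'] at h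
    exact zero_ne_one h
  haveI := finite_torsion p k
  let e : CommGroup.torsion kˣ ≃ {x : k // ∃ n : ℕ, 0 < n ∧ x ^ n = 1} :=
    { toFun := fun x => ⟨((x : kˣ) : k), by
        obtain ⟨n, hn, hx⟩ := isOfFinOrder_iff_pow_eq_one.1 x.2
        exact ⟨n, hn, by rw [← Units.val_pow_eq_pow_val, hx]; simp⟩⟩
      invFun := fun x => ⟨Units.mk0 (x : k) (by
        obtain ⟨x, n, hn, hx⟩ := x
        rintro h0
        simp only at h0
        rw [h0, zero_pow hn.ne'] at hx
        exact zero_ne_one hx), by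
          obtain ⟨x, n, hn, hx⟩ := x
          exact isOfFinOrder_iff_pow_eq_one.2 ⟨n, hn, by ext; simpa using hx⟩⟩
      left_inv := fun x => by ext; simp
      right_inv := fun x => by ext; simp }
  have h1 : (e.symm ⟨x, n, hn, h⟩) ^ (Nat.card (CommGroup.torsion kˣ)) = 1 := pow_card_eq_one'
  rw [Nat.card_congr e] at h1
  have h2 := congrArg (fun y : CommGroup.torsion kˣ => ((y : kˣ) : k)) h1
  simpa [e] using h2

lemma card_torsion_pos (p : ℕ) [Fact p.Prime] {k : Type} [Field k] [Algebra ℚ_[p] k] [FiniteDimensional ℚ_[p] k] : 0 < Nat.card {x : k // ∃ n : ℕ, 0 < n ∧ x ^ n = 1} := by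
  haveI := finite_torsion p k
  exact Nat.card_pos_iff.2 ⟨⟨⟨1, 1, one_pos, by simp⟩⟩, this⟩

lemma eq_one_of_divisible {x : kˣ} (hx : x ∈ U p k) (h : ∀ n : ℕ, 0 < n → ∃ z : kˣ, z ^ n = x) : x = 1 := by
  have hall : ∀ j, x ∈ Uj p k j := by
    intro j
    have hfi := finiteIndex_Uj p (k := k) j
    set N := (Uj p k j).relIndex (U p k) with hN
    obtain ⟨z, hz⟩ := h N (Nat.pos_of_ne_zero hfi)
    have hzU : z ∈ U p k := by
      rw [mem_U_iff] at hx ⊢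
      rw [← hz, Units.val_pow_eq_pow_val, w_pow] at hx
      rcases mul_eq_zero.1 hx with h | h
      · exact absurd (by exact_mod_cast h) hfi
      · exact h
    have := Subgroup.pow_index_mem ((Uj p k j).subgroupOf (U p k)) ⟨z, hzU⟩
    rw [Subgroup.mem_subgroupOf] at this
    rw [← hz]
    exact this
  have h1 : nu p k ((x : k) - 1) = 0 := by
    refine le_antisymm ?_ (nu_nonneg p _)
    refine ge_of_tendsto' (tendsto_pow_atTop_nhds_zero_of_lt_one (r := (p : ℝ)⁻¹) (by positivity)
      (inv_lt_one_of_one_lt₀ (one_lt_p p))) (fun j => (hall j).2)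
  rw [nu_eq_zero, sub_eq_zero] at h1
  ext; simpa using h1

end tors

section translate
variable (p : ℕ) [Fact p.Prime] {k : Type} [Field k] [Algebra ℚ_[p] k] [FiniteDimensional ℚ_[p] k]
  [Algebra ℤ_[p] k] [IsScalarTower ℤ_[p] ℚ_[p] k]

noncomputable def eqO : integralClosure ℤ_[p] k ≃+* 𝒪 p k :=
  RingEquiv.subringCongr (show (integralClosure ℤ_[p] k).toSubring = (𝒪 p k).toSubring by
    ext y; exact integral_iff p y)
lemma eqO_coe (y : integralClosure ℤ_[p] k) : ((eqO p y : 𝒪 p k) : k) = y := rfl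

variable (k) in
lemma resCard_eq' : Nat.card ((integralClosure ℤ_[p] k) ⧸ ((⊥ : Ideal (integralClosure ℤ_[p] k)).jacobson))
    = qk p k := by
  let e := eqO p (k := k)
  haveI : IsLocalRing (integralClosure ℤ_[p] k) := e.symm.isLocalRing
  rw [IsLocalRing.jacobson_eq_maximalIdeal _ bot_ne_top, ← card_resid]
  exact Nat.card_congr (IsLocalRing.ResidueField.mapEquiv e).toEquiv

lemma w_unif' {π : k} (h : π ∈ integralClosure ℤ_[p] k)
    (hi : Irreducible (⟨π, h⟩ : integralClosure ℤ_[p] k)) : π ≠ 0 ∧ w p π = fdeg p k := by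
  have hi' : Irreducible (eqO p ⟨π, h⟩) := (MulEquiv.irreducible_iff (eqO p)).2 hi
  set y := eqO p ⟨π, h⟩ with hy
  have hyc : (y : k) = π := rfl
  obtain ⟨ϖ, h0, hw⟩ := exists_unif p k
  have hm : ϖ ∈ 𝒪 p k := by
    rw [mem_𝒪, nu_le_one_iff p h0, hw]; positivity
  have h0' : (⟨ϖ, hm⟩ : 𝒪 p k) ≠ 0 := by
    intro h; exact h0 (congrArg Subtype.val h)
  have hmax := max_eq_span p h0' hw
  have hymem : y ∈ IsLocalRing.maximalIdeal (𝒪 p k) := hi'.not_isUnit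
  rw [hmax, Ideal.mem_span_singleton] at hymem
  obtain ⟨c, hc⟩ := hymem
  have hcu : IsUnit c := by
    rcases hi'.isUnit_or_isUnit hc with h1 | h1
    · exfalso
      have : (⟨ϖ, hm⟩ : 𝒪 p k) ∈ IsLocalRing.maximalIdeal (𝒪 p k) := by
        rw [hmax]; exact Ideal.mem_span_singleton_self _
      exact this h1
    · exact h1
  rw [isUnit_𝒪] at hcu
  have hc0 : (c : k) ≠ 0 := by intro h; rw [h] at hcu; simp at hcu
  have hπ : π = ϖ * c := by rw [← hyc, hc]; rfl
  refine ⟨by rw [hπ]; exact mul_ne_zero h0 hc0, ?_⟩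
  rw [hπ, w_mul p h0 hc0, (nu_eq_one_iff p hc0).1 hcu, hw, add_zero]
end translate
end LCFT

namespace LCFT
open Module

section abs
variable {X Y : Type} [CommGroup X] [CommGroup Y]

lemma relIndex_hom (f : X →* Y) (V A : Subgroup X) (h : V ≤ A) :
    V.relIndex A = (V.map f).relIndex (A.map f) * V.relIndex (A ⊓ f.ker) := by
  have h1 : V ≤ A ⊓ (V ⊔ f.ker) := le_inf h le_sup_left
  have hmod : A ⊓ (V ⊔ f.ker) = V ⊔ (A ⊓ f.ker) := by
    rw [inf_comm, sup_inf_assoc_of_le _ h, inf_comm]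
  rw [Subgroup.relIndex_map_map, ← Subgroup.relIndex_mul_relIndex V _ A h1 inf_le_left, mul_comm]
  congr 1
  · rw [inf_comm, Subgroup.inf_relIndex_right]
    rw [show A ⊔ f.ker = A ⊔ (V ⊔ f.ker) by rw [← sup_assoc, sup_eq_left.2 h], Subgroup.relIndex_sup_right]
  · rw [hmod, Subgroup.relIndex_sup_left]

lemma herbrand (N D : X →* X) (V A : Subgroup X) (h : V ≤ A) (hfin : V.relIndex A ≠ 0)
    (hND : ∀ x, N (D x) = 1) (hDN : ∀ x, D (N x) = 1)
    (hNA : A.map N ≤ A) (hDA : A.map D ≤ A) (hNV : V.map N ≤ V) (hDV : V.map D ≤ V)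
    (hV : V ⊓ D.ker ≤ V.map N) (hfin2 : (A.map D).relIndex (A ⊓ N.ker) ≠ 0) :
    (A.map N).relIndex (A ⊓ D.ker) ≠ 0 ∧
    (A.map N).relIndex (A ⊓ D.ker) ≤ (A.map D).relIndex (A ⊓ N.ker) := by
  have e1 := relIndex_hom N V A h
  have e2 := relIndex_hom D V A h
  have hNk : A.map N ≤ A ⊓ D.ker := le_inf hNA (by rintro _ ⟨x, -, rfl⟩; exact hDN x)
  have hDk : A.map D ≤ A ⊓ N.ker := le_inf hDA (by rintro _ ⟨x, -, rfl⟩; exact hND x)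
  have hNV2 : V.map N ≤ A.map N := Subgroup.map_mono h
  have hDV2 : V.map D ≤ A.map D := Subgroup.map_mono h
  have hVD : V.relIndex (A ⊓ D.ker) = (V.map N).relIndex (A ⊓ D.ker) := by
    have : V ⊓ (A ⊓ D.ker) = V.map N := by
      apply le_antisymm
      · exact (inf_le_inf le_rfl inf_le_right).trans hV
      · exact le_inf hNV (hNV2.trans hNk)
    rw [← this, Subgroup.inf_relIndex_right]
  rw [hVD, ← Subgroup.relIndex_mul_relIndex (V.map N) (A.map N) _ hNV2 hNk] at e2
  set a := (V.map N).relIndex (A.map N)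
  set b := (V.map D).relIndex (A.map D)
  set c := (A.map N).relIndex (A ⊓ D.ker)
  have hVN : V.relIndex (A ⊓ N.ker) ≤ (V.map D).relIndex (A ⊓ N.ker) := by
    apply Subgroup.relIndex_le_of_le_left hDV
    rw [← Subgroup.relIndex_mul_relIndex (V.map D) (A.map D) _ hDV2 hDk]
    apply mul_ne_zero _ hfin2
    intro h0
    rw [e2] at hfin
    exact hfin (by simp [b, h0])
  rw [← Subgroup.relIndex_mul_relIndex (V.map D) (A.map D) _ hDV2 hDk] at hVN
  set d := (A.map D).relIndex (A ⊓ N.ker)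
  set g := V.relIndex (A ⊓ N.ker)
  rw [e1] at hfin e2
  have ha : a ≠ 0 := left_ne_zero_of_mul hfin
  have hg : g ≠ 0 := right_ne_zero_of_mul hfin
  have e3 : g = b * c := by
    apply Nat.eq_of_mul_eq_mul_left (Nat.pos_of_ne_zero ha)
    rw [e2]; ring
  have hb : b ≠ 0 := by rw [e3] at hg; exact left_ne_zero_of_mul hg
  have hc : c ≠ 0 := by rw [e3] at hg; exact right_ne_zero_of_mul hg
  refine ⟨hc, ?_⟩
  rw [e3] at hVN
  exact Nat.le_of_mul_le_mul_left hVN (Nat.pos_of_ne_zero hb)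
end abs
end LCFT

namespace LCFT
open Module

section lat
variable (p : ℕ) [Fact p.Prime] (k L : Type) [Field k] [Algebra ℚ_[p] k] [FiniteDimensional ℚ_[p] k]
  [Field L] [Algebra ℚ_[p] L] [FiniteDimensional ℚ_[p] L] [Algebra k L] [IsScalarTower ℚ_[p] k L]
  [FiniteDimensional k L] [IsGalois k L]

lemma exists_pow_bound (C : ℝ) : ∃ c : ℕ, C ≤ (p : ℝ) ^ c := by
  obtain ⟨c, hc⟩ := pow_unbounded_of_one_lt C (one_lt_p p)
  exact ⟨c, hc.le⟩

lemma nu_trace_le (x : L) : nu p k (Algebra.trace k L x) ≤ nu p L x := by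
  rw [← nu_algebraMap p (L := L), trace_eq_sum_automorphisms]
  exact nu_sum_le p _ _ (nu_nonneg p _) (fun σ _ => (nu_algEquiv p σ x).le)

lemma exists_lattice : ∃ (b : Basis (L ≃ₐ[k] L) k L) (c : ℕ), (∀ σ τ : L ≃ₐ[k] L, σ (b τ) = b (σ * τ)) ∧
    (∀ σ, nu p L (b σ) ≤ 1) ∧ ∀ x σ, nu p k (b.repr x σ) ≤ (p : ℝ) ^ c * nu p L x := by
  classical
  obtain ⟨a, ha⟩ := exists_pow_bound p (nu p L (IsGalois.normalBasis k L 1))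
  have hp : (p : k) ≠ 0 := p_ne_zero p
  have hp' : (0 : ℝ) < p := by linarith [one_lt_p p]
  let b := Module.Basis.isUnitSMul (IsGalois.normalBasis k L) (w := fun _ => (p : k) ^ a) (fun _ => (IsUnit.mk0 _ hp).pow a)
  have hb : ∀ σ, b σ = (p : L) ^ a * σ (IsGalois.normalBasis k L 1) := by
    intro σ
    rw [Basis.isUnitSMul_apply, IsGalois.normalBasis_apply, Algebra.smul_def]
    simp
  obtain ⟨c, hc⟩ := exists_pow_bound p (∑ σ, nu p L (b.traceDual σ))
  refine ⟨b, c, ?_, ?_, ?_⟩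
  · intro σ τ
    rw [hb, hb]
    simp
  · intro σ
    rw [hb, nu_mul, nu_pow, nu_p, nu_algEquiv, inv_pow]
    rw [inv_mul_le_iff₀ (by positivity), mul_one]
    exact ha
  · intro x σ
    have h1 : b.repr x σ = Algebra.trace k L (x * b.traceDual σ) := by
      conv_lhs => rw [← b.traceDual_traceDual]
      rw [Module.Basis.traceDual_repr_apply, Algebra.traceForm_apply]
    rw [h1]
    refine (nu_trace_le p k L _).trans ?_
    rw [nu_mul, mul_comm]
    gcongr
    · exact nu_nonneg p x
    · exact (Finset.single_le_sum (fun i _ => nu_nonneg p (b.traceDual i)) (Finset.mem_univ σ)).trans hc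

variable {k L}
variable {b : Basis (L ≃ₐ[k] L) k L} {c : ℕ} 

/-- `p^i Λ` -/
def Lat (b : Basis (L ≃ₐ[k] L) k L) (i : ℕ) : AddSubgroup L where
  carrier := {x | ∀ σ, nu p k (b.repr x σ) ≤ ((p : ℝ)⁻¹) ^ i}
  add_mem' {x y} hx hy σ := by
    rw [map_add, Finsupp.add_apply]
    exact (nu_add p _ _).trans (max_le (hx σ) (hy σ))
  zero_mem' σ := by simp
  neg_mem' {x} hx σ := by
    rw [map_neg, Finsupp.neg_apply, nu_neg]; exact hx σ

lemma mem_Lat {i : ℕ} {x : L} : x ∈ Lat p b i ↔ ∀ σ, nu p k (b.repr x σ) ≤ ((p : ℝ)⁻¹) ^ i := Iff.rfl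

lemma Lat_nu (hb : ∀ σ, nu p L (b σ) ≤ 1) {i : ℕ} {x : L} (h : x ∈ Lat p b i) : nu p L x ≤ ((p : ℝ)⁻¹) ^ i := by
  rw [← b.sum_repr x]
  refine nu_sum_le p _ _ (by positivity) ?_
  intro σ _
  rw [Algebra.smul_def, nu_mul, nu_algebraMap]
  calc _ ≤ ((p : ℝ)⁻¹) ^ i * 1 := by
        gcongr
        · exact nu_nonneg p _
        · exact h σ
        · exact hb σ
    _ = _ := mul_one _

lemma Lat_of_nu (hc : ∀ x σ, nu p k (b.repr x σ) ≤ (p : ℝ) ^ c * nu p L x) {i : ℕ} {x : L}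
    (h : nu p L x ≤ ((p : ℝ)⁻¹) ^ (i + c)) : x ∈ Lat p b i := by
  intro σ
  have hp' : (0 : ℝ) < p := by linarith [one_lt_p p]
  refine (hc x σ).trans ?_
  calc _ ≤ (p : ℝ) ^ c * ((p : ℝ)⁻¹) ^ (i + c) := by gcongr
    _ = _ := by rw [pow_add, inv_pow, inv_pow]; field_simp

lemma Lat_anti {i j : ℕ} (h : i ≤ j) : Lat p b j ≤ Lat p b i := fun x hx σ =>
  (hx σ).trans (pow_le_pow_of_le_one (by have := one_lt_p p; positivity)
    (inv_le_one_of_one_le₀ (one_lt_p p).le) h)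

lemma repr_equiv (hs : ∀ σ τ : L ≃ₐ[k] L, σ (b τ) = b (σ * τ)) (σ τ : L ≃ₐ[k] L) (x : L) :
    b.repr (σ x) τ = b.repr x (σ⁻¹ * τ) := by
  classical
  conv_lhs => rw [← b.sum_repr x]
  rw [map_sum, map_sum, Finsupp.finsetSum_apply]
  rw [Finset.sum_eq_single (σ⁻¹ * τ)]
  · rw [map_smul, hs, mul_inv_cancel_left, map_smul, Basis.repr_self]; simp
  · intro ρ _ hρ
    rw [map_smul, hs, map_smul, Basis.repr_self]
    have : σ * ρ ≠ τ := by rintro rfl; simp at hρ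
    simp [Finsupp.single_apply, this]
  · simp

lemma Lat_equiv (hs : ∀ σ τ : L ≃ₐ[k] L, σ (b τ) = b (σ * τ)) (σ : L ≃ₐ[k] L) {i : ℕ} {x : L}
    (h : x ∈ Lat p b i) : σ x ∈ Lat p b i := by
  intro τ
  rw [repr_equiv hs]; exact h _

/-- fixed elements of the lattice -/
lemma Lat_fixed (hs : ∀ σ τ : L ≃ₐ[k] L, σ (b τ) = b (σ * τ)) {i : ℕ} {x : k}
    (h : algebraMap k L x ∈ Lat p b i) : ∃ a : k, nu p k a ≤ ((p : ℝ)⁻¹) ^ i ∧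
      algebraMap k L x = algebraMap k L a * ∑ σ : L ≃ₐ[k] L, σ (b 1) := by
  refine ⟨b.repr (algebraMap k L x) 1, h 1, ?_⟩
  conv_lhs => rw [← b.sum_repr (algebraMap k L x)]
  rw [Finset.mul_sum]
  refine Finset.sum_congr rfl fun σ _ => ?_
  have h1 := repr_equiv hs σ σ (algebraMap k L x)
  rw [AlgEquiv.commutes, inv_mul_cancel] at h1
  rw [h1, Algebra.smul_def, hs, mul_one]

lemma prod_expand {ι : Type} (s : Finset ι) (t : L) (y : ι → L) (ht : nu p L t ≤ 1) (hy : ∀ i, nu p L (y i) ≤ 1) :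
    ∃ r, nu p L r ≤ 1 ∧ ∏ i ∈ s, (1 + t * y i) = 1 + t * ∑ i ∈ s, y i + t ^ 2 * r := by
  classical
  induction s using Finset.induction_on with
  | empty => exact ⟨0, by simp, by simp⟩
  | insert a s ha ih =>
    obtain ⟨r, hr, h⟩ := ih
    refine ⟨r + y a * ∑ i ∈ s, y i + t * y a * r, ?_, ?_⟩
    · have h1 : nu p L (∑ i ∈ s, y i) ≤ 1 := nu_sum_le p _ _ zero_le_one (fun i _ => hy i)
      have h2 : ∀ {u v : L}, nu p L u ≤ 1 → nu p L v ≤ 1 → nu p L (u * v) ≤ 1 := by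
        intro u v hu hv
        rw [nu_mul]; exact mul_le_one₀ hu (nu_nonneg p v) hv
      refine (nu_add p _ _).trans (max_le ((nu_add p _ _).trans (max_le hr (h2 (hy a) h1))) (h2 (h2 ht (hy a)) hr))
    · rw [Finset.prod_insert ha, Finset.sum_insert ha, h]; ring

/-- the subgroup `1 + p^i Λ` -/
def VG (b : Basis (L ≃ₐ[k] L) k L) (hb : ∀ σ, nu p L (b σ) ≤ 1)
    (hc : ∀ x σ, nu p k (b.repr x σ) ≤ (p : ℝ) ^ c * nu p L x) (i : ℕ) (hi : c < i) : Subgroup Lˣ where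
  carrier := {x | (x : L) - 1 ∈ Lat p b i}
  mul_mem' {x y} hx hy := by
    simp only [Set.mem_setOf_eq] at *
    have : ((x * y : Lˣ) : L) - 1 = ((x : L) - 1) + (y - 1) + (x - 1) * (y - 1) := by push_cast; ring
    rw [this]
    refine add_mem (add_mem hx hy) (Lat_of_nu p hc ?_)
    have h1 := Lat_nu p hb hx
    have h2 := Lat_nu p hb hy
    rw [nu_mul, pow_add]
    have h3 : ((p : ℝ)⁻¹) ^ i ≤ ((p : ℝ)⁻¹) ^ c := pow_le_pow_of_le_one (by positivity)
      (inv_le_one_of_one_le₀ (one_lt_p p).le) hi.le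
    gcongr
    · exact nu_nonneg p _
    · exact h2.trans h3
  one_mem' := by simpa using (Lat p b i).zero_mem
  inv_mem' {x} hx := by
    simp only [Set.mem_setOf_eq] at *
    have h1 := Lat_nu p hb hx
    have hx1 : nu p L (x : L) = 1 := nu_eq_one_of_sub p (h1.trans_lt (inv_p_pow_lt p (by omega)))
    have : ((x⁻¹ : Lˣ) : L) - 1 = - ((x : L) - 1) + (x - 1) * (x - 1) * (x : L)⁻¹ := by
      have := x.ne_zero
      push_cast; field_simp; ring
    rw [this]
    refine add_mem (neg_mem hx) (Lat_of_nu p hc ?_)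
    rw [nu_mul, nu_mul, nu_inv, hx1, inv_one, mul_one, pow_add]
    have h3 : ((p : ℝ)⁻¹) ^ i ≤ ((p : ℝ)⁻¹) ^ c := pow_le_pow_of_le_one (by positivity)
      (inv_le_one_of_one_le₀ (one_lt_p p).le) hi.le
    gcongr
    · exact nu_nonneg p _
    · exact h1.trans h3

lemma norm_VG (hs : ∀ σ τ : L ≃ₐ[k] L, σ (b τ) = b (σ * τ)) (hb : ∀ σ, nu p L (b σ) ≤ 1)
    (hc : ∀ x σ, nu p k (b.repr x σ) ≤ (p : ℝ) ^ c * nu p L x) (i : ℕ) (hi : c < i) (x : kˣ)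
    (hx : algebraMap k L x - 1 ∈ Lat p b i) :
    ∃ v ∈ VG p b hb hc i hi, Algebra.norm k (v : L) = x := by
  have hp0 : (0 : ℝ) < p := by linarith [one_lt_p p]
  -- one step
  have step : ∀ j, i ≤ j → ∀ x : kˣ, algebraMap k L x - 1 ∈ Lat p b j →
      ∃ v ∈ VG p b hb hc i hi, ∃ y : kˣ, algebraMap k L y - 1 ∈ Lat p b (j + 1) ∧
        (x : k) = Algebra.norm k (v : L) * y := by
    intro j hj x hx
    have hx' : algebraMap k L ((x : k) - 1) ∈ Lat p b j := by simpa using hx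
    obtain ⟨a, ha, hxa⟩ := Lat_fixed p hs hx'
    have ha1 : nu p L (algebraMap k L a) ≤ 1 := by
      rw [nu_algebraMap]; exact ha.trans (pow_le_one₀ (by positivity) (inv_le_one_of_one_le₀ (one_lt_p p).le))
    obtain ⟨r, hr, hprod⟩ := prod_expand p Finset.univ (algebraMap k L a) (fun σ : L ≃ₐ[k] L => σ (b 1)) ha1
      (fun σ => by rw [nu_algEquiv]; exact hb 1)
    have hv1 : nu p L ((1 + algebraMap k L a * b 1) - 1) ≤ ((p : ℝ)⁻¹) ^ j := by
      rw [add_sub_cancel_left, nu_mul, nu_algebraMap]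
      calc _ ≤ ((p : ℝ)⁻¹) ^ j * 1 := by
            gcongr
            · exact nu_nonneg p _
            · exact hb 1
        _ = _ := mul_one _
    have hvnu : nu p L (1 + algebraMap k L a * b 1) = 1 :=
      nu_eq_one_of_sub p (hv1.trans_lt (inv_p_pow_lt p (by omega)))
    have hv0 : (1 + algebraMap k L a * b 1) ≠ 0 := by
      intro h0; rw [h0] at hvnu; simp at hvnu
    have hN : algebraMap k L (Algebra.norm k (1 + algebraMap k L a * b 1)) =
        algebraMap k L x + (algebraMap k L a) ^ 2 * r := by
      rw [Algebra.norm_eq_prod_automorphisms]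
      simp only [map_add, map_one, map_mul, AlgEquiv.commutes]
      rw [hprod, ← hxa]
      simp
    have hN0 : Algebra.norm k (1 + algebraMap k L a * b 1) ≠ 0 := Algebra.norm_ne_zero_iff.2 hv0
    have hNnu : nu p k (Algebra.norm k (1 + algebraMap k L a * b 1)) = 1 := by
      rw [nu_eq_one_iff p hN0, w_norm, ← nu_eq_one_iff p hv0]; exact hvnu
    refine ⟨Units.mk0 _ hv0, ?_, x * (Units.mk0 _ hN0)⁻¹, ?_, ?_⟩
    · show (1 + algebraMap k L a * b 1) - 1 ∈ Lat p b i
      rw [add_sub_cancel_left]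
      intro σ
      rw [← Algebra.smul_def, map_smul, Basis.repr_self]
      simp only [Finsupp.smul_apply, smul_eq_mul, nu_mul]
      have h4 : nu p k ((Finsupp.single (1 : L ≃ₐ[k] L) (1:k)) σ) ≤ 1 := by
        classical
        rw [Finsupp.single_apply]; split_ifs <;> simp
      calc _ ≤ ((p : ℝ)⁻¹) ^ i * 1 := by
            gcongr
            · exact nu_nonneg p _
            · exact ha.trans (pow_le_pow_of_le_one (by positivity) (inv_le_one_of_one_le₀ (one_lt_p p).le) hj)
        _ = _ := mul_one _
    · apply Lat_of_nu p hc
      have h5 : algebraMap k L ((x * (Units.mk0 _ hN0)⁻¹ : kˣ) : k) - 1 =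
          - ((algebraMap k L a) ^ 2 * r * (algebraMap k L (Algebra.norm k (1 + algebraMap k L a * b 1)))⁻¹) := by
        have hN0' : algebraMap k L (Algebra.norm k (1 + algebraMap k L a * b 1)) ≠ 0 := by
          simpa using hN0
        have h6 : algebraMap k L x = algebraMap k L (Algebra.norm k (1 + algebraMap k L a * b 1)) -
          (algebraMap k L a) ^ 2 * r := by rw [hN]; ring
        simp only [Units.val_mul, Units.val_inv_eq_inv_val, Units.val_mk0, map_mul, map_inv₀, h6]
        rw [sub_mul, mul_inv_cancel₀ hN0']
        ring
      rw [h5, nu_neg, nu_mul, nu_inv, nu_algebraMap, hNnu, inv_one, mul_one, nu_mul, nu_pow, nu_algebraMap]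
      calc nu p k a ^ 2 * nu p L r ≤ (((p : ℝ)⁻¹) ^ j) ^ 2 * 1 := by
            gcongr
            · exact nu_nonneg p _
            · exact nu_nonneg p _
        _ = ((p : ℝ)⁻¹) ^ (j * 2) := by rw [mul_one, pow_mul]
        _ ≤ _ := pow_le_pow_of_le_one (by positivity) (inv_le_one_of_one_le₀ (one_lt_p p).le) (by omega)
    · simp only [Units.val_mul, Units.val_inv_eq_inv_val, Units.val_mk0]
      field_simp
  have steps : ∀ t, ∃ v ∈ VG p b hb hc i hi, ∃ y : kˣ, algebraMap k L y - 1 ∈ Lat p b (i + t) ∧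
        (x : k) = Algebra.norm k (v : L) * y := by
    intro t
    induction t with
    | zero => exact ⟨1, one_mem _, x, hx, by simp⟩
    | succ t ih =>
      obtain ⟨v, hv, y, hy, h⟩ := ih
      obtain ⟨v', hv', y', hy', h'⟩ := step (i + t) (by omega) y hy
      refine ⟨v * v', mul_mem hv hv', y', hy', ?_⟩
      rw [h, h', Units.val_mul, map_mul]; ring
  have hn : finrank k L ≠ 0 := finrank_pos.ne'
  obtain ⟨j, hj⟩ := deep_roots p (k := k) (finrank k L) hn (i + c)
  obtain ⟨v, hv, y, hy, h⟩ := steps (j + 1)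
  have hyU : y ∈ Uj p k j := by
    apply Uj_anti p (show j ≤ i + (j + 1) by omega)
    rw [mem_Uj' p (by omega)]
    have := Lat_nu p hb hy
    rw [← nu_algebraMap p (L := L)]
    simpa using this
  obtain ⟨z, hz, hzy⟩ := hj y hyU
  refine ⟨v * Units.map (algebraMap k L).toMonoidHom z, mul_mem hv ?_, ?_⟩
  · show algebraMap k L z - 1 ∈ Lat p b i
    apply Lat_of_nu p hc
    rw [← map_one (algebraMap k L), ← map_sub, nu_algebraMap]
    exact hz.2
  · rw [h, Units.val_mul, map_mul]
    congr 1
    show Algebra.norm k (algebraMap k L z) = y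
    rw [Algebra.norm_algebraMap, ← hzy]; simp
end lat
end LCFT

namespace LCFT
open Module

section val
variable (p : ℕ) [Fact p.Prime] (k : Type) [Field k] [Algebra ℚ_[p] k] [FiniteDimensional ℚ_[p] k]

/-- normalized valuation -/
noncomputable def vhom : kˣ →* Multiplicative ℤ where
  toFun x := Multiplicative.ofAdd (w p (x : k) / (fdeg p k : ℤ))
  map_one' := by simp
  map_mul' x y := by
    rw [Units.val_mul, w_mul p x.ne_zero y.ne_zero, Int.add_ediv_of_dvd_left (fdeg_dvd p x.ne_zero), ofAdd_add]

/-- normalized valuation, integer valued -/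
noncomputable def v (x : kˣ) : ℤ := (vhom p k x).toAdd
variable {k}
lemma v_mul (x y : kˣ) : v p k (x * y) = v p k x + v p k y := by simp [v]
lemma v_one : v p k 1 = 0 := by simp [v]
lemma v_inv (x : kˣ) : v p k x⁻¹ = - v p k x := by simp [v]
lemma v_pow (x : kˣ) (n : ℕ) : v p k (x ^ n) = n * v p k x := by simp [v]
lemma v_zpow (x : kˣ) (n : ℤ) : v p k (x ^ n) = n * v p k x := by simp [v]
lemma w_eq_v (x : kˣ) : w p (x : k) = fdeg p k * v p k x := by
  show _ = (fdeg p k : ℤ) * (w p (x : k) / (fdeg p k : ℤ))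
  rw [Int.mul_ediv_cancel' (fdeg_dvd p x.ne_zero)]
lemma fdeg_ne : (fdeg p k : ℤ) ≠ 0 := by exact_mod_cast (fdeg_pos p k).ne'
lemma v_eq_iff {x : kˣ} {n : ℤ} : v p k x = n ↔ w p (x : k) = fdeg p k * n := by
  rw [w_eq_v]
  exact ⟨fun h => by rw [h], fun h => mul_left_cancel₀ (fdeg_ne p) h⟩
lemma mem_U_v {x : kˣ} : x ∈ U p k ↔ v p k x = 0 := by
  rw [mem_U_iff, v_eq_iff, mul_zero]
variable (k) in
lemma exists_v_one : ∃ x : kˣ, v p k x = 1 := by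
  obtain ⟨x, hx, h⟩ := exists_unif p k
  exact ⟨Units.mk0 x hx, by rw [v_eq_iff]; simp [h]⟩
lemma vhom_surj : Function.Surjective (vhom p k) := by
  intro n
  obtain ⟨x, hx⟩ := exists_v_one p k
  refine ⟨x ^ n.toAdd, ?_⟩
  have := v_zpow p x n.toAdd
  rw [hx, mul_one] at this
  exact Multiplicative.toAdd.injective this
lemma vhom_ker : (vhom p k).ker = U p k := by
  ext x
  rw [mem_U_v, MonoidHom.mem_ker]
  rfl
end val

section nrm
variable (k L : Type) [Field k] [Field L] [Algebra k L] 

/-- the norm on unit groups -/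
noncomputable def nrm : Lˣ →* kˣ := Units.map (Algebra.norm k)
/-- the inclusion on unit groups -/
noncomputable def incl : kˣ →* Lˣ := Units.map (algebraMap k L).toMonoidHom
/-- norm group -/
noncomputable def NG : Subgroup kˣ := (nrm k L).range
variable {k L}
@[simp] lemma nrm_coe (x : Lˣ) : ((nrm k L x : kˣ) : k) = Algebra.norm k (x : L) := rfl
@[simp] lemma incl_coe (x : kˣ) : ((incl k L x : Lˣ) : L) = algebraMap k L x := rfl
lemma incl_inj : Function.Injective (incl k L) := by
  intro x y h
  have := congrArg Units.val h
  simp only [incl_coe] at this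
  ext; exact (algebraMap k L).injective this
lemma mem_NG {x : kˣ} : x ∈ NG k L ↔ ∃ y : Lˣ, nrm k L y = x := Iff.rfl
lemma mem_NG' [FiniteDimensional k L] {x : kˣ} : x ∈ NG k L ↔ ∃ y : L, Algebra.norm k y = x := by
  constructor
  · rintro ⟨y, rfl⟩; exact ⟨y, rfl⟩
  · rintro ⟨y, hy⟩
    have hy0 : y ≠ 0 := by
      rintro rfl
      rw [Algebra.norm_zero] at hy
      exact x.ne_zero hy.symm
    exact ⟨Units.mk0 y hy0, by ext; simpa using hy⟩
lemma nrm_incl (x : kˣ) : nrm k L (incl k L x) = x ^ finrank k L := by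
  ext; simp [Algebra.norm_algebraMap]
/-- the action of automorphisms on units -/
noncomputable def act (s : L ≃ₐ[k] L) : Lˣ →* Lˣ := Units.map (s : L →* L)
@[simp] lemma act_coe (s : L ≃ₐ[k] L) (x : Lˣ) : ((act s x : Lˣ) : L) = s x := rfl
lemma nrm_act (s : L ≃ₐ[k] L) (x : Lˣ) : nrm k L (act s x) = nrm k L x := by
  ext; simp [Algebra.norm_eq_of_algEquiv]
lemma act_incl (s : L ≃ₐ[k] L) (x : kˣ) : act s (incl k L x) = incl k L x := by
  ext; simp
lemma incl_nrm [FiniteDimensional k L] [IsGalois k L] (x : Lˣ) : incl k L (nrm k L x) = ∏ s : L ≃ₐ[k] L, act s x := by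
  ext; simp [Algebra.norm_eq_prod_automorphisms]
lemma NG_trans (F : Type) [Field F] [Algebra k F] [Algebra F L] [IsScalarTower k F L] [FiniteDimensional k L] :
    nrm k L = (nrm k F).comp (nrm F L) := by
  haveI : FiniteDimensional k F := FiniteDimensional.left k F L
  haveI : FiniteDimensional F L := FiniteDimensional.right k F L
  ext x
  simp [Algebra.norm_norm]
/-- the operator `s - 1` -/
noncomputable def Dop (s : L ≃ₐ[k] L) : Lˣ →* Lˣ := act s / MonoidHom.id _
lemma Dop_apply (s : L ≃ₐ[k] L) (x : Lˣ) : Dop s x = act s x / x := rfl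
end nrm

section tower
variable (p : ℕ) [Fact p.Prime] (k L : Type) [Field k] [Algebra ℚ_[p] k] [FiniteDimensional ℚ_[p] k]
  [Field L] [Algebra ℚ_[p] L] [FiniteDimensional ℚ_[p] L] [Algebra k L] [IsScalarTower ℚ_[p] k L]
  [FiniteDimensional k L]

/-- residue degree -/
noncomputable def fres : ℕ := fdeg p L / fdeg p k
/-- ramification index -/
noncomputable def eram : ℕ := finrank k L * fdeg p k / fdeg p L
lemma fres_mul : fres p k L * fdeg p k = fdeg p L := Nat.div_mul_cancel (fdeg_dvd_fdeg p)
lemma eram_mul : eram p k L * fdeg p L = finrank k L * fdeg p k := Nat.div_mul_cancel (fdeg_dvd_mul p)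
lemma eram_mul_fres : eram p k L * fres p k L = finrank k L := by
  have h1 := fres_mul p k L
  have h2 := eram_mul p k L
  rw [← h1, ← mul_assoc] at h2
  exact Nat.eq_of_mul_eq_mul_right (fdeg_pos p k) h2
lemma fres_pos : 0 < fres p k L := by
  have h1 := fres_mul p k L
  have := fdeg_pos p L
  rw [← h1] at this
  exact Nat.pos_of_mul_pos_right this |> fun _ => by
    rcases Nat.eq_zero_or_pos (fres p k L) with h | h
    · simp [h] at this
    · exact h
lemma eram_pos : 0 < eram p k L := by
  have h := eram_mul_fres p k L
  have h2 : 0 < finrank k L := finrank_pos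
  rcases Nat.eq_zero_or_pos (eram p k L) with h' | h'
  · simp [h'] at h; omega
  · exact h'
variable {k L}
lemma v_nrm (x : Lˣ) : v p k (nrm k L x) = fres p k L * v p L x := by
  rw [v_eq_iff, nrm_coe, w_norm, w_eq_v, ← fres_mul p k L]; push_cast; ring
lemma v_incl (x : kˣ) : v p L (incl k L x) = eram p k L * v p k x := by
  rw [v_eq_iff, incl_coe, w_algebraMap, w_eq_v, ← mul_assoc, ← mul_assoc]
  congr 1
  have := eram_mul p k L
  rw [mul_comm (fdeg p L : ℤ)]; exact_mod_cast this.symm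
lemma nrm_mem_U {x : Lˣ} : nrm k L x ∈ U p k ↔ x ∈ U p L := by
  rw [mem_U_v, mem_U_v, v_nrm, mul_eq_zero, or_iff_right]
  exact_mod_cast (fres_pos p k L).ne'
lemma incl_mem_U {x : kˣ} : incl k L x ∈ U p L ↔ x ∈ U p k := by
  rw [mem_U_v, mem_U_v, v_incl, mul_eq_zero, or_iff_right]
  exact_mod_cast (eram_pos p k L).ne'
lemma act_mem_U {s : L ≃ₐ[k] L} {x : Lˣ} : act s x ∈ U p L ↔ x ∈ U p L := by
  rw [mem_U, mem_U, act_coe, nu_algEquiv]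

lemma index_zmult (n : ℕ) (H : Subgroup (Multiplicative ℤ))
    (hH : ∀ x : ℤ, Multiplicative.ofAdd x ∈ H ↔ (n : ℤ) ∣ x) : H.index = n := by
  have : H = AddSubgroup.toSubgroup (AddSubgroup.zmultiples (n : ℤ)) := by
    ext x
    rw [← ofAdd_toAdd x, hH]
    show _ ↔ x.toAdd ∈ AddSubgroup.zmultiples (n : ℤ)
    rw [Int.mem_zmultiples_iff]
  rw [this, AddSubgroup.index_toSubgroup, Int.index_zmultiples]
  simp

variable (k L) in
lemma unit_index [IsGalois k L] (s : L ≃ₐ[k] L) (hs : ∀ σ, σ ∈ Subgroup.zpowers s) :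
    (NG k L).relIndex (U p k) ≠ 0 ∧ (NG k L).relIndex (U p k) ≤ eram p k L := by
  haveI : IsCyclic (L ≃ₐ[k] L) := ⟨s, hs⟩
  obtain ⟨b, c, hb1, hb2, hc⟩ := exists_lattice p k L
  set V := VG p b hb2 hc (c + 1) (by omega) with hVdef
  have hVmem : ∀ x : Lˣ, x ∈ V ↔ (x : L) - 1 ∈ Lat p b (c + 1) := fun x => Iff.rfl
  set N : Lˣ →* Lˣ := (incl k L).comp (nrm k L) with hN
  have hactV : ∀ σ : L ≃ₐ[k] L, ∀ x ∈ V, act σ x ∈ V := by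
    intro σ x hx
    rw [hVmem] at hx ⊢
    have := Lat_equiv p hb1 σ hx
    simpa using this
  have hVU : V ≤ U p L := fun x hx =>
    nu_eq_one_of_sub p ((Lat_nu p hb2 hx).trans_lt (inv_p_pow_lt p (by omega)))
  have hfin : V.relIndex (U p L) ≠ 0 := by
    intro h0
    have hle : Uj p L (c + 1 + c) ≤ V := fun x hx => Lat_of_nu p hc hx.2
    exact finiteIndex_Uj p (k := L) (c + 1 + c) (Subgroup.relIndex_eq_zero_of_le_left hle h0)
  have hfix : ∀ x : Lˣ, x ∈ (Dop s).ker ↔ ∃ y : kˣ, incl k L y = x := by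
    intro x
    rw [MonoidHom.mem_ker, Dop_apply, div_eq_one]
    constructor
    · intro h
      have h1 : s (x : L) = x := congrArg Units.val h
      have h2 : ∀ σ : L ≃ₐ[k] L, σ (x : L) = x := by
        intro σ
        have : Subgroup.zpowers s ≤ MulAction.stabilizer (L ≃ₐ[k] L) (x : L) := by
          rw [Subgroup.zpowers_le]; exact h1
        exact this (hs σ)
      obtain ⟨y, hy⟩ := (IsGalois.mem_range_algebraMap_iff_fixed (F := k) (x : L)).2 h2
      have hy0 : y ≠ 0 := by rintro rfl; simp at hy; exact x.ne_zero hy.symm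
      exact ⟨Units.mk0 y hy0, by ext; simpa using hy⟩
    · rintro ⟨y, rfl⟩; exact act_incl s y
  have hNker : U p L ⊓ N.ker = (⊤ : Subgroup Lˣ).map (Dop s) := by
    ext x
    constructor
    · rintro ⟨-, hx⟩
      have hx1 : nrm k L x = 1 := by
        apply incl_inj (L := L); rw [map_one]; exact hx
      obtain ⟨y, hy⟩ := groupCohomology.exists_div_of_norm_eq_one hs (x := (x : L)) (congrArg Units.val hx1)
      refine ⟨y⁻¹, trivial, ?_⟩
      ext
      rw [← hy, Dop_apply]
      simp [div_eq_mul_inv, mul_comm]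
    · rintro ⟨y, -, rfl⟩
      rw [Subgroup.mem_inf]
      refine ⟨?_, ?_⟩
      · rw [Dop_apply]
        rw [mem_U, Units.val_div_eq_div_val, nu_div, act_coe, nu_algEquiv, div_self (nu_pos p y.ne_zero).ne']
      · rw [MonoidHom.mem_ker, hN, MonoidHom.comp_apply, Dop_apply, map_div, nrm_act]; simp
  have hidx : ((U p L).map (Dop s)).relIndex (U p L ⊓ N.ker) = eram p k L := by
    rw [hNker, Subgroup.relIndex_map_map, top_sup_eq, Subgroup.relIndex_top_right, sup_comm, ← vhom_ker,
      ← Subgroup.comap_map_eq, Subgroup.index_comap_of_surjective _ (vhom_surj p)]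
    apply index_zmult
    intro z
    constructor
    · rintro ⟨x, hx, h⟩
      obtain ⟨y, rfl⟩ := (hfix x).1 hx
      have h1 : v p L (incl k L y) = z := congrArg Multiplicative.toAdd h
      rw [v_incl] at h1
      exact ⟨_, h1.symm⟩
    · rintro ⟨t, rfl⟩
      obtain ⟨y, hy⟩ := vhom_surj p (k := k) (Multiplicative.ofAdd t)
      refine ⟨incl k L y, (hfix _).2 ⟨y, rfl⟩, ?_⟩
      have h1 := v_incl p (L := L) y
      have h2 : v p k y = t := congrArg Multiplicative.toAdd hy
      rw [h2] at h1
      exact Multiplicative.toAdd.injective h1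
  have hDU : ∀ x, Dop s x ∈ U p L := by
    intro x
    have : Dop s x ∈ (⊤ : Subgroup Lˣ).map (Dop s) := ⟨x, trivial, rfl⟩
    rw [← hNker] at this
    exact this.1
  have main := herbrand N (Dop s) V (U p L) hVU hfin ?_ ?_ ?_ ?_ ?_ ?_ ?_ ?_
  · rw [hidx] at main
    have hUD : U p L ⊓ (Dop s).ker = (U p k).map (incl k L) := by
      ext x
      constructor
      · rintro ⟨h1, h2⟩
        obtain ⟨y, rfl⟩ := (hfix x).1 h2
        exact ⟨y, (incl_mem_U p).1 h1, rfl⟩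
      · rintro ⟨y, hy, rfl⟩
        exact ⟨(incl_mem_U p).2 hy, (hfix _).2 ⟨y, rfl⟩⟩
    rw [hUD, hN, ← Subgroup.map_map, Subgroup.relIndex_map_map_of_injective _ _ incl_inj] at main
    have hNU : (U p L).map (nrm k L) = NG k L ⊓ U p k := by
      ext x
      constructor
      · rintro ⟨y, hy, rfl⟩
        exact ⟨⟨y, rfl⟩, (nrm_mem_U p).2 hy⟩
      · rintro ⟨⟨y, rfl⟩, hy⟩
        exact ⟨y, (nrm_mem_U p).1 hy, rfl⟩
    rw [hNU, Subgroup.inf_relIndex_right] at main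
    exact main
  · intro x
    have : Dop s x ∈ (⊤ : Subgroup Lˣ).map (Dop s) := ⟨x, trivial, rfl⟩
    rw [← hNker] at this
    exact this.2
  · intro x
    exact (hfix _).2 ⟨_, rfl⟩
  · rintro _ ⟨x, hx, rfl⟩
    exact (incl_mem_U p).2 ((nrm_mem_U p).2 hx)
  · rintro _ ⟨x, -, rfl⟩
    exact hDU x
  · rintro _ ⟨x, hx, rfl⟩
    show incl k L (nrm k L x) ∈ V
    rw [incl_nrm]
    exact Subgroup.prod_mem _ (fun σ _ => hactV σ x hx)
  · rintro _ ⟨x, hx, rfl⟩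
    exact V.div_mem (hactV s x hx) hx
  · rintro x ⟨hx, hx2⟩
    obtain ⟨y, rfl⟩ := (hfix x).1 hx2
    obtain ⟨u, hu, h⟩ := norm_VG p hb1 hb2 hc (c + 1) (by omega) y hx
    refine ⟨u, hu, ?_⟩
    show incl k L (nrm k L u) = _
    congr 1
    ext; exact h
  · rw [hidx]; exact (eram_pos p k L).ne'

lemma index_NG_eq : (NG k L).index = (NG k L).relIndex (U p k) * fres p k L := by
  rw [← Subgroup.relIndex_mul_index (show NG k L ≤ NG k L ⊔ U p k from le_sup_left),
    Subgroup.relIndex_sup_left]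
  congr 1
  rw [← vhom_ker, ← Subgroup.comap_map_eq, Subgroup.index_comap_of_surjective _ (vhom_surj p)]
  apply index_zmult
  intro z
  constructor
  · rintro ⟨_, ⟨y, rfl⟩, h⟩
    have h1 : v p k (nrm k L y) = z := congrArg Multiplicative.toAdd h
    rw [v_nrm] at h1
    exact ⟨_, h1.symm⟩
  · rintro ⟨t, rfl⟩
    obtain ⟨y, hy⟩ := vhom_surj p (k := L) (Multiplicative.ofAdd t)
    refine ⟨nrm k L y, ⟨y, rfl⟩, ?_⟩
    have h1 := v_nrm p (k := k) y
    have h2 : v p L y = t := congrArg Multiplicative.toAdd hy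
    rw [h2] at h1
    exact Multiplicative.toAdd.injective h1

end tower

/-- norm index inequality, cyclic case -/
lemma index_cyclic (p : ℕ) [Fact p.Prime] (k L : Type) [Field k] [Algebra ℚ_[p] k] [FiniteDimensional ℚ_[p] k]
  [Field L] [Algebra ℚ_[p] L] [FiniteDimensional ℚ_[p] L] [Algebra k L] [IsScalarTower ℚ_[p] k L]
  [FiniteDimensional k L] [IsGalois k L] (hcyc : IsCyclic (L ≃ₐ[k] L)) :
    (NG k L).index ≠ 0 ∧ (NG k L).index ≤ finrank k L := by
  obtain ⟨s, hs⟩ := hcyc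
  obtain ⟨h1, h2⟩ := unit_index p k L s hs
  rw [index_NG_eq p]
  refine ⟨mul_ne_zero h1 (fres_pos p k L).ne', ?_⟩
  rw [← eram_mul_fres p k L]
  exact Nat.mul_le_mul_right _ h2

lemma units_are_norms (p : ℕ) [Fact p.Prime] (k L : Type) [Field k] [Algebra ℚ_[p] k] [FiniteDimensional ℚ_[p] k]
  [Field L] [Algebra ℚ_[p] L] [FiniteDimensional ℚ_[p] L] [Algebra k L] [IsScalarTower ℚ_[p] k L]
  [FiniteDimensional k L] [IsGalois k L] (hcyc : IsCyclic (L ≃ₐ[k] L)) (h : fdeg p L = finrank k L * fdeg p k) :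
    U p k ≤ NG k L := by
  obtain ⟨s, hs⟩ := hcyc
  obtain ⟨h1, h2⟩ := unit_index p k L s hs
  have : eram p k L = 1 := by
    rw [eram, ← h]; exact Nat.div_self (fdeg_pos p L)
  rw [this] at h2
  rw [← Subgroup.relIndex_eq_one]
  omega
end LCFT

namespace LCFT
open Module

instance st_intermediate (p : ℕ) [Fact p.Prime] (k L : Type) [Field k] [Algebra ℚ_[p] k]
  [Field L] [Algebra ℚ_[p] L] [Algebra k L] [IsScalarTower ℚ_[p] k L]
  (F : IntermediateField k L) : IsScalarTower ℚ_[p] F L :=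
  IsScalarTower.of_algebraMap_eq fun x => rfl

instance fd_intermediate (p : ℕ) [Fact p.Prime] (k L : Type) [Field k] [Algebra ℚ_[p] k]
  [Field L] [Algebra ℚ_[p] L] [FiniteDimensional ℚ_[p] L] [Algebra k L] [IsScalarTower ℚ_[p] k L]
  (F : IntermediateField k L) : FiniteDimensional ℚ_[p] F :=
  FiniteDimensional.left ℚ_[p] F L

lemma cyclic_fixed {k L : Type} [Field k] [Field L] [Algebra k L] [FiniteDimensional k L]
    (H : Subgroup (L ≃ₐ[k] L)) [IsCyclic H] :
    IsCyclic (L ≃ₐ[IntermediateField.fixedField H] L) := by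
  have h := IntermediateField.fixingSubgroup_fixedField H
  have e := IntermediateField.fixingSubgroupEquiv (IntermediateField.fixedField H)
  rw [h] at e
  exact isCyclic_of_surjective e.toMonoidHom e.surjective

lemma index_NG_trans {k F L : Type} [Field k] [Field F] [Field L] [Algebra k L] [Algebra k F] [Algebra F L]
    [IsScalarTower k F L] [FiniteDimensional k L] (h : (NG F L).index ≠ 0) :
    (NG k L).index ≤ (NG F L).index * (NG k F).index ∧ ((NG k F).index ≠ 0 → (NG k L).index ≠ 0) := by
  have h1 : NG k L = (NG F L).map (nrm k F) := by
    rw [NG, NG_trans F, MonoidHom.range_eq_map, ← Subgroup.map_map, ← MonoidHom.range_eq_map]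
    rfl
  have h2 : (NG F L ⊔ (nrm k F).ker).index ∣ (NG F L).index := Subgroup.index_dvd_of_le le_sup_left
  have h3 : (NG F L ⊔ (nrm k F).ker).index ≠ 0 := fun h0 => h (by rw [h0] at h2; exact zero_dvd_iff.1 h2)
  rw [h1, Subgroup.index_map]
  exact ⟨Nat.mul_le_mul_right _ (Nat.le_of_dvd (Nat.pos_of_ne_zero h) h2), fun h4 => mul_ne_zero h3 h4⟩

/-- norm index inequality -/
lemma index_abelian (p : ℕ) [Fact p.Prime] (k L : Type) [Field k] [Algebra ℚ_[p] k] [FiniteDimensional ℚ_[p] k]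
  [Field L] [Algebra ℚ_[p] L] [FiniteDimensional ℚ_[p] L] [Algebra k L] [IsScalarTower ℚ_[p] k L]
  [FiniteDimensional k L] [IsAbelianGalois k L] :
    (NG k L).index ≠ 0 ∧ (NG k L).index ≤ finrank k L := by
  induction hn : finrank k L using Nat.strong_induction_on generalizing L with
  | _ n ih =>
    by_cases htriv : ∀ σ : L ≃ₐ[k] L, σ = 1
    · have hcyc : IsCyclic (L ≃ₐ[k] L) := ⟨⟨1, fun σ => ⟨0, by rw [htriv σ]; simp⟩⟩⟩
      rw [← hn]
      exact index_cyclic p k L hcyc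
    · push Not at htriv
      obtain ⟨σ, hσ⟩ := htriv
      let F := IntermediateField.fixedField (Subgroup.zpowers σ)
      have hc : IsCyclic (L ≃ₐ[F] L) := cyclic_fixed _
      have h1 := index_cyclic p F L hc
      have hmul : finrank k F * finrank F L = finrank k L := finrank_mul_finrank k F L
      have hF1 : finrank F L ≠ 1 := by
        intro h
        have : finrank F L = Nat.card (Subgroup.zpowers σ) := IntermediateField.finrank_fixedField_eq_card _
        rw [h] at this
        have h2 := Subgroup.card_eq_one.1 this.symm
        exact hσ (Subgroup.zpowers_eq_bot.1 h2)
      have hF0 : 0 < finrank F L := finrank_pos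
      have hk0 : 0 < finrank k F := finrank_pos
      have hlt : finrank k F < n := by rw [← hn, ← hmul]; nlinarith [show 2 ≤ finrank F L by omega]
      have h2 := ih _ hlt F rfl
      have h3 := index_NG_trans (k := k) (F := F) (L := L) h1.1
      refine ⟨h3.2 h2.1, h3.1.trans ?_⟩
      rw [← hn, ← hmul, mul_comm]
      exact Nat.mul_le_mul h2.2 h1.2
end LCFT

namespace LCFT
open Module

section unram
variable (p : ℕ) [Fact p.Prime] {k K : Type} [Field k] [Algebra ℚ_[p] k] [FiniteDimensional ℚ_[p] k]
  [Field K] [Algebra ℚ_[p] K] [FiniteDimensional ℚ_[p] K] [Algebra k K] [IsScalarTower ℚ_[p] k K]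
  [FiniteDimensional k K]

lemma nu_nat_coprime {m : ℕ} (hm : p.Coprime m) : nu p k (m : k) = 1 := by
  have h2 := nu_base p (k := k) (m : ℚ_[p])
  rw [map_natCast] at h2
  rw [h2]
  exact Padic.norm_natCast_eq_one_iff.2 hm

lemma root_eq_one {m : ℕ} (hm : p.Coprime m) {x : k} (hx : x ^ m = 1) (h : nu p k (x - 1) < 1) : x = 1 := by
  by_contra hne
  have hy : x - 1 ≠ 0 := sub_ne_zero.2 hne
  have hg : (∑ i ∈ Finset.range m, x ^ i) * (x - 1) = 0 := by
    rw [geom_sum_mul, hx, sub_self]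
  have hs : ∑ i ∈ Finset.range m, x ^ i = 0 := (mul_eq_zero.1 hg).resolve_right hy
  have hl' : (m : k) = - ∑ i ∈ Finset.range m, (x ^ i - 1) := by
    rw [Finset.sum_sub_distrib, hs]; simp
  have hx1 : nu p k x = 1 := nu_eq_one_of_sub p h
  have h1 : nu p k (m : k) ≤ nu p k (x - 1) := by
    rw [hl', nu_neg]
    apply nu_sum_le p _ _ (nu_nonneg p _)
    intro i _
    rw [← geom_sum_mul, nu_mul]
    refine mul_le_of_le_one_left (nu_nonneg p _) ?_
    apply nu_sum_le p _ _ zero_le_one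
    intro j _
    rw [nu_pow, hx1, one_pow]
  rw [nu_nat_coprime p hm] at h1
  linarith

lemma root_eq {m : ℕ} (hm : p.Coprime m) {x y : k} (hx : x ^ m = 1) (hy : y ^ m = 1) (hm0 : m ≠ 0)
    (h : nu p k (x - y) < 1) : x = y := by
  have hy0 : y ≠ 0 := by rintro rfl; simp [hm0] at hy
  have hy1 : nu p k y = 1 := by
    have : nu p k y ^ m = 1 := by rw [← nu_pow, hy, nu_one]
    exact (pow_eq_one_iff_of_nonneg (nu_nonneg p _) hm0).1 this
  have h1 : x / y = 1 := by
    apply root_eq_one p hm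
    · rw [div_pow, hx, hy, div_one]
    · have : x / y - 1 = (x - y) / y := by field_simp
      rw [this, nu_div, hy1, div_one]
      exact h
  exact (div_eq_one_iff_eq hy0).1 h1

/-- embedding of rings of integers -/
noncomputable def inclO : 𝒪 p k →+* 𝒪 p K :=
  ((algebraMap k K).comp (𝒪 p k).subtype).codRestrict (𝒪 p K) (fun x => by
    have := (mem_𝒪 p).1 x.2
    refine (mem_𝒪 p).2 ?_
    rw [← nu_algebraMap p (L := K)] at this
    exact this)

noncomputable def autO (σ : K ≃ₐ[k] K) : 𝒪 p K →+* 𝒪 p K :=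
  ((σ : K →+* K).comp (𝒪 p K).subtype).codRestrict (𝒪 p K) (fun x => by
    have := (mem_𝒪 p).1 x.2
    refine (mem_𝒪 p).2 ?_
    rw [← nu_algEquiv p (σ.restrictScalars ℚ_[p])] at this
    exact this)

lemma ff_aut {κ κ' : Type} [Field κ] [Field κ'] [Finite κ] [Finite κ'] (f : κ →+* κ') (s : κ' →+* κ')
    (h : ∀ r, s (f r) = f r) : ∃ i : ℕ, ∀ x, s x = x ^ (Nat.card κ ^ i) := by
  letI := f.toAlgebra
  letI : Fintype κ := Fintype.ofFinite _
  have hfin : Module.Finite κ κ' := Module.Finite.of_finite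
  let s' : κ' →ₐ[κ] κ' := { s with commutes' := h }
  have hs : Function.Bijective s' := Finite.injective_iff_bijective.1 s'.toRingHom.injective
  obtain ⟨i, hi⟩ := (FiniteField.bijective_frobeniusAlgEquivOfAlgebraic_pow κ κ').2 (AlgEquiv.ofBijective s' hs)
  refine ⟨i, fun x => ?_⟩
  have h1 := DFunLike.congr_fun hi x
  rw [AlgEquiv.coe_pow, FiniteField.coe_frobeniusAlgEquivOfAlgebraic_iterate, ← Nat.card_eq_fintype_card] at h1
  exact h1.symm

lemma local_aut {A B : Type} [CommRing A] [CommRing B] [IsLocalRing A] [IsLocalRing B]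
    [Finite (IsLocalRing.ResidueField A)] [Finite (IsLocalRing.ResidueField B)] (f : A →+* B) [IsLocalHom f]
    (s : B →+* B) [IsLocalHom s] (h : ∀ r, s (f r) = f r) :
    ∃ i : ℕ, ∀ x, s x - x ^ (Nat.card (IsLocalRing.ResidueField A) ^ i) ∈ IsLocalRing.maximalIdeal B := by
  obtain ⟨i, hi⟩ := ff_aut (IsLocalRing.ResidueField.map f) (IsLocalRing.ResidueField.map s) (fun r => by
    obtain ⟨r, rfl⟩ := IsLocalRing.residue_surjective r
    rw [IsLocalRing.ResidueField.map_residue, IsLocalRing.ResidueField.map_residue, h])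
  refine ⟨i, fun x => ?_⟩
  have := hi (IsLocalRing.residue _ x)
  rw [IsLocalRing.ResidueField.map_residue, ← map_pow] at this
  exact Ideal.Quotient.eq.1 this

lemma sigma_pow (σ : K ≃ₐ[k] K) : ∃ i : ℕ, ∀ x : K, nu p K x ≤ 1 → nu p K (σ x - x ^ (qk p k ^ i)) < 1 := by
  have hl : IsLocalHom (inclO p (k := k) (K := K)) := ⟨fun x hx => by
    rw [isUnit_𝒪] at hx ⊢
    rw [← nu_algebraMap p (L := K)]
    exact hx⟩
  have hl2 : IsLocalHom (autO p σ) := ⟨fun x hx => by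
    rw [isUnit_𝒪] at hx ⊢
    rw [← nu_algEquiv p (σ.restrictScalars ℚ_[p])]
    exact hx⟩
  obtain ⟨i, hi⟩ := local_aut (inclO p (k := k) (K := K)) (autO p σ) (fun r => by
    apply Subtype.ext
    exact σ.commutes r)
  rw [card_resid] at hi
  refine ⟨i, fun x hx => ?_⟩
  have := (mem_max p).1 (hi ⟨x, (mem_𝒪 p).2 hx⟩)
  exact this

end unram
end LCFT

namespace LCFT
open Module

lemma dvd_of_pow_sub {q N m : ℕ} (hq : 1 < q) (h : q ^ N - 1 ∣ q ^ m - 1) : N ∣ m := by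
  have h1 := Nat.pow_sub_one_gcd_pow_sub_one q N m
  rw [Nat.gcd_eq_left h] at h1
  have h2 : 1 ≤ q ^ N := Nat.one_le_pow _ _ (by omega)
  have h3 : 1 ≤ q ^ (N.gcd m) := Nat.one_le_pow _ _ (by omega)
  have h4 : q ^ N = q ^ (N.gcd m) := by omega
  have h5 := Nat.pow_right_injective hq h4
  rw [h5]; exact Nat.gcd_dvd_right _ _

lemma coprime_pow_sub {q N : ℕ} (hq : 1 < q) (hN : N ≠ 0) : Nat.Coprime q (q ^ N - 1) := by
  have h2 : 1 ≤ q ^ N := Nat.one_le_pow _ _ (by omega)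
  have h : Nat.Coprime (q ^ N) (q ^ N - 1) := by
    rw [Nat.coprime_comm]
    exact (Nat.coprime_self_sub_left h2).2 (Nat.coprime_one_left _)
  exact Nat.Coprime.coprime_dvd_left (dvd_pow_self q hN) h

lemma pow_sub_ne_zero {q N : ℕ} (hq : 1 < q) (hN : N ≠ 0) : q ^ N - 1 ≠ 0 := by
  have := Nat.one_lt_pow hN hq
  omega

lemma zeta_pow_iff {q N : ℕ} (hq : 1 < q) (hN : N ≠ 0) {M : Type} [CommMonoid M] {ζ : M}
    (hζ : IsPrimitiveRoot ζ (q ^ N - 1)) (i j : ℕ) : ζ ^ (q ^ i) = ζ ^ (q ^ j) ↔ i ≡ j [MOD N] := by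
  have h0 : 0 < q ^ N - 1 := Nat.pos_of_ne_zero (pow_sub_ne_zero hq hN)
  have key : ∀ i j, i ≤ j → (ζ ^ (q ^ i) = ζ ^ (q ^ j) ↔ i ≡ j [MOD N]) := by
    intro i j hij
    have hu : IsUnit ζ := IsUnit.of_pow_eq_one hζ.pow_eq_one h0.ne'
    have hle : q ^ i ≤ q ^ j := Nat.pow_le_pow_right (by omega) hij
    have e1 : ζ ^ (q ^ i) = ζ ^ (q ^ j) ↔ ζ ^ (q ^ j - q ^ i) = 1 := by
      conv_lhs => rhs; rw [← Nat.sub_add_cancel hle, pow_add]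
      constructor
      · intro h
        have := (hu.pow (q ^ i)).mul_right_cancel (a := 1) (c := ζ ^ (q ^ j - q ^ i)) (by rw [one_mul]; exact h)
        exact this.symm
      · intro h; rw [h, one_mul]
    rw [e1, hζ.pow_eq_one_iff_dvd, Nat.modEq_iff_dvd' hij]
    have e2 : q ^ j - q ^ i = q ^ i * (q ^ (j - i) - 1) := by
      rw [Nat.mul_sub, ← pow_add, Nat.add_sub_cancel' hij, mul_one]
    rw [e2]
    constructor
    · intro h
      exact dvd_of_pow_sub hq ((Nat.Coprime.pow_left i (coprime_pow_sub hq hN)).symm.dvd_of_dvd_mul_left h)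
    · intro h
      exact Dvd.dvd.mul_left (Nat.pow_sub_one_dvd_pow_sub_one q h) _
  rcases le_total i j with h | h
  · exact key i j h
  · rw [eq_comm, key j i h]; exact ⟨fun h => h.symm, fun h => h.symm⟩

section unram
variable (p : ℕ) [Fact p.Prime] {k K : Type} [Field k] [Algebra ℚ_[p] k] [FiniteDimensional ℚ_[p] k]
  [Field K] [Algebra ℚ_[p] K] [FiniteDimensional ℚ_[p] K] [Algebra k K] [IsScalarTower ℚ_[p] k K]
  [FiniteDimensional k K]

lemma coprime_p_sub {N : ℕ} (hN : N ≠ 0) : p.Coprime (qk p k ^ N - 1) :=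
  Nat.Coprime.coprime_dvd_left (dvd_pow_self p (fdeg_pos p k).ne') (coprime_pow_sub (one_lt_qk p k) hN)

lemma nu_root {m : ℕ} (hm : m ≠ 0) {x : k} (h : x ^ m = 1) : nu p k x = 1 := by
  have : nu p k x ^ m = 1 := by rw [← nu_pow, h, nu_one]
  exact (pow_eq_one_iff_of_nonneg (nu_nonneg p _) hm).1 this

lemma qk_fres : qk p K = qk p k ^ fres p k K := by
  rw [qk, qk, ← pow_mul, mul_comm, fres_mul]

lemma nu_pow_qk {x : k} (hx : nu p k x ≤ 1) : nu p k (x ^ qk p k - x) < 1 := by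
  letI : Fintype (IsLocalRing.ResidueField (𝒪 p k)) := Fintype.ofFinite _
  have h := FiniteField.pow_card (IsLocalRing.residue (𝒪 p k) ⟨x, (mem_𝒪 p).2 hx⟩)
  rw [← Nat.card_eq_fintype_card, card_resid, ← map_pow] at h
  have := (mem_max p).1 (Ideal.Quotient.eq.1 h)
  exact this

lemma zeta_aut {N : ℕ} (hN : N ≠ 0) {ζ : K} (hζ : IsPrimitiveRoot ζ (qk p k ^ N - 1)) (σ : K ≃ₐ[k] K) :
    ∃ i : ℕ, σ ζ = ζ ^ (qk p k ^ i) := by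
  obtain ⟨i, hi⟩ := sigma_pow p σ
  have h0 := pow_sub_ne_zero (one_lt_qk p k) hN
  refine ⟨i, root_eq p (coprime_p_sub p hN (k := k)) ?_ ?_ h0 (hi ζ (nu_root p h0 hζ.pow_eq_one).le)⟩
  · rw [← map_pow, hζ.pow_eq_one, map_one]
  · rw [← pow_mul, mul_comm, pow_mul, hζ.pow_eq_one, one_pow]

lemma N_dvd_fres {N : ℕ} (hN : N ≠ 0) {ζ : K} (hζ : IsPrimitiveRoot ζ (qk p k ^ N - 1)) : N ∣ fres p k K := by
  have h0 := pow_sub_ne_zero (one_lt_qk p k) hN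
  have h1 : ζ ^ qk p K = ζ := by
    apply root_eq p (coprime_p_sub p hN (k := k)) ?_ hζ.pow_eq_one h0 (nu_pow_qk p (nu_root p h0 hζ.pow_eq_one).le)
    rw [← pow_mul, mul_comm, pow_mul, hζ.pow_eq_one, one_pow]
  rw [qk_fres p (k := k)] at h1
  have h2 := (zeta_pow_iff (one_lt_qk p k) hN hζ (fres p k K) 0).1 (by simpa using h1)
  exact (Nat.modEq_zero_iff_dvd).1 h2

lemma gal_ext_of_adjoin {k K : Type} [Field k] [Field K] [Algebra k K] {ζ : K}
    (h : IntermediateField.adjoin k {ζ} = ⊤) {σ τ : K ≃ₐ[k] K} (hs : σ ζ = τ ζ) : σ = τ := by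
  have : IntermediateField.adjoin k {ζ} ≤ IntermediateField.fixedField (Subgroup.zpowers (τ⁻¹ * σ)) := by
    rw [IntermediateField.adjoin_simple_le_iff, IntermediateField.mem_fixedField_iff]
    intro f hf
    have h2 : Subgroup.zpowers (τ⁻¹ * σ) ≤ MulAction.stabilizer (K ≃ₐ[k] K) ζ := by
      rw [Subgroup.zpowers_le]
      change τ⁻¹ (σ ζ) = ζ
      rw [hs]; exact τ.symm_apply_apply ζ
    exact h2 hf
  rw [h] at this
  ext x
  have h3 := (IntermediateField.mem_fixedField_iff _ _).1 (this (IntermediateField.mem_top (x := x))) _ (Subgroup.mem_zpowers _)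
  have h4 : τ⁻¹ (σ x) = x := h3
  have h5 : τ (τ⁻¹ (σ x)) = σ x := τ.apply_symm_apply (σ x)
  rw [h4] at h5
  exact h5.symm

lemma unram_gen {N : ℕ} (hN : N ≠ 0) {ζ : K} (hζ : IsPrimitiveRoot ζ (qk p k ^ N - 1))
    (htop : IntermediateField.adjoin k {ζ} = ⊤) :
    IsAbelianGalois k K ∧ finrank k K = N ∧ fdeg p K = finrank k K * fdeg p k ∧ fres p k K = N ∧
      ∃ φ : K ≃ₐ[k] K, φ ζ = ζ ^ qk p k ∧ ∀ σ, σ ∈ Subgroup.zpowers φ := by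
  have h0 := pow_sub_ne_zero (one_lt_qk p k) hN
  haveI : NeZero (qk p k ^ N - 1) := ⟨h0⟩
  have hab : IsAbelianGalois k K := by
    have h1 := hζ.intermediateField_adjoin_isCyclotomicExtension k
    have h2 := IsCyclotomicExtension.isAbelianGalois {qk p k ^ N - 1} k (IntermediateField.adjoin k {ζ})
    rw [htop] at h2
    exact IsAbelianGalois.of_algHom (IntermediateField.topEquiv (F := k) (E := K)).symm.toAlgHom
  choose i hi using zeta_aut p hN hζ
  have hinj : Function.Injective (fun σ : K ≃ₐ[k] K => (⟨i σ % N, Nat.mod_lt _ (Nat.pos_of_ne_zero hN)⟩ : Fin N)) := by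
    intro σ τ h
    apply gal_ext_of_adjoin htop
    rw [hi, hi, zeta_pow_iff (one_lt_qk p k) hN hζ]
    exact congrArg Fin.val h
  have hle : finrank k K ≤ N := by
    rw [← IsGalois.card_aut_eq_finrank]
    simpa using Nat.card_le_card_of_injective _ hinj
  have h1 : N ∣ fres p k K := N_dvd_fres p hN hζ
  have h2 := Nat.le_of_dvd (fres_pos p k K) h1
  have h3 : fres p k K ∣ finrank k K := ⟨eram p k K, by rw [mul_comm, eram_mul_fres]⟩
  have h4 := Nat.le_of_dvd finrank_pos h3
  have h5 : fres p k K = N := by omega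
  have h6 : finrank k K = N := by omega
  have hbij := (Fintype.bijective_iff_injective_and_card _).2 ⟨hinj, by
    rw [← Nat.card_eq_fintype_card, IsGalois.card_aut_eq_finrank, h6, Fintype.card_fin]⟩
  refine ⟨hab, h6, by rw [h6, ← h5, fres_mul], h5, ?_⟩
  obtain ⟨φ, hφ⟩ := hbij.2 ⟨1 % N, Nat.mod_lt _ (Nat.pos_of_ne_zero hN)⟩
  have hφ1 : φ ζ = ζ ^ qk p k := by
    rw [hi]
    conv_rhs => rw [← pow_one (qk p k)]
    rw [zeta_pow_iff (one_lt_qk p k) hN hζ]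
    exact congrArg Fin.val hφ
  refine ⟨φ, hφ1, fun σ => ⟨(i σ : ℤ), ?_⟩⟩
  apply gal_ext_of_adjoin htop
  have : ∀ n : ℕ, (φ ^ n) ζ = ζ ^ (qk p k ^ n) := by
    intro n
    induction n with
    | zero => simp
    | succ n ih => rw [pow_succ', AlgEquiv.mul_apply, ih, map_pow, hφ1, ← pow_mul, pow_succ']
  rw [hi σ, ← this (i σ)]
  rfl

end unram
end LCFT

namespace LCFT
open Module

section abs
variable {G M : Type} [CommGroup G] [Finite G] [CommGroup M] [MulDistribMulAction G M]

open Classical in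
noncomputable def NH (H : Subgroup G) : M →* M :=
  letI := Fintype.ofFinite H
  { toFun := fun y => ∏ t : H, (t : G) • y
    map_one' := by simp
    map_mul' := fun x y => by simp [smul_mul', Finset.prod_mul_distrib] }

lemma NH_apply (H : Subgroup G) [Fintype H] (y : M) : NH H y = ∏ t : H, (t : G) • y := by
  rw [NH]
  simp only [MonoidHom.coe_mk, OneHom.coe_mk]
  congr!

lemma NH_smul (H : Subgroup G) (g : G) (y : M) : NH H (g • y) = g • NH H y := by
  letI := Fintype.ofFinite H
  rw [NH_apply, NH_apply, Finset.smul_prod']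
  exact Finset.prod_congr rfl fun t _ => smul_comm _ _ _

lemma smul_NH (H : Subgroup G) (g : H) (y : M) : (g : G) • NH H y = NH H y := by
  letI := Fintype.ofFinite H
  rw [NH_apply, Finset.smul_prod']
  refine Fintype.prod_equiv (Equiv.mulLeft g) _ _ fun t => ?_
  simp [mul_smul]

lemma geom_smul (g : G) (x : M) (n : ℕ) :
    g • (∏ l ∈ Finset.range n, g ^ l • x) / (∏ l ∈ Finset.range n, g ^ l • x) = g ^ n • x / x := by
  induction n with
  | zero => simp
  | succ n ih =>
    rw [Finset.prod_range_succ, smul_mul', mul_div_mul_comm, ih, smul_smul, ← pow_succ']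
    rw [mul_comm, div_mul_div_cancel]

lemma zsum_pow {G ι : Type} [CommGroup G] (s : Finset ι) (σ : G) (f : ι → ℤ) :
    σ ^ (∑ i ∈ s, f i) = ∏ i ∈ s, σ ^ f i := by
  classical
  induction s using Finset.induction_on with
  | empty => simp
  | insert a s ha ih => rw [Finset.sum_insert ha, Finset.prod_insert ha, zpow_add, ih]

theorem lemma_C (I J : Subgroup G) (hJI : J ≤ I) (σ φ : G) (hσI : σ ∈ I) (hσ : ∀ τ ∈ I, ∃ j : ℕ, ∃ t ∈ J, τ = σ ^ j * t)
    (H90 : ∀ Y : M, NH I Y = 1 → ∃ z : M, (∀ t ∈ J, t • z = z) ∧ NH J Y = σ • z / z)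
    (v : M →* Multiplicative ℤ) (hv : ∀ (g : G) x, v (g • x) = v x)
    (hvI : ∀ c : M, (∀ g ∈ I, g • c = c) → (Nat.card I : ℤ) ∣ (v c).toAdd)
    {ι : Type} (s : Finset ι) (x : ι → M) (α τ : ι → G) (d : ι → ℕ) (ε : ι → ℤ)
    (hα : ∀ i ∈ s, α i * τ i = φ ^ d i) (hτ : ∀ i ∈ s, τ i ∈ I) (hx : ∀ i ∈ s, α i • x i = x i)
    (hY : NH I (∏ i ∈ s, (∏ l ∈ Finset.range (d i), φ ^ l • x i) ^ ε i) = 1) :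
    ∏ i ∈ s, τ i ^ (ε i * (v (x i)).toAdd) ∈ J := by
  obtain ⟨z, hz, hYz⟩ := H90 _ hY
  have hch : ∀ i, ∃ j : ℕ, ∃ t ∈ J, i ∈ s → τ i = σ ^ j * t := by
    intro i
    by_cases hi : i ∈ s
    · obtain ⟨j, t, ht, h⟩ := hσ _ (hτ i hi)
      exact ⟨j, t, ht, fun _ => h⟩
    · exact ⟨0, 1, J.one_mem, fun h => absurd h hi⟩
  choose j t htJ ht using hch
  set Y := ∏ i ∈ s, (∏ l ∈ Finset.range (d i), φ ^ l • x i) ^ ε i with hYdef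
  let wi : ι → M := fun i => ∏ l ∈ Finset.range (j i), σ ^ l • NH J (x i)
  let W : M := ∏ i ∈ s, (wi i) ^ ε i
  have h1 : φ • Y / Y = ∏ i ∈ s, (τ i • x i / x i) ^ ε i := by
    rw [hYdef, Finset.smul_prod', ← Finset.prod_div_distrib]
    refine Finset.prod_congr rfl fun i hi => ?_
    rw [smul_zpow', ← div_zpow, geom_smul, ← hα i hi, mul_comm, mul_smul, hx i hi]
  have h2 : NH J (φ • Y / Y) = σ • W / W := by
    rw [h1, map_prod]
    simp only [W]
    rw [Finset.smul_prod', ← Finset.prod_div_distrib]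
    refine Finset.prod_congr rfl fun i hi => ?_
    rw [smul_zpow', ← div_zpow, geom_smul, map_zpow, map_div, NH_smul, ht i hi, mul_smul]
    rw [smul_NH J ⟨t i, htJ i⟩]
  have h3 : NH J (φ • Y / Y) = σ • (φ • z / z) / (φ • z / z) := by
    rw [map_div, NH_smul, hYz, smul_div', smul_div', smul_comm φ σ z]
    rw [div_div_div_comm]
  set c := W / (φ • z / z) with hc
  have hcσ : σ • c = c := by
    rw [hc, smul_div', div_eq_div_iff_div_eq_div, ← h2, ← h3]
  have hJ1 : ∀ g ∈ J, g • W = W := by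
    intro g hg
    simp only [W, wi]
    rw [Finset.smul_prod']
    refine Finset.prod_congr rfl fun i hi => ?_
    rw [smul_zpow', Finset.smul_prod']
    congr 1
    refine Finset.prod_congr rfl fun l _ => ?_
    rw [smul_comm, smul_NH J ⟨g, hg⟩]
  have hcJ : ∀ g ∈ J, g • c = c := by
    intro g hg
    rw [hc, smul_div', smul_div', hJ1 g hg, smul_comm g φ z, hz g hg]
  have hcI : ∀ g ∈ I, g • c = c := by
    intro g hg
    obtain ⟨l, t', ht', rfl⟩ := hσ g hg
    rw [mul_smul, hcJ t' ht']
    have : ∀ l : ℕ, σ ^ l • c = c := by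
      intro l
      induction l with
      | zero => simp
      | succ l ih => rw [pow_succ, mul_smul, hcσ, ih]
    exact this l
  have hvNH : ∀ y : M, v (NH J y) = v y ^ Nat.card J := by
    intro y
    letI := Fintype.ofFinite J
    rw [NH_apply, map_prod, Finset.prod_congr rfl (fun (t : J) _ => hv (t : G) y), Finset.prod_const, Nat.card_eq_fintype_card]
    rfl
  have hvc : (v c).toAdd = Nat.card J * ∑ i ∈ s, j i * (ε i * (v (x i)).toAdd) := by
    have : v c = ∏ i ∈ s, ((v (x i) ^ Nat.card J) ^ j i) ^ ε i := by
      rw [hc, map_div, map_div, hv, div_self', div_one]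
      simp only [W, wi]
      rw [map_prod]
      refine Finset.prod_congr rfl fun i _ => ?_
      rw [map_zpow, map_prod, Finset.prod_congr rfl (fun l _ => hv (σ ^ l) _), Finset.prod_const, hvNH, Finset.card_range]
    rw [this, toAdd_prod, Finset.mul_sum]
    refine Finset.sum_congr rfl fun i _ => ?_
    simp
    ring
  have hdvd := hvI c hcI
  rw [hvc] at hdvd
  have hcard : Nat.card I = Nat.card J * J.relIndex I := by
    rw [← Subgroup.card_mul_index (J.subgroupOf I), Subgroup.relIndex]
    congr 1
    exact Nat.card_congr (Subgroup.subgroupOfEquivOfLe hJI).toEquiv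
  rw [hcard] at hdvd
  push_cast at hdvd
  have hJ0 : (Nat.card J : ℤ) ≠ 0 := by exact_mod_cast Nat.card_pos.ne'
  have hdvd2 := Int.dvd_of_mul_dvd_mul_left hJ0 hdvd
  have hpow : σ ^ (J.relIndex I) ∈ J := by
    have := Subgroup.pow_index_mem (J.subgroupOf I) (⟨σ, hσI⟩ : I)
    exact this
  obtain ⟨B, hB⟩ := hdvd2
  have h5 : ∏ i ∈ s, τ i ^ (ε i * (v (x i)).toAdd) =
      σ ^ (∑ i ∈ s, (j i : ℤ) * (ε i * (v (x i)).toAdd)) * ∏ i ∈ s, t i ^ (ε i * (v (x i)).toAdd) := by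
    have : ∀ f : ι → ℤ, σ ^ (∑ i ∈ s, f i) = ∏ i ∈ s, σ ^ f i := fun f => zsum_pow s σ f
    rw [this, ← Finset.prod_mul_distrib]
    refine Finset.prod_congr rfl fun i hi => ?_
    rw [ht i hi, mul_zpow, zpow_mul σ, zpow_natCast]
  rw [h5, hB, zpow_mul, zpow_natCast]
  exact J.mul_mem (J.zpow_mem hpow _) (J.prod_mem fun i _ => J.zpow_mem (htJ i) _)

lemma exists_sep (I : Subgroup G) {g : G} (hg : g ≠ 1) : ∃ J : Subgroup G, J ≤ I ∧ g ∉ J ∧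
    ∃ σ ∈ I, ∀ τ ∈ I, ∃ j : ℕ, ∃ t ∈ J, τ = σ ^ j * t := by
  obtain ⟨χ, hχ⟩ := CommGroup.exists_apply_ne_one_of_hasEnoughRootsOfUnity G ℂ hg
  refine ⟨I ⊓ χ.ker, inf_le_left, fun h => hχ h.2, ?_⟩
  have : IsCyclic (I.map χ) := by
    haveI : Finite (I.map χ) := Set.Finite.image _ (Set.toFinite _)
    infer_instance
  obtain ⟨⟨_, σ, hσ, rfl⟩, h⟩ := this
  refine ⟨σ, hσ, fun τ hτ => ?_⟩
  obtain ⟨n, hn⟩ := h ⟨χ τ, τ, hτ, rfl⟩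
  have hn' : χ σ ^ n = χ τ := congrArg Subtype.val hn
  have h0 : IsOfFinOrder (χ σ) := χ.isOfFinOrder (isOfFinOrder_of_finite σ)
  obtain ⟨m, hm⟩ := h0.mem_powers_iff_mem_zpowers.2 ⟨n, rfl⟩
  have hm' : χ σ ^ m = χ τ := hm.trans hn'
  refine ⟨m, (σ ^ m)⁻¹ * τ, ⟨I.mul_mem (I.inv_mem (I.pow_mem hσ _)) hτ, ?_⟩, by group⟩
  change _ ∈ χ.ker
  rw [MonoidHom.mem_ker, map_mul, map_inv, map_pow, hm', inv_mul_cancel]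

end abs
end LCFT

namespace LCFT
open Module

instance galCommGroup (k E : Type) [Field k] [Field E] [Algebra k E] [IsAbelianGalois k E] : CommGroup (E ≃ₐ[k] E) :=
  { (inferInstance : Group (E ≃ₐ[k] E)) with mul_comm := fun a b => (IsMulCommutative.is_comm (M := E ≃ₐ[k] E)).comm a b }

section fieldlevel
variable {k E : Type} [Field k] [Field E] [Algebra k E] [FiniteDimensional k E] [IsAbelianGalois k E]

lemma norm_fixed (H : Subgroup (E ≃ₐ[k] E)) (y : E) [Fintype H] :
    algebraMap (IntermediateField.fixedField H) E (Algebra.norm (IntermediateField.fixedField H) y) = ∏ t : H, (t : E ≃ₐ[k] E) y := by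
  rw [Algebra.norm_eq_prod_automorphisms]
  exact (Fintype.prod_equiv (IntermediateField.subgroupEquivAlgEquiv H).toEquiv _ _ (fun t => rfl)).symm

lemma NH_coe (H : Subgroup (E ≃ₐ[k] E)) (y : Eˣ) [Fintype H] :
    ((NH H y : Eˣ) : E) = ∏ t : H, (t : E ≃ₐ[k] E) y := by
  rw [NH_apply, Units.coe_prod]
  rfl

lemma H90_field (I J : Subgroup (E ≃ₐ[k] E)) (hJI : J ≤ I) (σ : E ≃ₐ[k] E) (hσI : σ ∈ I)
    (hσ : ∀ τ ∈ I, ∃ j : ℕ, ∃ t ∈ J, τ = σ ^ j * t) (Y : Eˣ) (hY : NH I Y = 1) :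
    ∃ z : Eˣ, (∀ t ∈ J, t • z = z) ∧ NH J Y = σ • z / z := by
  letI := Fintype.ofFinite I
  letI := Fintype.ofFinite J
  set F := IntermediateField.fixedField I with hF
  let r : (E ≃ₐ[F] E) →* (E ≃ₐ[k] E) := 
    { toFun := fun g => g.restrictScalars k, map_one' := rfl, map_mul' := fun _ _ => rfl }
  have hr : Function.Injective r := fun a b h => by
    ext x; exact DFunLike.congr_fun h x
  have hrI : ∀ g ∈ I, ∃ g', r g' = g := fun g hg => ⟨IntermediateField.subgroupEquivAlgEquiv I ⟨g, hg⟩, by ext x; rfl⟩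
  have hrI' : ∀ g', r g' ∈ I := fun g' => by
    rw [← IntermediateField.fixingSubgroup_fixedField I]
    intro x
    exact g'.commutes x
  let J' := J.comap r
  letI := Fintype.ofFinite J'
  set K := IntermediateField.fixedField J' with hK
  obtain ⟨σ', hσ'⟩ := hrI σ hσI
  have h1 : Algebra.norm F (Y : E) = 1 := by
    apply (algebraMap F E).injective
    rw [norm_fixed, map_one, ← NH_coe, hY, Units.val_one]
  have h2 : Algebra.norm F (Algebra.norm K (Y : E)) = 1 := by rw [Algebra.norm_norm, h1]
  let s := AlgEquiv.restrictNormalHom K σ'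
  have hs : ∀ g, g ∈ Subgroup.zpowers s := by
    intro g
    obtain ⟨g', rfl⟩ := AlgEquiv.restrictNormalHom_surjective (K₁ := K) E g
    obtain ⟨j, t, ht, h⟩ := hσ _ (hrI' g')
    obtain ⟨t', rfl⟩ := hrI t (hJI ht)
    have h' : g' = σ' ^ j * t' := hr (by rw [h, map_mul, map_pow, hσ'])
    refine ⟨j, ?_⟩
    have h3 : AlgEquiv.restrictNormalHom K t' = 1 := by
      ext x
      have := AlgEquiv.restrictNormal_commutes t' K x
      rw [AlgEquiv.one_apply]
      refine this.trans ?_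
      exact x.2 ⟨t', ht⟩
    rw [h', map_mul, h3, mul_one, map_pow]
    simp [s]
  haveI : IsCyclic (K ≃ₐ[F] K) := ⟨s, hs⟩
  obtain ⟨y, hy⟩ := groupCohomology.exists_div_of_norm_eq_one hs h2
  let z : Eˣ := Units.map (algebraMap K E).toMonoidHom y
  have hzc : (z : E) = algebraMap K E y := rfl
  have hsz : algebraMap K E (s y) = σ z := by
    have := AlgEquiv.restrictNormal_commutes σ' K y
    refine this.trans ?_
    rw [← hσ']; rfl
  refine ⟨z⁻¹, ?_, ?_⟩
  · intro t ht
    rw [smul_inv']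
    congr 1
    ext
    obtain ⟨t', rfl⟩ := hrI t (hJI ht)
    exact (y : K).2 ⟨t', ht⟩
  · ext
    have h4 := congrArg (algebraMap K E) hy
    rw [map_div₀, hsz, norm_fixed] at h4
    rw [smul_inv', inv_div_inv, Units.val_div_eq_div_val, NH_coe]
    have h5 : ∏ t : J', (t : E ≃ₐ[F] E) (Y : E) = ∏ t : J, (t : E ≃ₐ[k] E) (Y : E) := by
      refine Fintype.prod_bijective (fun t : J' => (⟨r t, t.2⟩ : J)) ⟨?_, ?_⟩ _ _ (fun t => rfl)
      · intro a b h; exact Subtype.ext (hr (congrArg Subtype.val h))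
      · rintro ⟨t, ht⟩
        obtain ⟨t', rfl⟩ := hrI t (hJI ht)
        exact ⟨⟨t', ht⟩, rfl⟩
    rw [← h5, ← h4]
    rfl

end fieldlevel
end LCFT

namespace LCFT
open Module

section good
variable (p : ℕ) [Fact p.Prime] {k E : Type} [Field k] [Algebra ℚ_[p] k] [FiniteDimensional ℚ_[p] k]
  [Field E] [Algebra ℚ_[p] E] [FiniteDimensional ℚ_[p] E] [Algebra k E] [IsScalarTower ℚ_[p] k E]
  [FiniteDimensional k E]

lemma fres_trans (F : Type) [Field F] [Algebra ℚ_[p] F] [FiniteDimensional ℚ_[p] F] [Algebra k F] [IsScalarTower ℚ_[p] k F]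
    [FiniteDimensional k F] [Algebra F E] [IsScalarTower ℚ_[p] F E] [FiniteDimensional F E] :
    fres p k F * fres p F E = fres p k E := by
  have h1 := fres_mul p k F
  have h2 := fres_mul p F E
  have h3 := fres_mul p k E
  have h := fdeg_pos p k
  have : (fres p k F * fres p F E) * fdeg p k = fres p k E * fdeg p k := by
    rw [h3, ← h2, ← h1]; ring
  exact Nat.eq_of_mul_eq_mul_right h this

/-- `E/k` contains the unramified extension of degree `N`, generated by `ζ`, as maximal unramified subextension, and `N` kills
the Galois group. -/
def Good (k : Type) [Field k] [Algebra ℚ_[p] k] [FiniteDimensional ℚ_[p] k] (E : Type)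
  [Field E] [Algebra ℚ_[p] E] [FiniteDimensional ℚ_[p] E] [Algebra k E] [IsScalarTower ℚ_[p] k E]
  [FiniteDimensional k E] (N : ℕ) (ζ : E) : Prop :=
  N ≠ 0 ∧ IsPrimitiveRoot ζ (qk p k ^ N - 1) ∧ fres p k E = N ∧ ∀ g : E ≃ₐ[k] E, g ^ N = 1

/-- the inertia group -/
def Iner (k : Type) {E : Type} [Field k] [Field E] [Algebra k E] (ζ : E) : Subgroup (E ≃ₐ[k] E) := MulAction.stabilizer (E ≃ₐ[k] E) ζ

lemma mem_Iner {k E : Type} [Field k] [Field E] [Algebra k E] {ζ : E} {g : E ≃ₐ[k] E} : g ∈ Iner k ζ ↔ g ζ = ζ := Iff.rfl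

lemma fixedField_Iner {k E : Type} [Field k] [Field E] [Algebra k E] [FiniteDimensional k E] [IsGalois k E] (ζ : E) :
    IntermediateField.fixedField (Iner k ζ) = IntermediateField.adjoin k {ζ} := by
  have : Iner k ζ = (IntermediateField.adjoin k {ζ}).fixingSubgroup := by
    ext g
    rw [mem_Iner, ← Subgroup.zpowers_le, ← IntermediateField.le_iff_le, IntermediateField.adjoin_simple_le_iff,
      IntermediateField.mem_fixedField_iff]
    constructor
    · intro h f hf
      have h2 : Subgroup.zpowers g ≤ Iner k ζ := by
        rw [Subgroup.zpowers_le]; exact h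
      exact h2 hf
    · intro h; exact h g (Subgroup.mem_zpowers g)
  rw [this, IsGalois.fixedField_fixingSubgroup]

variable [IsAbelianGalois k E]

lemma pow_zeta {q d : ℕ} {ζ : E} {α : E ≃ₐ[k] E} (h : α ζ = ζ ^ (q ^ d)) (j : ℕ) : (α ^ j) ζ = ζ ^ (q ^ (d * j)) := by
  induction j with
  | zero => simp
  | succ n ih => rw [pow_succ', AlgEquiv.mul_apply, ih, map_pow, h, ← pow_mul, ← pow_add]; ring_nf

lemma adjoin_self_top {k E : Type} [Field k] [Field E] [Algebra k E] (ζ : E) : IntermediateField.adjoin k {(IntermediateField.AdjoinSimple.gen k ζ)} = ⊤ := by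
  apply IntermediateField.map_injective (IntermediateField.adjoin k {ζ}).val
  rw [IntermediateField.adjoin_map, ← AlgHom.fieldRange_eq_map, IntermediateField.fieldRange_val, Set.image_singleton]
  rfl

variable {N : ℕ} {ζ : E}

lemma good_F (h : Good p k E N ζ) : 
    finrank k (IntermediateField.adjoin k {ζ}) = N ∧ fres p (IntermediateField.adjoin k {ζ}) E = 1 ∧
    finrank (IntermediateField.adjoin k {ζ}) E = Nat.card (Iner k ζ) ∧ 
    ∃ φ : E ≃ₐ[k] E, φ ζ = ζ ^ qk p k := by
  obtain ⟨hN, hζ, hf, hkill⟩ := h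
  have hζ' : IsPrimitiveRoot (IntermediateField.AdjoinSimple.gen k ζ) (qk p k ^ N - 1) :=
    IsPrimitiveRoot.of_map_of_injective (f := algebraMap (IntermediateField.adjoin k {ζ}) E) hζ (algebraMap (IntermediateField.adjoin k {ζ}) E).injective
  obtain ⟨h1, h2, h3, h4, φ, hφ, hgen⟩ := unram_gen p hN hζ' (adjoin_self_top ζ)
  refine ⟨h2, ?_, ?_, ?_⟩
  · have := fres_trans p (k := k) (E := E) (IntermediateField.adjoin k {ζ})
    rw [h4, hf] at this
    exact Nat.eq_of_mul_eq_mul_left (Nat.pos_of_ne_zero hN) (by rw [this, mul_one])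
  · rw [← fixedField_Iner, IntermediateField.finrank_fixedField_eq_card]
  · obtain ⟨φ', hφ'⟩ := AlgEquiv.restrictNormalHom_surjective (F := k) (K₁ := IntermediateField.adjoin k {ζ}) E φ
    refine ⟨φ', ?_⟩
    have := AlgEquiv.restrictNormal_commutes φ' (IntermediateField.adjoin k {ζ}) (IntermediateField.AdjoinSimple.gen k ζ)
    have h5 : φ'.restrictNormal (IntermediateField.adjoin k {ζ}) = φ := hφ'
    rw [h5, hφ, map_pow] at this
    exact this.symm

lemma good_card (h : Good p k E N ζ) : Nat.card (E ≃ₐ[k] E) = N * Nat.card (Iner k ζ) := by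
  obtain ⟨h1, h2, h3, h4⟩ := good_F p h
  rw [IsGalois.card_aut_eq_finrank, ← finrank_mul_finrank k (IntermediateField.adjoin k {ζ}) E, h1, h3]

lemma good_val (h : Good p k E N ζ) (c : Eˣ) (hc : ∀ g ∈ Iner k ζ, g • c = c) :
    (Nat.card (Iner k ζ) : ℤ) ∣ (vhom p E c).toAdd := by
  obtain ⟨h1, h2, h3, h4⟩ := good_F p h
  have hmem : (c : E) ∈ IntermediateField.adjoin k {ζ} := by
    rw [← fixedField_Iner, IntermediateField.mem_fixedField_iff]
    intro g hg
    exact congrArg Units.val (hc g hg)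
  have h5 : incl (IntermediateField.adjoin k {ζ}) E (Units.mk0 ⟨c, hmem⟩ (by intro h0; exact c.ne_zero (congrArg Subtype.val h0))) = c := by
    ext; rfl
  rw [← h5]
  change _ ∣ v p E _
  rw [v_incl]
  have h6 := eram_mul_fres p (IntermediateField.adjoin k {ζ}) E
  rw [h2, mul_one] at h6
  rw [h6, h3]
  exact dvd_mul_right _ _

lemma good_sigma (h : Good p k E N ζ) {d : ℕ} (hd : d ∣ N) {α : E ≃ₐ[k] E} (hα : α ζ = ζ ^ (qk p k ^ d)) (hα1 : α ^ (N / d) = 1) :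
    fres p k (IntermediateField.fixedField (Subgroup.zpowers α)) = d ∧
    eram p (IntermediateField.fixedField (Subgroup.zpowers α)) E = 1 ∧
    orderOf α = N / d ∧ finrank k (IntermediateField.fixedField (Subgroup.zpowers α)) = d * Nat.card (Iner k ζ) := by
  have hcard := good_card p h
  obtain ⟨hN, hζ, hf, hkill⟩ := h
  obtain ⟨e, he⟩ := hd
  have hd0 : 0 < d := Nat.pos_of_ne_zero (by rintro rfl; simp at he; exact hN he)
  have he0 : 0 < e := Nat.pos_of_ne_zero (by rintro rfl; simp at he; exact hN he)
  have hNd : N / d = e := by rw [he, Nat.mul_div_cancel_left _ hd0]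
  rw [hNd] at hα1 ⊢
  have hfix : ∀ j : ℕ, (α ^ j) ζ = ζ → α ^ j = 1 := by
    intro j hj
    rw [pow_zeta hα] at hj
    have := (zeta_pow_iff (one_lt_qk p k) hN hζ (d * j) 0).1 (by simpa using hj)
    rw [Nat.modEq_zero_iff_dvd, he] at this
    obtain ⟨c, rfl⟩ := Nat.dvd_of_mul_dvd_mul_left hd0 this
    rw [pow_mul, hα1, one_pow]
  have hord : orderOf α = e := by
    apply Nat.dvd_antisymm (orderOf_dvd_of_pow_eq_one hα1)
    have h1 := pow_zeta hα (orderOf α)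
    rw [pow_orderOf_eq_one] at h1
    have := (zeta_pow_iff (one_lt_qk p k) hN hζ (d * orderOf α) 0).1 (by simpa using h1.symm)
    rw [Nat.modEq_zero_iff_dvd, he] at this
    exact Nat.dvd_of_mul_dvd_mul_left hd0 this
  set S := IntermediateField.fixedField (Subgroup.zpowers α) with hS
  have hSE : finrank S E = e := by
    rw [hS, IntermediateField.finrank_fixedField_eq_card, Nat.card_zpowers, hord]
  have hft := fres_trans p (k := k) (E := E) S
  rw [hf] at hft
  have hf0 := fres_pos p k S
  have hg0 : fres p S E ≠ 0 := (fres_pos p S E).ne'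
  have hζS : IsPrimitiveRoot ζ (qk p S ^ (fres p S E) - 1) := by
    rw [qk_fres p (k := k), ← pow_mul, hft]; exact hζ
  have htop : IntermediateField.adjoin S {ζ} = ⊤ := by
    rw [← fixedField_Iner]
    have : Iner S ζ = ⊥ := by
      rw [eq_bot_iff]
      intro g hg
      rw [mem_Iner] at hg
      obtain ⟨⟨g', hg'⟩, hgg⟩ := (IntermediateField.subgroupEquivAlgEquiv (Subgroup.zpowers α)).surjective g
      obtain ⟨j, rfl⟩ := (isOfFinOrder_of_finite α).mem_powers_iff_mem_zpowers.2 hg'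
      have h2 : ∀ x, g x = (α ^ j) x := fun x => by rw [← hgg]; rfl
      have h3 := hfix j (by rw [← h2, hg])
      rw [Subgroup.mem_bot]
      ext x
      rw [h2, h3]; rfl
    rw [this, IntermediateField.fixedField_bot]
  obtain ⟨h1, h2, h3, h4, -⟩ := unram_gen p hg0 hζS htop
  have h5 : fres p k S = d := by
    rw [← h2, hSE, he] at hft
    exact Nat.eq_of_mul_eq_mul_right he0 hft
  refine ⟨h5, ?_, hord, ?_⟩
  · have := eram_mul_fres p S E
    rw [h2] at this
    exact Nat.eq_of_mul_eq_mul_right (Nat.pos_of_ne_zero hg0) (by rw [this, one_mul])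
  · have h6 := finrank_mul_finrank k S E
    rw [← IsGalois.card_aut_eq_finrank k E, hcard, hSE, he] at h6
    exact Nat.eq_of_mul_eq_mul_right he0 (by rw [h6]; ring)

end good
end LCFT

namespace LCFT
open Module

section art
variable (p : ℕ) [Fact p.Prime] {k E : Type} [Field k] [Algebra ℚ_[p] k] [FiniteDimensional ℚ_[p] k]
  [Field E] [Algebra ℚ_[p] E] [FiniteDimensional ℚ_[p] E] [Algebra k E] [IsScalarTower ℚ_[p] k E]
  [FiniteDimensional k E] [IsAbelianGalois k E] {N : ℕ} {ζ : E}

/-- fixed field of an automorphism -/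
noncomputable abbrev Sg (α : E ≃ₐ[k] E) : IntermediateField k E := IntermediateField.fixedField (Subgroup.zpowers α)

lemma ker_restrict {k E : Type} [Field k] [Field E] [Algebra k E] [FiniteDimensional k E] [IsAbelianGalois k E]
    (α g : E ≃ₐ[k] E) : AlgEquiv.restrictNormalHom (Sg α) g = 1 ↔ g ∈ Subgroup.zpowers α := by
  rw [← MonoidHom.mem_ker, IntermediateField.restrictNormalHom_ker, IntermediateField.fixingSubgroup_fixedField]

set_option maxHeartbeats 1000000 in
lemma norm_formula (h : Good p k E N ζ) {d : ℕ} (hd : d ∣ N) {α φ : E ≃ₐ[k] E} (hφ : φ ζ = ζ ^ qk p k)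
    (hα : α ζ = ζ ^ (qk p k ^ d)) (hα1 : α ^ (N / d) = 1) (x : (Sg α)ˣ) :
    incl k E (nrm k (Sg α) x) = NH (Iner k ζ) (∏ l ∈ Finset.range d, φ ^ l • incl (Sg α) E x) := by
  obtain ⟨h1, h2, h3, h4⟩ := good_sigma p h hd hα hα1
  obtain ⟨hN, hζ, hf, hkill⟩ := h
  letI := Fintype.ofFinite (Iner k ζ)
  have hφ' : φ ζ = ζ ^ (qk p k ^ 1) := by rw [pow_one]; exact hφ
  obtain ⟨e, he⟩ := hd
  have hd0 : 0 < d := Nat.pos_of_ne_zero (by rintro rfl; simp at he; exact hN he)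
  have hNd : N / d = e := by rw [he, Nat.mul_div_cancel_left _ hd0]
  rw [hNd] at h3 hα1
  let Φ : Iner k ζ × Fin d → ((Sg α) ≃ₐ[k] (Sg α)) := fun t => AlgEquiv.restrictNormalHom (Sg α) ((t.1 : E ≃ₐ[k] E) * φ ^ (t.2 : ℕ))
  have hinj : Function.Injective Φ := by
    rintro ⟨τ, i⟩ ⟨τ', i'⟩ hh
    simp only [Φ] at hh
    rw [← mul_inv_eq_one, ← map_inv, ← map_mul, ker_restrict] at hh
    obtain ⟨j, hj⟩ := (isOfFinOrder_of_finite α).mem_powers_iff_mem_zpowers.2 hh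
    simp only at hj
    have hj' : α ^ j * ((τ' : E ≃ₐ[k] E) * φ ^ (i' : ℕ)) = (τ : E ≃ₐ[k] E) * φ ^ (i : ℕ) := by
      rw [hj]; group
    have hz := DFunLike.congr_fun hj' ζ
    have hτ : (τ : E ≃ₐ[k] E) ζ = ζ := τ.2
    have hτ' : (τ' : E ≃ₐ[k] E) ζ = ζ := τ'.2
    rw [AlgEquiv.mul_apply, AlgEquiv.mul_apply, AlgEquiv.mul_apply, pow_zeta hφ', pow_zeta hφ', map_pow, map_pow, map_pow, hτ, hτ',
      pow_zeta hα, ← pow_mul, ← pow_add, zeta_pow_iff (one_lt_qk p k) hN hζ, one_mul, one_mul] at hz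
    have hz2 : (i' : ℕ) ≡ i [MOD d] := by
      have : d * j + i' ≡ i [MOD d] := hz.of_dvd ⟨e, he⟩
      have h5 : d * j + (i' : ℕ) ≡ i' [MOD d] := by simp [Nat.ModEq]
      exact h5.symm.trans this
    have hii : (i' : ℕ) = i := Nat.ModEq.eq_of_lt_of_lt hz2 i'.2 i.2
    rw [hii] at hz hj'
    have hz3 : d * j ≡ 0 [MOD N] := Nat.ModEq.add_right_cancel' (i : ℕ) (by simpa using hz)
    rw [Nat.modEq_zero_iff_dvd, he] at hz3
    obtain ⟨c, rfl⟩ := Nat.dvd_of_mul_dvd_mul_left hd0 hz3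
    rw [pow_mul, hα1, one_pow, one_mul] at hj'
    have := mul_right_cancel hj'
    ext1
    · exact Subtype.ext this.symm
    · exact Fin.ext hii.symm
  have hbij : Function.Bijective Φ := by
    rw [Fintype.bijective_iff_injective_and_card]
    refine ⟨hinj, ?_⟩
    rw [← Nat.card_eq_fintype_card, ← Nat.card_eq_fintype_card, IsGalois.card_aut_eq_finrank, h4, Nat.card_prod, Nat.card_fin, mul_comm]
  have h5 : (incl k E (nrm k (Sg α) x)) = incl (Sg α) E (incl k (Sg α) (nrm k (Sg α) x)) := by
    ext; simp [← IsScalarTower.algebraMap_apply]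
  rw [h5, incl_nrm, map_prod, NH_apply, ← Fintype.prod_bijective Φ hbij (fun t => ((t.1 : E ≃ₐ[k] E) * φ ^ (t.2 : ℕ)) • incl (Sg α) E x)]
  · rw [Fintype.prod_prod_type]
    refine Finset.prod_congr rfl fun t _ => ?_
    rw [Finset.smul_prod', Finset.prod_range]
    refine Finset.prod_congr rfl fun i _ => ?_
    rw [mul_smul]
  · intro t
    ext
    have := AlgEquiv.restrictNormal_commutes ((t.1 : E ≃ₐ[k] E) * φ ^ (t.2 : ℕ)) (Sg α) (x : Sg α)
    exact this.symm

/-- `a` corresponds to `α` -/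
def IsArt (ζ : E) (φ α : E ≃ₐ[k] E) (d : ℕ) (a : kˣ) : Prop :=
  α ζ = ζ ^ (qk p k ^ d) ∧ ∃ x : Eˣ, α • x = x ∧ v p E x = 1 ∧
    incl k E a = NH (Iner k ζ) (∏ l ∈ Finset.range d, φ ^ l • x)

lemma art_rel (h : Good p k E N ζ) {φ : E ≃ₐ[k] E} (hφ : φ ζ = ζ ^ qk p k) {ι : Type} (s : Finset ι) (α : ι → (E ≃ₐ[k] E))
    (d : ι → ℕ) (a : ι → kˣ) (ε : ι → ℤ) (hA : ∀ i ∈ s, IsArt p ζ φ (α i) (d i) (a i))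
    (h1 : ∏ i ∈ s, a i ^ ε i = 1) (h0 : ∑ i ∈ s, d i * ε i = 0) : ∏ i ∈ s, α i ^ ε i = 1 := by
  have hch : ∀ i, ∃ x : Eˣ, i ∈ s → α i • x = x ∧ v p E x = 1 ∧
    incl k E (a i) = NH (Iner k ζ) (∏ l ∈ Finset.range (d i), φ ^ l • x) := by
    intro i
    by_cases hi : i ∈ s
    · obtain ⟨x, hx⟩ := (hA i hi).2
      exact ⟨x, fun _ => hx⟩
    · exact ⟨1, fun h => absurd h hi⟩
  choose x hx using hch
  have hφ' : φ ζ = ζ ^ (qk p k ^ 1) := by rw [pow_one]; exact hφ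
  have key : ∏ i ∈ s, ((α i)⁻¹ * φ ^ d i) ^ ε i = 1 := by
    by_contra hne
    obtain ⟨J, hJI, hgJ, σ, hσI, hσ⟩ := exists_sep (Iner k ζ) hne
    apply hgJ
    have := lemma_C (Iner k ζ) J hJI σ φ hσI hσ (H90_field (Iner k ζ) J hJI σ hσI hσ) (vhom p E) (fun g y => by
      change vhom p E (act g y) = _
      have : act g y * y⁻¹ ∈ (vhom p E).ker := by
        rw [vhom_ker, mem_U, Units.val_mul, nu_mul, act_coe]
        have := nu_algEquiv p (g.restrictScalars ℚ_[p]) (y : E)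
        rw [AlgEquiv.restrictScalars_apply] at this
        rw [this, ← nu_mul, ← Units.val_mul, mul_inv_cancel, Units.val_one, nu_one]
      rw [MonoidHom.mem_ker, map_mul, map_inv, mul_inv_eq_one] at this
      exact this) (good_val p h) s x α (fun i => (α i)⁻¹ * φ ^ d i) d ε (fun i hi => by rw [mul_inv_cancel_left]) (fun i hi => by
        rw [mem_Iner, AlgEquiv.mul_apply, pow_zeta hφ', one_mul, ← (hA i hi).1]
        exact (α i).symm_apply_apply ζ) (fun i hi => (hx i hi).1) (by
        rw [map_prod, ← map_one (incl k E), ← h1, map_prod]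
        refine Finset.prod_congr rfl fun i hi => ?_
        rw [map_zpow, map_zpow, (hx i hi).2.2])
    have h2 : ∏ i ∈ s, ((α i)⁻¹ * φ ^ d i) ^ ε i = ∏ i ∈ s, ((α i)⁻¹ * φ ^ d i) ^ (ε i * (vhom p E (x i)).toAdd) := by
      refine Finset.prod_congr rfl fun i hi => ?_
      have : (vhom p E (x i)).toAdd = 1 := (hx i hi).2.1
      rw [this, mul_one]
    rw [h2]
    exact this
  have h3 : ∏ i ∈ s, ((α i)⁻¹ * φ ^ d i) ^ ε i = (∏ i ∈ s, α i ^ ε i)⁻¹ * φ ^ (∑ i ∈ s, d i * ε i : ℤ) := by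
    rw [zsum_pow, ← Finset.prod_inv_distrib, ← Finset.prod_mul_distrib]
    refine Finset.prod_congr rfl fun i hi => ?_
    rw [mul_zpow, inv_zpow, zpow_mul, zpow_natCast]
  rw [h3, h0, zpow_zero, mul_one] at key
  exact inv_eq_one.1 key

lemma isArt_of_norm (h : Good p k E N ζ) {d : ℕ} (hd : d ∣ N) {α φ : E ≃ₐ[k] E} (hφ : φ ζ = ζ ^ qk p k)
    (hα : α ζ = ζ ^ (qk p k ^ d)) (hα1 : α ^ (N / d) = 1) (x : (Sg α)ˣ) (hx : v p (Sg α) x = 1) :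
    IsArt p ζ φ α d (nrm k (Sg α) x) := by
  refine ⟨hα, incl (Sg α) E x, ?_, ?_, norm_formula p h hd hφ hα hα1 x⟩
  · ext
    exact (x : Sg α).2 ⟨α, Subgroup.mem_zpowers α⟩
  · rw [v_incl, (good_sigma p h hd hα hα1).2.1, hx]; simp

lemma good_one (h : Good p k E N ζ) {α : E ≃ₐ[k] E} (hα : α ζ = ζ ^ qk p k) :
    α ζ = ζ ^ (qk p k ^ 1) ∧ α ^ (N / 1) = 1 := ⟨by rw [pow_one]; exact hα, by rw [Nat.div_one]; exact h.2.2.2 α⟩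

lemma isArt_of_mem (h : Good p k E N ζ) {α φ : E ≃ₐ[k] E} (hφ : φ ζ = ζ ^ qk p k)
    (hα : α ζ = ζ ^ qk p k) {a : kˣ} (ha : v p k a = 1) (hm : a ∈ NG k (Sg α)) : IsArt p ζ φ α 1 a := by
  obtain ⟨x, rfl⟩ := hm
  obtain ⟨h1, h2⟩ := good_one p h hα
  refine isArt_of_norm p h (one_dvd N) hφ h1 h2 x ?_
  rw [v_nrm, (good_sigma p h (one_dvd N) h1 h2).1] at ha
  simpa using ha

end art
end LCFT

namespace LCFT
open Module

section art
variable (p : ℕ) [Fact p.Prime] {k E : Type} [Field k] [Algebra ℚ_[p] k] [FiniteDimensional ℚ_[p] k]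
  [Field E] [Algebra ℚ_[p] E] [FiniteDimensional ℚ_[p] E] [Algebra k E] [IsScalarTower ℚ_[p] k E]
  [FiniteDimensional k E] [IsAbelianGalois k E] {N : ℕ} {ζ : E}

lemma NG_le {k E : Type} [Field k] [Field E] [Algebra k E] [FiniteDimensional k E] (F : Type) [Field F] [Algebra k F] [Algebra F E] [IsScalarTower k F E] : NG k E ≤ NG k F := by
  rw [NG, NG_trans F]
  rintro _ ⟨y, rfl⟩
  exact ⟨nrm F E y, rfl⟩

lemma units_Sg (h : Good p k E N ζ) {α : E ≃ₐ[k] E} (hα : α ζ = ζ ^ qk p k) :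
    U p k ⊓ NG k (Sg α) ≤ NG k E := by
  obtain ⟨h1, h2⟩ := good_one p h hα
  obtain ⟨h3, h4, h5, h6⟩ := good_sigma p h (one_dvd N) h1 h2
  rintro u ⟨hu, x, rfl⟩
  have hx : x ∈ U p (Sg α) := (nrm_mem_U p).1 hu
  have hc : IsCyclic (E ≃ₐ[Sg α] E) := cyclic_fixed _
  have h7 := eram_mul p (Sg α) E
  rw [h4, one_mul] at h7
  obtain ⟨y, rfl⟩ := units_are_norms p (Sg α) E hc h7 hx
  rw [NG, NG_trans (Sg α)]
  exact ⟨y, rfl⟩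

lemma relIndex_good (h : Good p k E N ζ) : (NG k E).relIndex (U p k) ≠ 0 ∧ (NG k E).relIndex (U p k) ≤ Nat.card (Iner k ζ) := by
  obtain ⟨-, -, -, φ, hφ⟩ := good_F p h
  obtain ⟨h1, h2⟩ := good_one p h hφ
  obtain ⟨h3, h4, h5, h6⟩ := good_sigma p h (one_dvd N) h1 h2
  have e : (NG k E).relIndex (U p k) = (NG k (Sg φ)).relIndex (U p k) := by
    rw [← Subgroup.inf_relIndex_right, ← Subgroup.inf_relIndex_right (NG k (Sg φ))]
    congr 1
    apply le_antisymm
    · exact inf_le_inf_right _ (NG_le (Sg φ))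
    · rw [inf_comm]
      exact le_inf (units_Sg p h hφ) inf_le_left
  have h7 := index_abelian p k (Sg φ)
  rw [index_NG_eq p, h3, h6, ← e, mul_one, one_mul] at h7
  exact h7

lemma exists_art (h : Good p k E N ζ) {φ : E ≃ₐ[k] E} (hφ : φ ζ = ζ ^ qk p k) (π : kˣ) (hπ : v p k π = 1) :
    ∃ α : E ≃ₐ[k] E, α ζ = ζ ^ qk p k ∧ π ∈ NG k (Sg α) := by
  have hex : ∀ t : Iner k ζ, (φ * t) ζ = ζ ^ qk p k := fun t => by
    have : (t : E ≃ₐ[k] E) ζ = ζ := t.2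
    rw [AlgEquiv.mul_apply, this, hφ]
  have hch : ∀ t : Iner k ζ, ∃ a : kˣ, v p k a = 1 ∧ a ∈ NG k (Sg (φ * (t : E ≃ₐ[k] E))) := by
    intro t
    obtain ⟨x, hx⟩ := exists_v_one p (Sg (φ * (t : E ≃ₐ[k] E)))
    obtain ⟨h1, h2⟩ := good_one p h (hex t)
    refine ⟨nrm k _ x, ?_, x, rfl⟩
    rw [v_nrm, hx, (good_sigma p h (one_dvd N) h1 h2).1]; simp
  choose a ha1 ha2 using hch
  have hu : ∀ b c : kˣ, v p k b = 1 → v p k c = 1 → b * c⁻¹ ∈ U p k := by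
    intro b c hb hc
    rw [mem_U_v, v_mul, v_inv, hb, hc]; norm_num
  let ρ : Iner k ζ → U p k ⧸ (NG k E).subgroupOf (U p k) := fun t => QuotientGroup.mk (⟨a t * π⁻¹, hu _ _ (ha1 t) hπ⟩ : U p k)
  have hinj : Function.Injective ρ := by
    intro s t hst
    have h1 := QuotientGroup.eq.1 hst
    rw [Subgroup.mem_subgroupOf] at h1
    have h2 : (a s)⁻¹ * a t ∈ NG k E := by
      have : (a s)⁻¹ * a t = (a s * π⁻¹)⁻¹ * (a t * π⁻¹) := by rw [mul_inv, inv_inv, mul_assoc, mul_comm (a t), mul_inv_cancel_left]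
      rw [this]; exact h1
    have h3 : a t ∈ NG k (Sg (φ * (s : E ≃ₐ[k] E))) := by
      have := (NG k (Sg (φ * (s : E ≃ₐ[k] E)))).mul_mem (ha2 s) (NG_le _ h2)
      rwa [mul_inv_cancel_left] at this
    have A1 := isArt_of_mem p h hφ (hex s) (ha1 t) h3
    have A2 := isArt_of_mem p h hφ (hex t) (ha1 t) (ha2 t)
    have := art_rel p h hφ (Finset.univ : Finset (Fin 2)) ![φ * (s : E ≃ₐ[k] E), φ * (t : E ≃ₐ[k] E)] ![1, 1] ![a t, a t] ![1, -1]
      (fun i _ => by fin_cases i; exacts [A1, A2]) (by simp) (by simp)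
    simp only [Fin.prod_univ_two] at this
    simp at this
    rw [← mul_inv_rev, mul_inv_eq_one] at this
    exact Subtype.ext (mul_left_cancel this)
  obtain ⟨hr0, hr1⟩ := relIndex_good p h
  haveI : Finite (U p k ⧸ (NG k E).subgroupOf (U p k)) := Nat.finite_of_card_ne_zero hr0
  have hbij := hinj.bijective_of_nat_card_le hr1
  obtain ⟨t, ht⟩ := hbij.2 (QuotientGroup.mk 1)
  have h1 := QuotientGroup.eq.1 ht
  rw [Subgroup.mem_subgroupOf] at h1
  have h2 : π * (a t)⁻¹ ∈ NG k E := by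
    have : π * (a t)⁻¹ = (a t * π⁻¹)⁻¹ * 1 := by rw [mul_inv, inv_inv, mul_one, mul_comm]
    rw [this]; exact h1
  refine ⟨φ * t, hex t, ?_⟩
  have := (NG k (Sg (φ * (t : E ≃ₐ[k] E)))).mul_mem (NG_le _ h2) (ha2 t)
  rwa [inv_mul_cancel_right] at this

theorem exists_Art (h : Good p k E N ζ) : ∃ Art : kˣ →* (E ≃ₐ[k] E),
    (∀ a α, v p k a = 1 → (Art a = α ↔ α ζ = ζ ^ qk p k ∧ a ∈ NG k (Sg α))) ∧ 
    (∀ (β : E ≃ₐ[k] E) (f : ℕ) (a : kˣ) (φ : E ≃ₐ[k] E), 1 ≤ f → φ ζ = ζ ^ qk p k → v p k a = (f : ℤ) → IsArt p ζ φ β f a → Art a = β) ∧ Function.Surjective Art := by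
  obtain ⟨-, -, -, φ, hφ⟩ := good_F p h
  have hφ1 : φ ζ = ζ ^ (qk p k ^ 1) := by rw [pow_one]; exact hφ
  choose A hA1 hA2 using exists_art p h hφ
  have hA : ∀ π hπ, IsArt p ζ φ (A π hπ) 1 π := fun π hπ => isArt_of_mem p h hφ (hA1 π hπ) hπ (hA2 π hπ)
  have huniq : ∀ π α, IsArt p ζ φ α 1 π → ∀ hπ, A π hπ = α := by
    intro π α hα hπ
    have := art_rel p h hφ (Finset.univ : Finset (Fin 2)) ![A π hπ, α] ![1, 1] ![π, π] ![1, -1]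
      (fun i _ => by fin_cases i; exacts [hA π hπ, hα]) (by simp) (by simp)
    simp only [Fin.prod_univ_two] at this
    simp at this
    rwa [mul_inv_eq_one] at this
  obtain ⟨π, hπ⟩ := exists_v_one p k
  have hrel : ∀ a b c d ha hb hc hd, a * b = c * d → A a ha * A b hb = A c hc * A d hd := by
    intro a b c d ha hb hc hd habcd
    have := art_rel p h hφ (Finset.univ : Finset (Fin 4)) ![A a ha, A b hb, A c hc, A d hd] ![1, 1, 1, 1] ![a, b, c, d] ![1, 1, -1, -1]
      (fun i _ => by fin_cases i; exacts [hA a ha, hA b hb, hA c hc, hA d hd]) (by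
        simp [Fin.prod_univ_four]; rw [habcd, mul_inv_cancel_comm, mul_inv_cancel]) (by simp [Fin.sum_univ_four])
    simp [Fin.prod_univ_four] at this
    rw [mul_inv_eq_one, mul_inv_eq_iff_eq_mul] at this
    rw [this, mul_comm]
  have hpv : ∀ a : kˣ, v p k (π * (a * π ^ (-(v p k a)))) = 1 := by
    intro a; rw [v_mul, v_mul, v_zpow, hπ]; ring
  let Art : kˣ →* (E ≃ₐ[k] E) := 
    { toFun := fun a => A π hπ ^ (v p k a) * (A (π * (a * π ^ (-(v p k a)))) (hpv a) * (A π hπ)⁻¹)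
      map_one' := by
        have : ∀ b (hb : v p k b = 1), b = π → A b hb = A π hπ := by rintro b hb rfl; rfl
        have e := this (π * (1 * π ^ (-(v p k 1)))) (hpv 1) (by rw [v_one]; simp)
        rw [e, v_one]; simp
      map_mul' := fun a b => by
        have := hrel (π * (a * π ^ (-(v p k a)))) (π * (b * π ^ (-(v p k b)))) (π * (a * b * π ^ (-(v p k (a * b))))) π
          (hpv a) (hpv b) (hpv (a * b)) hπ (by rw [v_mul, neg_add, zpow_add]; simp only [mul_assoc, mul_comm, mul_left_comm])
        have h2 : A (π * (a * b * π ^ (-(v p k (a * b))))) (hpv (a * b)) = A (π * (a * π ^ (-(v p k a)))) (hpv a) * A (π * (b * π ^ (-(v p k b)))) (hpv b) * (A π hπ)⁻¹ := by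
          rw [this, mul_inv_cancel_right]
        rw [h2, v_mul, zpow_add]
        simp only [mul_assoc, mul_comm, mul_left_comm] }
  have hArt : ∀ a ha, Art a = A a ha := by
    intro a ha
    change A π hπ ^ (v p k a) * (A (π * (a * π ^ (-(v p k a)))) (hpv a) * (A π hπ)⁻¹) = _
    have : ∀ b (hb : v p k b = 1), b = a → A b hb = A a ha := by rintro b hb rfl; rfl
    have e := this (π * (a * π ^ (-(v p k a)))) (hpv a) (by rw [ha, zpow_neg, zpow_one]; rw [mul_left_comm, mul_inv_cancel, mul_one])
    rw [e, ha, zpow_one]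
    rw [mul_left_comm, mul_inv_cancel, mul_one]
  have hsurj : Function.Surjective Art := by
    have hfr : ∀ α : E ≃ₐ[k] E, α ζ = ζ ^ qk p k → α ∈ Art.range := by
      intro α hα
      obtain ⟨x, hx⟩ := exists_v_one p (Sg α)
      obtain ⟨h1, h2⟩ := good_one p h hα
      have hv : v p k (nrm k _ x) = 1 := by
        rw [v_nrm, hx, (good_sigma p h (one_dvd N) h1 h2).1]; simp
      exact ⟨nrm k _ x, (hArt _ hv).trans (huniq _ _ (isArt_of_mem p h hφ hα hv ⟨x, rfl⟩) _)⟩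
    intro g
    obtain ⟨i, hi⟩ := zeta_aut p h.1 h.2.1 g
    have h3 : φ * ((φ ^ i)⁻¹ * g) ∈ Art.range := by
      apply hfr
      rw [AlgEquiv.mul_apply, AlgEquiv.mul_apply, hi, ← one_mul i, ← pow_zeta hφ1, one_mul]
      have : (φ ^ i)⁻¹ ((φ ^ i) ζ) = ζ := (φ ^ i).symm_apply_apply ζ
      rw [this, hφ]
    have h4 := hfr φ hφ
    have : g = φ ^ i * (φ⁻¹ * (φ * ((φ ^ i)⁻¹ * g))) := by group
    rw [this]
    exact Art.range.mul_mem (Art.range.pow_mem h4 _) (Art.range.mul_mem (Art.range.inv_mem h4) h3)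
  refine ⟨Art, ?_, ?_, hsurj⟩
  · intro a α ha
    constructor
    · intro h1
      rw [← h1, hArt a ha]
      exact ⟨hA1 a ha, hA2 a ha⟩
    · rintro ⟨h1, h2⟩
      rw [hArt a ha]
      exact huniq _ _ (isArt_of_mem p h hφ h1 ha h2) _
  · intro β f a φ' hf hφ' ha hβ
    have hA' : ∀ b hb, IsArt p ζ φ' (A b hb) 1 b := fun b hb => isArt_of_mem p h hφ' (hA1 b hb) hb (hA2 b hb)
    have hv : v p k (a * π ^ (-(f - 1 : ℤ))) = 1 := by rw [v_mul, v_zpow, ha, hπ]; ring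
    have := art_rel p h hφ' (Finset.univ : Finset (Fin 3)) ![β, A π hπ, A _ hv] ![f, 1, 1] ![a, π, a * π ^ (-(f - 1 : ℤ))] ![1, -(f - 1 : ℤ), -1]
      (fun i _ => by fin_cases i; exacts [hβ, hA' π hπ, hA' _ hv]) (by
        simp [Fin.prod_univ_three]) (by simp [Fin.sum_univ_three])
    have this : β ^ (1:ℤ) * A π hπ ^ (-(f - 1 : ℤ)) * (A _ hv) ^ (-1 : ℤ) = 1 := by
      rw [Fin.prod_univ_three] at this
      exact this
    have e1 : a = π ^ (f - 1 : ℤ) * (a * π ^ (-(f - 1 : ℤ))) := by rw [zpow_neg, mul_left_comm, mul_inv_cancel, mul_one]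
    have e2 : Art a = A π hπ ^ (f - 1 : ℤ) * A _ hv := by
      conv_lhs => rw [e1]
      rw [map_mul, map_zpow, hArt π hπ, hArt _ hv]
    rw [e2]
    rw [zpow_one, zpow_neg, zpow_neg, zpow_one, mul_inv_eq_one, mul_inv_eq_iff_eq_mul] at this
    rw [this, mul_comm]

end art
end LCFT

namespace LCFT
open Module

section func
variable (p : ℕ) [Fact p.Prime] {k₁ k₂ E₁ E₂ : Type}
  [Field k₁] [Algebra ℚ_[p] k₁] [FiniteDimensional ℚ_[p] k₁]
  [Field k₂] [Algebra ℚ_[p] k₂] [FiniteDimensional ℚ_[p] k₂]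
  [Field E₁] [Algebra ℚ_[p] E₁] [FiniteDimensional ℚ_[p] E₁]
  [Field E₂] [Algebra ℚ_[p] E₂] [FiniteDimensional ℚ_[p] E₂]
  [Algebra k₁ k₂] [IsScalarTower ℚ_[p] k₁ k₂] [FiniteDimensional k₁ k₂]
  [Algebra k₁ E₁] [IsScalarTower ℚ_[p] k₁ E₁] [FiniteDimensional k₁ E₁]
  [Algebra k₂ E₂] [IsScalarTower ℚ_[p] k₂ E₂] [FiniteDimensional k₂ E₂]
  [Algebra E₁ E₂] [IsScalarTower ℚ_[p] E₁ E₂] [FiniteDimensional E₁ E₂]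
  [Algebra k₁ E₂] [IsScalarTower ℚ_[p] k₁ E₂] [FiniteDimensional k₁ E₂]
  [IsScalarTower k₁ k₂ E₂] [IsScalarTower k₁ E₁ E₂]
  [IsAbelianGalois k₁ E₁] [IsAbelianGalois k₂ E₂] {N₁ N₂ : ℕ} {ζ₁ : E₁} {ζ₂ : E₂}

lemma frob_zeta {k E : Type} [Field k] [Algebra ℚ_[p] k] [FiniteDimensional ℚ_[p] k]
  [Field E] [Algebra ℚ_[p] E] [FiniteDimensional ℚ_[p] E] [Algebra k E] [IsScalarTower ℚ_[p] k E]
  [FiniteDimensional k E] {N : ℕ} {ζ : E} (h : Good p k E N ζ) {α : E ≃ₐ[k] E} (hα : α ζ = ζ ^ qk p k)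
  {ξ : E} (hξ : ξ ^ (qk p E - 1) = 1) : α ξ = ξ ^ qk p k := by
  have h1 : qk p E = qk p k ^ N := by rw [qk_fres p (k := k), h.2.2.1]
  rw [h1] at hξ
  haveI : NeZero (qk p k ^ N - 1) := ⟨pow_sub_ne_zero (one_lt_qk p k) h.1⟩
  obtain ⟨i, -, rfl⟩ := h.2.1.eq_pow_of_pow_eq_one hξ
  rw [map_pow, hα, ← pow_mul, ← pow_mul, mul_comm]

lemma zeta_lift (h1 : Good p k₁ E₁ N₁ ζ₁) : (algebraMap E₁ E₂ ζ₁) ^ (qk p E₂ - 1) = 1 := by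
  have h2 : qk p E₁ = qk p k₁ ^ N₁ := by rw [qk_fres p (k := k₁), h1.2.2.1]
  have h3 : qk p E₂ = qk p E₁ ^ fres p E₁ E₂ := qk_fres p
  have h4 : qk p k₁ ^ N₁ - 1 ∣ qk p E₂ - 1 := by
    rw [h3, ← h2]
    simpa using Nat.sub_dvd_pow_sub_pow (qk p E₁) 1 (fres p E₁ E₂)
  rw [← map_pow, (h1.2.1.pow_eq_one_iff_dvd _).2 h4, map_one]

set_option maxHeartbeats 1000000 in
lemma func_art (h1 : Good p k₁ E₁ N₁ ζ₁) (h2 : Good p k₂ E₂ N₂ ζ₂) (hf : fres p k₁ k₂ ∣ N₁)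
    (hk : ∀ g : E₁ ≃ₐ[k₁] E₁, g ζ₁ = ζ₁ ^ (qk p k₁ ^ fres p k₁ k₂) → g ^ (N₁ / fres p k₁ k₂) = 1) {α : E₂ ≃ₐ[k₂] E₂} (hα : α ζ₂ = ζ₂ ^ qk p k₂)
    {π : k₂ˣ} (hv : v p k₂ π = 1) (hπ : π ∈ NG k₂ (Sg α)) {β φ : E₁ ≃ₐ[k₁] E₁}
    (hβ : ∀ x : E₁, α (algebraMap E₁ E₂ x) = algebraMap E₁ E₂ (β x)) (hφ : φ ζ₁ = ζ₁ ^ qk p k₁) :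
    IsArt p ζ₁ φ β (fres p k₁ k₂) (nrm k₁ k₂ π) := by
  have hq : qk p k₂ = qk p k₁ ^ fres p k₁ k₂ := qk_fres p
  have hβζ : β ζ₁ = ζ₁ ^ (qk p k₁ ^ fres p k₁ k₂) := by
    apply (algebraMap E₁ E₂).injective
    rw [← hβ, frob_zeta p h2 hα (zeta_lift p h1), map_pow, hq]
  have hS1 := good_sigma p h1 hf hβζ (hk β hβζ)
  obtain ⟨g1, g2⟩ := good_one p h2 hα
  have hS2 := good_sigma p h2 (one_dvd _) g1 g2
  have hm : ∀ x : Sg β, algebraMap E₁ E₂ x ∈ Sg α := by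
    intro x
    rw [IntermediateField.mem_fixedField_iff]
    intro g hg
    have h3 : g ∈ MulAction.stabilizer (E₂ ≃ₐ[k₂] E₂) (algebraMap E₁ E₂ (x : E₁)) := by
      refine (Subgroup.zpowers_le.2 ?_) hg
      change α (algebraMap E₁ E₂ (x : E₁)) = algebraMap E₁ E₂ (x : E₁)
      rw [hβ]
      congr 1
      exact x.2 ⟨β, Subgroup.mem_zpowers β⟩
    exact h3
  let j : Sg β →+* Sg α := RingHom.codRestrict ((algebraMap E₁ E₂).comp (algebraMap (Sg β) E₁)) (Sg α) hm
  letI : Algebra (Sg β) (Sg α) := j.toAlgebra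
  have hj : ∀ x : Sg β, ((algebraMap (Sg β) (Sg α) x : Sg α) : E₂) = algebraMap E₁ E₂ (x : E₁) := fun _ => rfl
  haveI : IsScalarTower k₁ k₂ (Sg α) := IsScalarTower.of_algebraMap_eq (fun x => by
    apply Subtype.ext
    exact IsScalarTower.algebraMap_apply k₁ k₂ E₂ x)
  haveI : IsScalarTower ℚ_[p] k₁ (Sg α) := IsScalarTower.of_algebraMap_eq (fun x => by
    rw [IsScalarTower.algebraMap_apply ℚ_[p] k₂ (Sg α), IsScalarTower.algebraMap_apply ℚ_[p] k₁ k₂, ← IsScalarTower.algebraMap_apply k₁ k₂])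
  haveI : IsScalarTower k₁ (Sg β) (Sg α) := IsScalarTower.of_algebraMap_eq (fun x => by
    apply Subtype.ext
    rw [hj]
    change algebraMap k₁ E₂ x = algebraMap E₁ E₂ (algebraMap k₁ E₁ x)
    rw [← IsScalarTower.algebraMap_apply])
  haveI : IsScalarTower ℚ_[p] (Sg β) (Sg α) := IsScalarTower.of_algebraMap_eq (fun x => by
    rw [IsScalarTower.algebraMap_apply ℚ_[p] k₁ (Sg α), IsScalarTower.algebraMap_apply k₁ (Sg β) (Sg α), ← IsScalarTower.algebraMap_apply ℚ_[p] k₁ (Sg β)])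
  haveI : FiniteDimensional k₁ (Sg α) := FiniteDimensional.trans k₁ k₂ (Sg α)
  haveI : FiniteDimensional (Sg β) (Sg α) := FiniteDimensional.right k₁ _ _
  obtain ⟨x, rfl⟩ := hπ
  rw [v_nrm, hS2.1] at hv
  have hx : v p (Sg α) x = 1 := by simpa using hv
  have e1 := fres_trans p (k := k₁) (E := Sg α) k₂
  have e2 := fres_trans p (k := k₁) (E := Sg α) (Sg β)
  rw [hS2.1] at e1
  rw [hS1.1, ← e1] at e2
  have e3 : fres p (Sg β) (Sg α) = 1 := Nat.eq_of_mul_eq_mul_left (fres_pos p k₁ k₂) e2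
  have e4 : nrm k₁ k₂ (nrm k₂ (Sg α) x) = nrm k₁ (Sg β) (nrm (Sg β) (Sg α) x) := by
    rw [← MonoidHom.comp_apply, ← MonoidHom.comp_apply, ← NG_trans, ← NG_trans]
  rw [e4]
  exact isArt_of_norm p h1 hf hφ hβζ (hk β hβζ) _ (by rw [v_nrm, e3, hx]; simp)

/-- the Artin map of a good extension -/
noncomputable def ArtG {k E : Type} [Field k] [Algebra ℚ_[p] k] [FiniteDimensional ℚ_[p] k]
  [Field E] [Algebra ℚ_[p] E] [FiniteDimensional ℚ_[p] E] [Algebra k E] [IsScalarTower ℚ_[p] k E]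
  [FiniteDimensional k E] [IsAbelianGalois k E] {N : ℕ} {ζ : E} (h : Good p k E N ζ) : kˣ →* (E ≃ₐ[k] E) := (exists_Art p h).choose

section
variable {k E : Type} [Field k] [Algebra ℚ_[p] k] [FiniteDimensional ℚ_[p] k]
  [Field E] [Algebra ℚ_[p] E] [FiniteDimensional ℚ_[p] E] [Algebra k E] [IsScalarTower ℚ_[p] k E]
  [FiniteDimensional k E] [IsAbelianGalois k E] {N : ℕ} {ζ : E} (h : Good p k E N ζ)

lemma ArtG_iff {a : kˣ} {α : E ≃ₐ[k] E} (ha : v p k a = 1) : ArtG p h a = α ↔ α ζ = ζ ^ qk p k ∧ a ∈ NG k (Sg α) :=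
  (exists_Art p h).choose_spec.1 a α ha
lemma ArtG_eq {β : E ≃ₐ[k] E} {f : ℕ} {a : kˣ} {φ : E ≃ₐ[k] E} (h1 : 1 ≤ f) (h2 : φ ζ = ζ ^ qk p k) (h3 : v p k a = (f : ℤ))
    (h4 : IsArt p ζ φ β f a) : ArtG p h a = β :=
  (exists_Art p h).choose_spec.2.1 β f a φ h1 h2 h3 h4
lemma ArtG_surj : Function.Surjective (ArtG p h) := (exists_Art p h).choose_spec.2.2

lemma hom_ext_unif {G : Type} [Group G] {f g : kˣ →* G} (hfg : ∀ a, v p k a = 1 → f a = g a) : f = g := by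
  obtain ⟨π, hπ⟩ := exists_v_one p k
  ext a
  have e : a = π ^ (v p k a) * (π⁻¹ * (π * (a * π ^ (-(v p k a))))) := by
    rw [inv_mul_cancel_left, zpow_neg, mul_left_comm, mul_inv_cancel, mul_one]
  rw [e, map_mul, map_mul, map_zpow, map_inv, map_mul g, map_mul g, map_zpow, map_inv, hfg _ hπ, hfg (π * (a * π ^ (-(v p k a)))) (by
    rw [v_mul, v_mul, v_zpow, hπ]; ring)]
end

theorem func_ArtG (h1 : Good p k₁ E₁ N₁ ζ₁) (h2 : Good p k₂ E₂ N₂ ζ₂) (hf : fres p k₁ k₂ ∣ N₁)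
    (hk : ∀ g : E₁ ≃ₐ[k₁] E₁, g ζ₁ = ζ₁ ^ (qk p k₁ ^ fres p k₁ k₂) → g ^ (N₁ / fres p k₁ k₂) = 1) (a : k₂ˣ) (x : E₁) :
    ArtG p h2 a (algebraMap E₁ E₂ x) = algebraMap E₁ E₂ (ArtG p h1 (nrm k₁ k₂ a) x) := by
  have key : ∀ α : E₂ ≃ₐ[k₁] E₂, ∀ x, α (algebraMap E₁ E₂ x) = algebraMap E₁ E₂ (AlgEquiv.restrictNormalHom E₁ α x) :=
    fun α x => (AlgEquiv.restrictNormal_commutes α E₁ x).symm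
  let rs : (E₂ ≃ₐ[k₂] E₂) →* (E₂ ≃ₐ[k₁] E₂) := 
    { toFun := fun σ => σ.restrictScalars k₁, map_one' := rfl, map_mul' := fun _ _ => rfl }
  have : ((AlgEquiv.restrictNormalHom E₁).comp rs).comp (ArtG p h2) = (ArtG p h1).comp (nrm k₁ k₂) := by
    apply hom_ext_unif p
    intro a ha
    obtain ⟨-, -, -, φ, hφ⟩ := good_F p h1
    obtain ⟨g1, g2⟩ := (ArtG_iff p h2 ha).1 rfl
    symm
    refine ArtG_eq p h1 (fres_pos p k₁ k₂) hφ (by rw [v_nrm, ha, mul_one]) (func_art p h1 h2 hf hk g1 ha g2 (fun x => ?_) hφ)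
    exact key (rs (ArtG p h2 a)) x
  have h3 := DFunLike.congr_fun this a
  have h4 := key (rs (ArtG p h2 a)) x
  rw [MonoidHom.comp_apply, MonoidHom.comp_apply, MonoidHom.comp_apply] at h3
  rw [h3] at h4
  exact h4

end func
end LCFT

namespace LCFT
open Module

section res
variable {k Ω : Type} [Field k] [Field Ω] [Algebra k Ω]

/-- restriction of automorphisms for subfields of `Ω` -/
noncomputable def res {E S : IntermediateField k Ω} [Normal k E] (h : E ≤ S) : (S ≃ₐ[k] S) →* (E ≃ₐ[k] E) :=
  letI : Algebra E S := (IntermediateField.inclusion h).toRingHom.toAlgebra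
  haveI : IsScalarTower k E S := IsScalarTower.of_algebraMap_eq' (IntermediateField.inclusion h).comp_algebraMap.symm
  AlgEquiv.restrictNormalHom E

lemma res_coe {E S : IntermediateField k Ω} [Normal k E] (h : E ≤ S) (σ : S ≃ₐ[k] S) (x : E) :
    ((res h σ x : E) : Ω) = (σ ⟨x, h x.2⟩ : S) := by
  letI : Algebra E S := (IntermediateField.inclusion h).toRingHom.toAlgebra
  haveI : IsScalarTower k E S := IsScalarTower.of_algebraMap_eq' (IntermediateField.inclusion h).comp_algebraMap.symm
  have := AlgEquiv.restrictNormal_commutes σ E x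
  exact congrArg Subtype.val this

lemma res_surj {E S : IntermediateField k Ω} [Normal k E] [Normal k S] (h : E ≤ S) : Function.Surjective (res h) := by
  letI : Algebra E S := (IntermediateField.inclusion h).toRingHom.toAlgebra
  haveI : IsScalarTower k E S := IsScalarTower.of_algebraMap_eq' (IntermediateField.inclusion h).comp_algebraMap.symm
  exact AlgEquiv.restrictNormalHom_surjective S

lemma gal_ext_of {S : IntermediateField k Ω} (g : S ≃ₐ[k] S) (T : Set Ω) (hT : S ≤ IntermediateField.adjoin k T)
    (hg : ∀ x ∈ T, ∃ hx : x ∈ S, g ⟨x, hx⟩ = ⟨x, hx⟩) : g = 1 := by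
  let F : IntermediateField k S := IntermediateField.fixedField (Subgroup.zpowers g)
  have hm : ∀ x : S, g x = x → x ∈ F := by
    intro x hx
    rw [IntermediateField.mem_fixedField_iff]
    intro g' hg'
    have h3 : g' ∈ MulAction.stabilizer (S ≃ₐ[k] S) x := (Subgroup.zpowers_le.2 hx) hg'
    exact h3
  have h1 : IntermediateField.adjoin k T ≤ IntermediateField.lift F := by
    rw [IntermediateField.adjoin_le_iff]
    intro x hx
    obtain ⟨h2, h3⟩ := hg x hx
    exact ⟨⟨x, h2⟩, hm _ h3, rfl⟩
  ext x
  obtain ⟨y, hy, hyx⟩ := h1 (hT x.2)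
  have : y = x := Subtype.ext hyx
  subst this
  exact congrArg Subtype.val (hy ⟨g, Subgroup.mem_zpowers g⟩)

lemma gal_ext_iSup {ι : Type} (E : ι → IntermediateField k Ω) {S : IntermediateField k Ω} (hS : S = ⨆ i, E i) (g : S ≃ₐ[k] S)
    (hg : ∀ i x (hx : x ∈ S), x ∈ E i → g ⟨x, hx⟩ = ⟨x, hx⟩) : g = 1 := by
  apply gal_ext_of g (⋃ i, (E i : Set Ω))
  · rw [hS]
    exact iSup_le fun i x hx => IntermediateField.subset_adjoin _ _ (Set.mem_iUnion.2 ⟨i, hx⟩)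
  · intro x hx
    obtain ⟨i, hi⟩ := Set.mem_iUnion.1 hx
    have hx' : x ∈ S := by rw [hS]; exact le_iSup E i hi
    exact ⟨hx', hg i x hx' hi⟩

lemma comm_of {S : IntermediateField k Ω} {ι : Type} (E : ι → IntermediateField k Ω) (hS : S = ⨆ i, E i)
    (hE : ∀ i, IsAbelianGalois k (E i)) (σ τ : S ≃ₐ[k] S) : σ * τ = τ * σ := by
  rw [← mul_inv_eq_one]
  apply gal_ext_iSup E hS
  intro i x hx hi
  have h : E i ≤ S := by rw [hS]; exact le_iSup E i
  have := hE i
  have h1 : res h (σ * τ * (τ * σ)⁻¹) = 1 := by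
    rw [map_mul, map_inv, map_mul, map_mul, mul_inv_eq_one, mul_comm]
  have h2 := res_coe h (σ * τ * (τ * σ)⁻¹) ⟨x, hi⟩
  rw [h1] at h2
  exact Subtype.ext h2.symm

theorem abelian_iSup [CharZero k] {ι : Type} (E : ι → IntermediateField k Ω) (hE : ∀ i, IsAbelianGalois k (E i)) :
    IsAbelianGalois k (⨆ i, E i : IntermediateField k Ω) := by
  haveI : Normal k (⨆ i, E i : IntermediateField k Ω) := IntermediateField.normal_iSup k Ω E
  haveI : IsGalois k (⨆ i, E i : IntermediateField k Ω) := IsGalois.mk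
  exact { is_comm := ⟨comm_of E rfl hE⟩ }

theorem abelian_sup [CharZero k] (E F : IntermediateField k Ω) [IsAbelianGalois k E] [IsAbelianGalois k F] :
    IsAbelianGalois k (E ⊔ F : IntermediateField k Ω) := by
  rw [← iSup_bool_eq (f := Bool.rec F E)]
  apply abelian_iSup
  rintro (_ | _) <;> assumption

theorem abelian_le {E F : IntermediateField k Ω} (h : E ≤ F) [IsAbelianGalois k F] : IsAbelianGalois k E :=
  IsAbelianGalois.of_algHom (IntermediateField.inclusion h)

end res

section base
variable {k₁ k₂ Ω : Type} [Field k₁] [Field k₂] [Field Ω] [Algebra k₁ k₂] [Algebra k₁ Ω] [Algebra k₂ Ω] [IsScalarTower k₁ k₂ Ω] [CharZero k₁] [CharZero k₂]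

theorem base_fd (E : IntermediateField k₁ Ω) [FiniteDimensional k₁ E] : FiniteDimensional k₂ (IntermediateField.adjoin k₂ (E : Set Ω)) := by
  obtain ⟨x, hx⟩ := Field.exists_primitive_element k₁ E
  have h1 : E = IntermediateField.adjoin k₁ {(x : Ω)} := by
    have := congrArg (IntermediateField.map E.val) hx
    rw [IntermediateField.adjoin_map, ← AlgHom.fieldRange_eq_map, IntermediateField.fieldRange_val, Set.image_singleton] at this
    exact this.symm
  have h2 : IntermediateField.adjoin k₂ (E : Set Ω) = IntermediateField.adjoin k₂ {(x : Ω)} := by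
    apply le_antisymm
    · rw [IntermediateField.adjoin_le_iff]
      have : E ≤ (IntermediateField.adjoin k₂ {(x : Ω)}).restrictScalars k₁ := by
        conv_lhs => rw [h1]
        rw [IntermediateField.adjoin_le_iff]
        exact IntermediateField.subset_adjoin _ _
      exact this
    · exact IntermediateField.adjoin.mono _ _ _ (by simp)
  rw [h2]
  apply IntermediateField.adjoin.finiteDimensional
  have h3 : IsIntegral k₁ (x : Ω) := (IsIntegral.of_finite k₁ x).map E.val
  exact h3.tower_top

theorem base_abelian (E : IntermediateField k₁ Ω) [FiniteDimensional k₁ E] [IsAbelianGalois k₁ E] : IsAbelianGalois k₂ (IntermediateField.adjoin k₂ (E : Set Ω)) := by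
  set M := IntermediateField.adjoin k₂ (E : Set Ω) with hM
  have hEM : ∀ x ∈ E, x ∈ M := fun x hx => IntermediateField.subset_adjoin k₂ _ hx
  let j : E →+* M := RingHom.codRestrict (algebraMap E Ω) M (fun x => hEM x x.2)
  haveI : Normal k₂ M := by
    rw [normal_iff]
    have key : ∀ x ∈ (E : Set Ω), IsIntegral k₂ x ∧ ((minpoly k₂ x).map (algebraMap k₂ M)).Splits := by
      intro x hx
      have h3 : IsIntegral k₁ x := (IsIntegral.of_finite k₁ (⟨x, hx⟩ : E)).map E.val
      refine ⟨h3.tower_top, ?_⟩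
      have h4 := minpoly.dvd_map_of_isScalarTower k₁ k₂ x
      have h5 := (Normal.splits (F := k₁) (K := E) inferInstance ⟨x, hx⟩).map j
      have h6 : minpoly k₁ (⟨x, hx⟩ : E) = minpoly k₁ x := (minpoly.algebraMap_eq (B := E) (B' := Ω) (algebraMap E Ω).injective ⟨x, hx⟩).symm
      rw [h6, Polynomial.map_map] at h5
      have h7 : j.comp (algebraMap k₁ E) = (algebraMap k₂ M).comp (algebraMap k₁ k₂) := by
        ext y
        exact IsScalarTower.algebraMap_apply k₁ k₂ Ω y
      rw [h7, ← Polynomial.map_map] at h5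
      exact h5.of_dvd (Polynomial.map_ne_zero (Polynomial.map_ne_zero (minpoly.ne_zero h3))) (Polynomial.map_dvd _ h4)
    intro x
    have h8 := IntermediateField.splits_of_mem_adjoin k₂ Ω key x.2
    have h9 : minpoly k₂ (x : Ω) = minpoly k₂ x := minpoly.algebraMap_eq (B := M) (B' := Ω) (algebraMap M Ω).injective x
    rw [h9] at h8
    haveI := base_fd (k₂ := k₂) E
    exact ⟨IsIntegral.of_finite k₂ x, h8⟩
  haveI : IsGalois k₂ M := IsGalois.mk
  have hle : E ≤ M.restrictScalars k₁ := hEM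
  refine { is_comm := ⟨fun σ τ => ?_⟩ }
  rw [← mul_inv_eq_one]
  apply gal_ext_of _ (E : Set Ω) le_rfl
  intro x hx
  let rs : (M ≃ₐ[k₂] M) →* (M.restrictScalars k₁ ≃ₐ[k₁] M.restrictScalars k₁) := 
    { toFun := fun σ => σ.restrictScalars k₁, map_one' := rfl, map_mul' := fun _ _ => rfl }
  refine ⟨hEM x hx, ?_⟩
  have h1 : res hle (rs (σ * τ * (τ * σ)⁻¹)) = 1 := by
    rw [map_mul, map_inv, map_mul, map_mul, map_mul, map_mul, map_inv, map_mul, mul_inv_eq_one, mul_comm]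
  have h2 := res_coe hle (rs (σ * τ * (τ * σ)⁻¹)) ⟨x, hx⟩
  rw [h1] at h2
  exact Subtype.ext h2.symm

end base
end LCFT

namespace LCFT
open Module

instance fd_omega (p : ℕ) [Fact p.Prime] (k Ω : Type) [Field k] [Algebra ℚ_[p] k] [FiniteDimensional ℚ_[p] k]
  [Field Ω] [Algebra ℚ_[p] Ω] [Algebra k Ω] [IsScalarTower ℚ_[p] k Ω] (F : IntermediateField k Ω) [FiniteDimensional k F] :
  FiniteDimensional ℚ_[p] F := FiniteDimensional.trans ℚ_[p] k F

lemma charZero' (p : ℕ) [Fact p.Prime] (k : Type) [Field k] [Algebra ℚ_[p] k] : CharZero k :=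
  charZero_of_injective_algebraMap (algebraMap ℚ_[p] k).injective

section art
variable (p : ℕ) [Fact p.Prime] {k Ω : Type} [Field k] [Algebra ℚ_[p] k] [FiniteDimensional ℚ_[p] k]
  [Field Ω] [Algebra ℚ_[p] Ω] [Algebra k Ω] [IsScalarTower ℚ_[p] k Ω] [IsAlgClosed Ω]

lemma exists_zeta [CharZero Ω] (n : ℕ) (hn : n ≠ 0) : ∃ ζ : Ω, IsPrimitiveRoot ζ n := by
  haveI : NeZero (n : Ω) := ⟨Nat.cast_ne_zero.2 hn⟩
  exact HasEnoughRootsOfUnity.exists_primitiveRoot Ω n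

lemma fd_zeta {n : ℕ} (hn : n ≠ 0) {ζ : Ω} (hζ : IsPrimitiveRoot ζ n) : FiniteDimensional k (IntermediateField.adjoin k {ζ}) :=
  IntermediateField.adjoin.finiteDimensional (hζ.isIntegral (Nat.pos_of_ne_zero hn)).tower_top

lemma prim_gen {n : ℕ} {ζ : Ω} (hζ : IsPrimitiveRoot ζ n) : IsPrimitiveRoot (IntermediateField.AdjoinSimple.gen k ζ) n :=
  IsPrimitiveRoot.of_map_of_injective (f := algebraMap (IntermediateField.adjoin k {ζ}) Ω) (by
    rw [IntermediateField.AdjoinSimple.algebraMap_gen]; exact hζ) (algebraMap (IntermediateField.adjoin k {ζ}) Ω).injective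

set_option maxHeartbeats 1000000 in
theorem exists_good {D : ℕ} (hD : D ≠ 0) (E₀ : IntermediateField k Ω) [FiniteDimensional k E₀] [IsAbelianGalois k E₀] :
    ∃ (N : ℕ) (E : IntermediateField k Ω) (_ : E₀ ≤ E) (_ : FiniteDimensional k E) (_ : IsAbelianGalois k E) (ζ : E),
      Good p k E N ζ ∧ (∀ f, f ∣ D → f ∣ N ∧ ∀ g : E ≃ₐ[k] E, g ζ = ζ ^ (qk p k ^ f) → g ^ (N / f) = 1) ∧ E = E₀ ⊔ IntermediateField.adjoin k {(ζ : Ω)} := by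
  haveI := charZero' p k
  haveI := charZero' p Ω
  set f₀ := fres p k E₀ with hf₀
  have hf₀p : 0 < f₀ := fres_pos p k E₀
  set e₀ := Nat.card (E₀ ≃ₐ[k] E₀) with he₀
  have he₀p : 0 < e₀ := Nat.card_pos
  have hN : f₀ * (e₀ * D) ≠ 0 := by positivity
  have hN' : e₀ * D ≠ 0 := by positivity
  have h0 : qk p k ^ (f₀ * (e₀ * D)) - 1 ≠ 0 := pow_sub_ne_zero (one_lt_qk p k) hN
  obtain ⟨ζ, hζ⟩ := exists_zeta (Ω := Ω) _ h0
  have hq : qk p E₀ ^ (e₀ * D) = qk p k ^ (f₀ * (e₀ * D)) := by rw [qk_fres p (k := k), ← pow_mul]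
  haveI : FiniteDimensional k (IntermediateField.adjoin k {ζ}) := fd_zeta h0 hζ
  haveI : FiniteDimensional E₀ (IntermediateField.adjoin E₀ {ζ}) := fd_zeta h0 hζ
  have u1 := unram_gen p (k := k) (K := IntermediateField.adjoin k {ζ}) hN (prim_gen hζ) (adjoin_self_top ζ)
  have u2 := unram_gen p (k := E₀) (K := IntermediateField.adjoin E₀ {ζ}) hN' (by rw [hq]; exact prim_gen hζ) (adjoin_self_top ζ)
  have hE := IntermediateField.restrictScalars_adjoin_eq_sup k E₀ {ζ}
  haveI := u1.1
  haveI a1 : IsAbelianGalois k (E₀ ⊔ IntermediateField.adjoin k {ζ} : IntermediateField k Ω) := abelian_sup _ _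
  haveI a2 : FiniteDimensional k (E₀ ⊔ IntermediateField.adjoin k {ζ} : IntermediateField k Ω) := inferInstance
  have a3 : E₀ ≤ (E₀ ⊔ IntermediateField.adjoin k {ζ} : IntermediateField k Ω) := le_sup_left
  have a4 : ζ ∈ (E₀ ⊔ IntermediateField.adjoin k {ζ} : IntermediateField k Ω) := (le_sup_right : IntermediateField.adjoin k {ζ} ≤ _) (IntermediateField.mem_adjoin_simple_self k ζ)
  have a5 : fdeg p (E₀ ⊔ IntermediateField.adjoin k {ζ} : IntermediateField k Ω) = fdeg p (IntermediateField.adjoin E₀ {ζ}) := by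
    have : ∀ (E : IntermediateField k Ω) [FiniteDimensional k E], (IntermediateField.adjoin E₀ {ζ}).restrictScalars k = E → fdeg p E = fdeg p (IntermediateField.adjoin E₀ {ζ}) := by
      rintro _ _ rfl; rfl
    exact this _ hE
  set E := (E₀ ⊔ IntermediateField.adjoin k {ζ} : IntermediateField k Ω) with hEdef
  have hζE : IsPrimitiveRoot (⟨ζ, a4⟩ : E) (qk p k ^ (f₀ * (e₀ * D)) - 1) :=
    IsPrimitiveRoot.of_map_of_injective (f := algebraMap E Ω) hζ (algebraMap E Ω).injective
  have hfr : fres p k E = f₀ * (e₀ * D) := by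
    have h1 := fres_mul p k E
    have h2 := fres_mul p E₀ (IntermediateField.adjoin E₀ {ζ})
    have h3 := fres_mul p k E₀
    rw [a5, ← h2, u2.2.2.2.1, ← h3, ← hf₀] at h1
    exact Nat.eq_of_mul_eq_mul_right (fdeg_pos p k) (by rw [h1]; ring)
  have kill : ∀ (g : E ≃ₐ[k] E) (f m : ℕ), g ⟨ζ, a4⟩ = ⟨ζ, a4⟩ ^ (qk p k ^ f) → f * m ≡ 0 [MOD f₀ * (e₀ * D)] → e₀ ∣ m → g ^ m = 1 := by
    intro g f m hg hfm hem
    apply gal_ext_of (g ^ m) ((E₀ : Set Ω) ∪ {ζ})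
    · rw [hEdef, sup_le_iff]
      exact ⟨fun x hx => IntermediateField.subset_adjoin _ _ (Or.inl hx), IntermediateField.adjoin.mono _ _ _ (by simp)⟩
    · rintro x (hx | hx)
      · refine ⟨a3 hx, ?_⟩
        have h1 : res a3 (g ^ m) = 1 := by
          obtain ⟨m', rfl⟩ := hem
          rw [map_pow, pow_mul, he₀, pow_card_eq_one', one_pow]
        have h2 := res_coe a3 (g ^ m) ⟨x, hx⟩
        rw [h1] at h2
        exact Subtype.ext h2.symm
      · rw [Set.mem_singleton_iff] at hx
        subst hx
        refine ⟨a4, ?_⟩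
        rw [pow_zeta hg, (zeta_pow_iff (one_lt_qk p k) hN hζE _ 0).2 hfm, pow_zero, pow_one]
  refine ⟨f₀ * (e₀ * D), E, a3, a2, a1, ⟨ζ, a4⟩, ⟨hN, hζE, hfr, fun g => ?_⟩, ?_, rfl⟩
  · obtain ⟨i, hi⟩ := zeta_aut p hN hζE g
    refine kill g i _ hi ?_ ⟨f₀ * D, by ring⟩
    exact (Nat.modEq_zero_iff_dvd.2 (Dvd.intro_left _ rfl))
  · intro f hf
    have hfN : f ∣ f₀ * (e₀ * D) := hf.mul_left _ |>.mul_left _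
    refine ⟨hfN, fun g hg => kill g f _ hg ?_ ?_⟩
    · rw [Nat.mul_div_cancel' hfN]
      exact (Nat.modEq_zero_iff_dvd.2 dvd_rfl)
    · obtain ⟨c, rfl⟩ := hf
      have hf0 : 0 < f := Nat.pos_of_ne_zero (by rintro rfl; simp at hD)
      have : f₀ * (e₀ * (f * c)) = f * (e₀ * (f₀ * c)) := by ring
      rw [this, Nat.mul_div_cancel_left _ hf0]
      exact Dvd.intro _ rfl

end art
end LCFT

namespace LCFT
open Module

section art
variable (p : ℕ) [Fact p.Prime] {k₁ k₂ k Ω : Type}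
  [Field k₁] [Algebra ℚ_[p] k₁] [FiniteDimensional ℚ_[p] k₁]
  [Field k₂] [Algebra ℚ_[p] k₂] [FiniteDimensional ℚ_[p] k₂]
  [Field k] [Algebra ℚ_[p] k] [FiniteDimensional ℚ_[p] k]
  [Field Ω] [Algebra ℚ_[p] Ω] [IsAlgClosed Ω]
  [Algebra k Ω] [IsScalarTower ℚ_[p] k Ω] 
  [Algebra k₁ Ω] [IsScalarTower ℚ_[p] k₁ Ω] 
  [Algebra k₂ Ω] [IsScalarTower ℚ_[p] k₂ Ω]
  [Algebra k₁ k₂] [IsScalarTower ℚ_[p] k₁ k₂] [FiniteDimensional k₁ k₂] [IsScalarTower k₁ k₂ Ω]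

theorem func_G {E₁ : IntermediateField k₁ Ω} {E₂ : IntermediateField k₂ Ω} [FiniteDimensional k₁ E₁] [FiniteDimensional k₂ E₂]
    [IsAbelianGalois k₁ E₁] [IsAbelianGalois k₂ E₂] (hE : E₁ ≤ E₂.restrictScalars k₁) {N₁ N₂ : ℕ} {ζ₁ : E₁} {ζ₂ : E₂}
    (h1 : Good p k₁ E₁ N₁ ζ₁) (h2 : Good p k₂ E₂ N₂ ζ₂) (hf : fres p k₁ k₂ ∣ N₁)
    (hk : ∀ g : E₁ ≃ₐ[k₁] E₁, g ζ₁ = ζ₁ ^ (qk p k₁ ^ fres p k₁ k₂) → g ^ (N₁ / fres p k₁ k₂) = 1) (a : k₂ˣ) (x : Ω) (hx : x ∈ E₁) :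
    ((ArtG p h2 a ⟨x, hE hx⟩ : E₂) : Ω) = ArtG p h1 (nrm k₁ k₂ a) ⟨x, hx⟩ := by
  let j : E₁ →+* E₂ := RingHom.codRestrict (algebraMap E₁ Ω) E₂ (fun x => hE x.2)
  letI : Algebra E₁ E₂ := j.toAlgebra
  haveI : IsScalarTower k₁ E₁ E₂ := IsScalarTower.of_algebraMap_eq (fun x => rfl)
  haveI : IsScalarTower k₁ k₂ E₂ := IsScalarTower.of_algebraMap_eq (fun x => Subtype.ext (IsScalarTower.algebraMap_apply k₁ k₂ Ω x))
  haveI : IsScalarTower ℚ_[p] k₁ E₂ := IsScalarTower.of_algebraMap_eq (fun x => Subtype.ext (IsScalarTower.algebraMap_apply ℚ_[p] k₁ Ω x))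
  haveI : IsScalarTower ℚ_[p] E₁ E₂ := IsScalarTower.of_algebraMap_eq (fun x => rfl)
  haveI : FiniteDimensional k₁ E₂ := FiniteDimensional.trans k₁ k₂ E₂
  haveI : FiniteDimensional E₁ E₂ := FiniteDimensional.right k₁ E₁ E₂
  exact congrArg Subtype.val (func_ArtG p h1 h2 hf hk a ⟨x, hx⟩)

lemma nrm_self {k : Type} [Field k] (a : kˣ) : nrm k k a = a := by
  ext; rw [nrm_coe]; simp

lemma fres_self : fres p k k = 1 := by
  have := fres_mul p k k
  exact Nat.eq_of_mul_eq_mul_right (fdeg_pos p k) (by rw [this, one_mul])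

theorem func_same {E E' : IntermediateField k Ω} [FiniteDimensional k E] [FiniteDimensional k E']
    [IsAbelianGalois k E] [IsAbelianGalois k E'] (hE : E ≤ E') {N N' : ℕ} {ζ : E} {ζ' : E'}
    (h1 : Good p k E N ζ) (h2 : Good p k E' N' ζ') (a : kˣ) (x : Ω) (hx : x ∈ E) :
    ((ArtG p h2 a ⟨x, hE hx⟩ : E') : Ω) = ArtG p h1 a ⟨x, hx⟩ := by
  have := func_G p (k₁ := k) (k₂ := k) (E₁ := E) (E₂ := E') hE h1 h2 (by rw [fres_self]; exact one_dvd _) (fun g _ => by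
    rw [fres_self, Nat.div_one]; exact h1.2.2.2 g) a x hx
  rw [nrm_self] at this
  exact this

/-- the Artin map of a finite abelian extension inside `Ω` -/
noncomputable def art (E : IntermediateField k Ω) [FiniteDimensional k E] [IsAbelianGalois k E] : kˣ →* (E ≃ₐ[k] E) :=
  let h := exists_good p one_ne_zero E
  haveI := h.choose_spec.choose_spec.choose_spec.choose
  haveI := h.choose_spec.choose_spec.choose_spec.choose_spec.choose
  (res h.choose_spec.choose_spec.choose).comp (ArtG p h.choose_spec.choose_spec.choose_spec.choose_spec.choose_spec.choose_spec.1)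

lemma art_spec (E : IntermediateField k Ω) [FiniteDimensional k E] [IsAbelianGalois k E] :
    ∃ (N : ℕ) (E' : IntermediateField k Ω) (hE : E ≤ E') (_ : FiniteDimensional k E') (_ : IsAbelianGalois k E') (ζ : E')
      (h : Good p k E' N ζ), art p E = (res hE).comp (ArtG p h) := by
  let h := exists_good p one_ne_zero E
  haveI := h.choose_spec.choose_spec.choose_spec.choose
  haveI := h.choose_spec.choose_spec.choose_spec.choose_spec.choose
  exact ⟨_, _, h.choose_spec.choose_spec.choose, _, _, _, h.choose_spec.choose_spec.choose_spec.choose_spec.choose_spec.choose_spec.1, rfl⟩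

lemma art_good {E E' : IntermediateField k Ω} [FiniteDimensional k E] [FiniteDimensional k E']
    [IsAbelianGalois k E] [IsAbelianGalois k E'] (hE : E ≤ E') {N : ℕ} {ζ : E'}
    (h : Good p k E' N ζ) : art p E = (res hE).comp (ArtG p h) := by
  haveI := charZero' p k
  obtain ⟨N₁, E₁, hE₁, i1, i2, ζ₁, h₁, e⟩ := art_spec p E
  haveI : IsAbelianGalois k (E' ⊔ E₁ : IntermediateField k Ω) := abelian_sup _ _
  obtain ⟨N₂, E₂, hE₂, i3, i4, ζ₂, h₂, -⟩ := exists_good p one_ne_zero (E' ⊔ E₁)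
  rw [e]
  ext a x
  rw [MonoidHom.comp_apply, MonoidHom.comp_apply, res_coe, res_coe]
  rw [← func_same p (le_sup_left.trans hE₂) h h₂ a x (hE x.2), ← func_same p (le_sup_right.trans hE₂) h₁ h₂ a x (hE₁ x.2)]

lemma art_self {E : IntermediateField k Ω} [FiniteDimensional k E] [IsAbelianGalois k E] {N : ℕ} {ζ : E}
    (h : Good p k E N ζ) : art p E = ArtG p h := by
  rw [art_good p le_rfl h]
  ext a x
  rw [MonoidHom.comp_apply, res_coe]

theorem art_surj (E : IntermediateField k Ω) [FiniteDimensional k E] [IsAbelianGalois k E] : Function.Surjective (art p E) := by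
  obtain ⟨N₁, E₁, hE₁, i1, i2, ζ₁, h₁, e⟩ := art_spec p E
  rw [e]
  exact (res_surj hE₁).comp (ArtG_surj p h₁)

theorem art_func {E₁ : IntermediateField k₁ Ω} {E₂ : IntermediateField k₂ Ω} [FiniteDimensional k₁ E₁] [FiniteDimensional k₂ E₂]
    [IsAbelianGalois k₁ E₁] [IsAbelianGalois k₂ E₂] (hE : E₁ ≤ E₂.restrictScalars k₁) (a : k₂ˣ) (x : Ω) (hx : x ∈ E₁) :
    ((art p E₂ a ⟨x, hE hx⟩ : E₂) : Ω) = art p E₁ (nrm k₁ k₂ a) ⟨x, hx⟩ := by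
  haveI := charZero' p k₁
  haveI := charZero' p k₂
  obtain ⟨N₁, E₁', hE₁, i1, i2, ζ₁, h₁, e₁, -⟩ := exists_good p (fres_pos p k₁ k₂).ne' E₁
  haveI := base_fd (k₂ := k₂) E₁'
  haveI := base_abelian (k₂ := k₂) E₁'
  haveI : IsAbelianGalois k₂ (E₂ ⊔ IntermediateField.adjoin k₂ (E₁' : Set Ω) : IntermediateField k₂ Ω) := abelian_sup _ _
  obtain ⟨N₂, E₂', hE₂, i3, i4, ζ₂, h₂, -⟩ := exists_good p one_ne_zero (E₂ ⊔ IntermediateField.adjoin k₂ (E₁' : Set Ω))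
  have hle : E₁' ≤ E₂'.restrictScalars k₁ := fun x hx => hE₂ ((le_sup_right : _ ≤ (E₂ ⊔ IntermediateField.adjoin k₂ (E₁' : Set Ω))) (IntermediateField.subset_adjoin _ _ hx))
  have := func_G p hle h₁ h₂ (e₁ _ dvd_rfl).1 (e₁ _ dvd_rfl).2 a x (hE₁ hx)
  rw [art_good p (le_sup_left.trans hE₂) h₂, art_good p hE₁ h₁, MonoidHom.comp_apply, MonoidHom.comp_apply, res_coe, res_coe]
  exact this

theorem art_le {E E' : IntermediateField k Ω} [FiniteDimensional k E] [FiniteDimensional k E']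
    [IsAbelianGalois k E] [IsAbelianGalois k E'] (hE : E ≤ E') : art p E = (res hE).comp (art p E') := by
  ext a x
  have := art_func p (k₁ := k) (k₂ := k) (E₁ := E) (E₂ := E') hE a x x.2
  rw [nrm_self] at this
  rw [MonoidHom.comp_apply, res_coe, this]

theorem art_ker (F : IntermediateField k Ω) [FiniteDimensional k F] [IsAbelianGalois k F] : (art p F).ker = NG k F := by
  have h1 : NG k F ≤ (art p F).ker := by
    rintro _ ⟨y, rfl⟩
    rw [MonoidHom.mem_ker]
    have hbot : F ≤ (⊥ : IntermediateField F Ω).restrictScalars k := by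
      intro x hx
      exact IntermediateField.algebraMap_mem _ (⟨x, hx⟩ : F)
    ext x
    have := art_func p (k₁ := k) (k₂ := F) (E₁ := F) (E₂ := ⊥) hbot y x x.2
    rw [← this]
    have h2 : (⟨(x : Ω), hbot x.2⟩ : (⊥ : IntermediateField F Ω)) = algebraMap F (⊥ : IntermediateField F Ω) x := rfl
    rw [h2, AlgEquiv.commutes]
    rfl
  have h2 := index_abelian p k F
  have h3 : (art p F).ker.index = finrank k F := by
    rw [Subgroup.index_ker, MonoidHom.range_eq_top.2 (art_surj p F), Subgroup.card_top, IsGalois.card_aut_eq_finrank]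
  by_contra hne
  haveI : (NG k F).FiniteIndex := ⟨h2.1⟩
  have := Subgroup.index_strictAnti (lt_of_le_of_ne h1 (Ne.symm hne))
  omega

theorem art_zeta {E : IntermediateField k Ω} [FiniteDimensional k E] [IsAbelianGalois k E] {n : ℕ} (hn : n ≠ 0) (ζ : E)
    (hζ : IsPrimitiveRoot ζ (qk p k ^ n - 1)) (a : kˣ) (ha : v p k a = 1) : art p E a ζ = ζ ^ qk p k := by
  obtain ⟨N₁, E₁, hE₁, i1, i2, ζ₁, h₁, e⟩ := art_spec p E
  rw [e]
  apply Subtype.ext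
  rw [MonoidHom.comp_apply, res_coe]
  have h2 := ((ArtG_iff p h₁ ha).1 rfl).1
  have hζ' : IsPrimitiveRoot (⟨(ζ : Ω), hE₁ ζ.2⟩ : E₁) (qk p k ^ n - 1) := hζ.map_of_injective (f := IntermediateField.inclusion hE₁) (IntermediateField.inclusion hE₁).injective
  rw [frob_zeta p h₁ h2]
  · rfl
  · obtain ⟨c, hc⟩ := N_dvd_fres p hn hζ'
    rw [hζ'.pow_eq_one_iff_dvd, qk_fres p (k := k) (K := E₁), hc, pow_mul]
    simpa using Nat.sub_dvd_pow_sub_pow (qk p k ^ n) 1 c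

end art
end LCFT

namespace LCFT
open Module

section equi
variable (p : ℕ) [Fact p.Prime] {k k' E E' : Type}
  [Field k] [Algebra ℚ_[p] k] [FiniteDimensional ℚ_[p] k]
  [Field k'] [Algebra ℚ_[p] k'] [FiniteDimensional ℚ_[p] k']
  [Field E] [Algebra ℚ_[p] E] [FiniteDimensional ℚ_[p] E]
  [Field E'] [Algebra ℚ_[p] E'] [FiniteDimensional ℚ_[p] E']
  [Algebra k E] [IsScalarTower ℚ_[p] k E] [FiniteDimensional k E]
  [Algebra k' E'] [IsScalarTower ℚ_[p] k' E'] [FiniteDimensional k' E']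
  [IsAbelianGalois k E] [IsAbelianGalois k' E'] {N N' : ℕ} {ζ : E} {ζ' : E'}

theorem equi_ArtG (h : Good p k E N ζ) (h' : Good p k' E' N' ζ') (s : k ≃ₐ[ℚ_[p]] k') (t : E ≃ₐ[ℚ_[p]] E')
    (hst : ∀ x, t (algebraMap k E x) = algebraMap k' E' (s x)) (a : kˣ) (x : E) :
    ArtG p h' (Units.map s.toRingEquiv.toRingHom.toMonoidHom a) (t x) = t (ArtG p h a x) := by
  letI : Algebra k k' := s.toRingEquiv.toRingHom.toAlgebra
  letI : Algebra E E' := t.toRingEquiv.toRingHom.toAlgebra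
  letI : Algebra k E' := ((algebraMap k' E').comp (algebraMap k k')).toAlgebra
  haveI : IsScalarTower ℚ_[p] k k' := IsScalarTower.of_algebraMap_eq (fun x => (s.commutes x).symm)
  haveI : IsScalarTower ℚ_[p] E E' := IsScalarTower.of_algebraMap_eq (fun x => (t.commutes x).symm)
  haveI : IsScalarTower k k' E' := IsScalarTower.of_algebraMap_eq (fun x => rfl)
  haveI : IsScalarTower k E E' := IsScalarTower.of_algebraMap_eq (fun x => (hst x).symm)
  haveI : IsScalarTower ℚ_[p] k E' := IsScalarTower.of_algebraMap_eq (fun x => by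
    rw [IsScalarTower.algebraMap_apply k k' E', ← IsScalarTower.algebraMap_apply ℚ_[p] k k', ← IsScalarTower.algebraMap_apply ℚ_[p] k' E'])
  let e : k ≃ₐ[k] k' := AlgEquiv.ofRingEquiv (f := s.toRingEquiv) (fun x => rfl)
  let e' : E ≃ₐ[E] E' := AlgEquiv.ofRingEquiv (f := t.toRingEquiv) (fun x => rfl)
  haveI : FiniteDimensional k k' := e.toLinearEquiv.finiteDimensional
  haveI : FiniteDimensional E E' := e'.toLinearEquiv.finiteDimensional
  haveI : FiniteDimensional k E' := FiniteDimensional.trans k k' E'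
  have hf : fres p k k' = 1 := by
    have h1 := eram_mul_fres p k k'
    rw [← e.toLinearEquiv.finrank_eq, finrank_self] at h1
    exact Nat.eq_one_of_mul_eq_one_left h1
  have := func_ArtG p h h' (by rw [hf]; exact one_dvd _) (fun g _ => by
    rw [hf, Nat.div_one]; exact h.2.2.2 g) (Units.map s.toRingEquiv.toRingHom.toMonoidHom a) x
  have h2 : nrm k k' (Units.map s.toRingEquiv.toRingHom.toMonoidHom a) = a := by
    ext
    rw [nrm_coe]
    have h3 := Algebra.norm_eq_of_algEquiv e (a : k)
    rw [Algebra.norm_self] at h3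
    exact h3
  rw [h2] at this
  exact this
end equi

section equi2
variable (p : ℕ) [Fact p.Prime] {k Ω : Type}
  [Field k] [Algebra ℚ_[p] k] [FiniteDimensional ℚ_[p] k]
  [Field Ω] [Algebra ℚ_[p] Ω] [IsAlgClosed Ω]
  [Algebra k Ω] [IsScalarTower ℚ_[p] k Ω] 

lemma stab_adj (T : Ω ≃ₐ[ℚ_[p]] Ω) (s : k ≃ₐ[ℚ_[p]] k) (hT : ∀ x, T (algebraMap k Ω x) = algebraMap k Ω (s x))
    (L : IntermediateField k Ω) (hL : ∀ x ∈ L, T x ∈ L) {ζ : Ω} {n : ℕ} (hn : n ≠ 0) (hζ : IsPrimitiveRoot ζ n) :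
    ∀ x ∈ L ⊔ IntermediateField.adjoin k {ζ}, T x ∈ L ⊔ IntermediateField.adjoin k {ζ} := by
  intro x hx
  have h1 : L ⊔ IntermediateField.adjoin k {ζ} = IntermediateField.adjoin k ((L : Set Ω) ∪ {ζ}) := by
    rw [IntermediateField.adjoin_union, IntermediateField.adjoin_self]
  have hz : ζ ∈ L ⊔ IntermediateField.adjoin k {ζ} := (le_sup_right : _ ≤ L ⊔ IntermediateField.adjoin k {ζ}) (IntermediateField.mem_adjoin_simple_self k ζ)
  rw [h1] at hx
  induction hx using IntermediateField.adjoin_induction with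
  | mem x hx =>
    rcases hx with hx | hx
    · exact (le_sup_left : L ≤ _) (hL x hx)
    · rw [Set.mem_singleton_iff] at hx
      subst hx
      have h2 : (T x) ^ n = 1 := by rw [← map_pow, hζ.pow_eq_one, map_one]
      haveI : NeZero n := ⟨hn⟩
      obtain ⟨i, -, hi⟩ := hζ.eq_pow_of_pow_eq_one h2
      rw [← hi]
      exact pow_mem hz i
  | algebraMap x => rw [hT]; exact IntermediateField.algebraMap_mem _ _
  | add x y _ _ h1 h2 => rw [map_add]; exact add_mem h1 h2
  | mul x y _ _ h1 h2 => rw [map_mul]; exact mul_mem h1 h2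
  | inv x _ h1 => rw [map_inv₀]; exact inv_mem h1

theorem equi_art (T : Ω ≃ₐ[ℚ_[p]] Ω) (s : k ≃ₐ[ℚ_[p]] k) (hT : ∀ x, T (algebraMap k Ω x) = algebraMap k Ω (s x))
    (L : IntermediateField k Ω) [FiniteDimensional k L] [IsAbelianGalois k L] (hL : ∀ x ∈ L, T x ∈ L) (hL' : ∀ x ∈ L, T.symm x ∈ L)
    (a : kˣ) (x : Ω) (hx : x ∈ L) :
    (art p L (Units.map s.toRingEquiv.toRingHom.toMonoidHom a) ⟨T x, hL x hx⟩ : Ω) = T (art p L a ⟨x, hx⟩) := by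
  obtain ⟨N, E, hE, i1, i2, ζ, h, -, hEe⟩ := exists_good p one_ne_zero L
  have hN : qk p k ^ N - 1 ≠ 0 := by
    have := Nat.one_lt_pow h.1 (one_lt_qk p k)
    omega
  have hz : IsPrimitiveRoot (ζ : Ω) (qk p k ^ N - 1) := h.2.1.map_of_injective (f := E.val) E.val.injective
  have hT' : ∀ x, T.symm (algebraMap k Ω x) = algebraMap k Ω (s.symm x) := by
    intro x
    rw [AlgEquiv.symm_apply_eq, hT, AlgEquiv.apply_symm_apply]
  have s1 : ∀ x ∈ E, T x ∈ E := by
    rw [hEe]; exact stab_adj p T s hT L hL hN hz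
  have s2 : ∀ x ∈ E, T.symm x ∈ E := by
    rw [hEe]; exact stab_adj p T.symm s.symm hT' L hL' hN hz
  let t : E ≃ₐ[ℚ_[p]] E := 
    { toFun := fun x => ⟨T x, s1 x x.2⟩
      invFun := fun x => ⟨T.symm x, s2 x x.2⟩
      left_inv := fun x => Subtype.ext (T.symm_apply_apply _)
      right_inv := fun x => Subtype.ext (T.apply_symm_apply _)
      map_mul' := fun x y => Subtype.ext (map_mul T _ _)
      map_add' := fun x y => Subtype.ext (map_add T _ _)
      commutes' := fun x => Subtype.ext (T.commutes x) }
  have := equi_ArtG p h h s t (fun x => Subtype.ext (hT x)) a ⟨x, hE hx⟩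
  rw [art_good p hE h, MonoidHom.comp_apply, res_coe, MonoidHom.comp_apply, res_coe]
  exact congrArg Subtype.val this
end equi2
end LCFT

namespace LCFT
open Module

section kummer
variable {k : Type} [Field k] {n : ℕ} {ζ : k}

lemma kscale {L : Type} [Field L] [Algebra k L] (hn : n ≠ 0) (hζ : IsPrimitiveRoot ζ n) (σ : L ≃ₐ[k] L) {r : L} {a : kˣ} (hr : r ^ n = algebraMap k L a) :
    ∃ c : kˣ, c ^ n = 1 ∧ σ r = algebraMap k L c * r := by
  have hr0 : r ≠ 0 := by
    rintro rfl
    rw [zero_pow hn] at hr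
    exact a.ne_zero ((map_eq_zero _).1 hr.symm)
  have h1 : (σ r / r) ^ n = 1 := by
    rw [div_pow, ← map_pow, hr, AlgEquiv.commutes, div_self]
    exact (map_ne_zero _).2 a.ne_zero
  haveI : NeZero n := ⟨hn⟩
  have hζ' : IsPrimitiveRoot (algebraMap k L ζ) n := hζ.map_of_injective (algebraMap k L).injective
  obtain ⟨i, -, hi⟩ := hζ'.eq_pow_of_pow_eq_one h1
  refine ⟨Units.mk0 (ζ ^ i) (pow_ne_zero _ (hζ.ne_zero hn)), ?_, ?_⟩
  · ext
    simp only [Units.val_pow_eq_pow_val, Units.val_mk0, Units.val_one]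
    rw [← pow_mul, mul_comm, pow_mul, hζ.pow_eq_one, one_pow]
  · rw [Units.val_mk0, map_pow, hi, div_mul_cancel₀ _ hr0]

variable {Ω : Type} [Field Ω] [Algebra k Ω]

lemma kummer_abelian [CharZero k] (hn : n ≠ 0) (hζ : IsPrimitiveRoot ζ n) (R : Set Ω) (hfin : R.Finite)
    (hR : ∀ r ∈ R, ∃ a : kˣ, r ^ n = algebraMap k Ω a) :
    FiniteDimensional k (IntermediateField.adjoin k R) ∧ IsAbelianGalois k (IntermediateField.adjoin k R) ∧
      ∀ g : (IntermediateField.adjoin k R) ≃ₐ[k] (IntermediateField.adjoin k R), g ^ n = 1 := by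
  set M := IntermediateField.adjoin k R with hM
  have hmem : ∀ r ∈ R, r ∈ M := fun r hr => IntermediateField.subset_adjoin k R hr
  have hR' : ∀ r (hr : r ∈ R), ∃ a : kˣ, (⟨r, hmem r hr⟩ : M) ^ n = algebraMap k M a := by
    intro r hr
    obtain ⟨a, ha⟩ := hR r hr
    exact ⟨a, Subtype.ext ha⟩
  have hIntg : ∀ r ∈ R, IsIntegral k r := by
    intro r hr
    obtain ⟨a, ha⟩ := hR r hr
    exact ⟨Polynomial.X ^ n - Polynomial.C (a : k), Polynomial.monic_X_pow_sub_C _ hn, by simp [ha]⟩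
  haveI : Finite R := hfin
  haveI hfd : FiniteDimensional k M := IntermediateField.finiteDimensional_adjoin hIntg
  haveI : Normal k M := by
    rw [normal_iff]
    have key : ∀ x ∈ R, IsIntegral k x ∧ ((minpoly k x).map (algebraMap k M)).Splits := by
      intro x hx
      refine ⟨hIntg x hx, ?_⟩
      obtain ⟨a, ha⟩ := hR' x hx
      have hd : minpoly k x ∣ Polynomial.X ^ n - Polynomial.C (a : k) := minpoly.dvd _ _ (by
        have := congrArg Subtype.val ha
        simp only [map_sub, map_pow, Polynomial.aeval_X, Polynomial.aeval_C]
        exact sub_eq_zero.2 this)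
      refine Polynomial.Splits.of_dvd ?_ (Polynomial.map_ne_zero (Polynomial.X_pow_sub_C_ne_zero (Nat.pos_of_ne_zero hn) (a : k))) (Polynomial.map_dvd _ hd)
      rw [Polynomial.map_sub, Polynomial.map_pow, Polynomial.map_X, Polynomial.map_C]
      exact X_pow_sub_C_splits_of_isPrimitiveRoot (hζ.map_of_injective (algebraMap k M).injective) ha
    intro x
    have h8 := IntermediateField.splits_of_mem_adjoin k Ω key x.2
    have h9 : minpoly k (x : Ω) = minpoly k x := minpoly.algebraMap_eq (B := M) (B' := Ω) (algebraMap M Ω).injective x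
    rw [h9] at h8
    exact ⟨IsIntegral.of_finite k x, h8⟩
  haveI : IsGalois k M := IsGalois.mk
  refine ⟨hfd, { is_comm := ⟨fun σ τ => ?_⟩ }, fun g => ?_⟩
  · rw [← mul_inv_eq_one]
    apply gal_ext_of _ R le_rfl
    intro x hx
    refine ⟨hmem x hx, ?_⟩
    obtain ⟨a, ha⟩ := hR' x hx
    have key : (σ * τ) ⟨x, hmem x hx⟩ = (τ * σ) ⟨x, hmem x hx⟩ := by
      obtain ⟨c, -, hc⟩ := kscale hn hζ σ ha
      obtain ⟨d, -, hd⟩ := kscale hn hζ τ ha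
      rw [AlgEquiv.mul_apply, AlgEquiv.mul_apply, hc, hd, map_mul, map_mul, hc, hd, AlgEquiv.commutes, AlgEquiv.commutes]
      ring
    have key2 : ∀ y : M, (σ * τ) ((τ * σ)⁻¹ y) = (τ * σ) ((τ * σ)⁻¹ y) ↔ (σ * τ * (τ * σ)⁻¹) y = y := by
      intro y
      rw [← AlgEquiv.mul_apply, ← AlgEquiv.mul_apply, mul_inv_cancel]; rfl
    rw [← key2]
    obtain ⟨c, -, hc⟩ := kscale hn hζ (τ * σ)⁻¹ ha
    rw [hc, map_mul, map_mul, key, AlgEquiv.commutes, AlgEquiv.commutes]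
  · apply gal_ext_of _ R le_rfl
    intro x hx
    refine ⟨hmem x hx, ?_⟩
    obtain ⟨a, ha⟩ := hR' x hx
    obtain ⟨c, hc1, hc⟩ := kscale hn hζ g ha
    have : ∀ i : ℕ, (g ^ i) ⟨x, hmem x hx⟩ = algebraMap k M (c ^ i : kˣ) * ⟨x, hmem x hx⟩ := by
      intro i
      induction i with
      | zero => simp
      | succ i ih =>
        rw [pow_succ', AlgEquiv.mul_apply, ih, map_mul, hc, AlgEquiv.commutes, pow_succ, Units.val_mul, map_mul]
        ring
    rw [this, hc1]
    simp

end kummer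

section kex

lemma index_pow (p : ℕ) [Fact p.Prime] {k : Type}
  [Field k] [Algebra ℚ_[p] k] [FiniteDimensional ℚ_[p] k] {n : ℕ} (hn : n ≠ 0) : (powMonoidHom n : kˣ →* kˣ).range.index ≠ 0 := by
  set P := (powMonoidHom n : kˣ →* kˣ).range with hP
  have h1 : P.relIndex (P ⊔ U p k) ≠ 0 := by
    rw [Subgroup.relIndex_sup_left]
    obtain ⟨j, hj⟩ := deep_roots p (k := k) n hn 0
    have hle : Uj p k j ≤ P := by
      intro x hx
      obtain ⟨z, -, hz⟩ := hj x hx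
      exact ⟨z, hz⟩
    exact fun h => finiteIndex_Uj p (k := k) j (Nat.eq_zero_of_zero_dvd (h ▸ Subgroup.relIndex_dvd_of_le_left _ hle))
  rw [← Subgroup.relIndex_mul_index (le_sup_left : P ≤ P ⊔ U p k)]
  refine mul_ne_zero h1 ?_
  obtain ⟨π, hπ⟩ := exists_v_one p k
  haveI : Finite (kˣ ⧸ (P ⊔ U p k)) := by
    haveI : NeZero n := ⟨hn⟩
    apply Finite.of_surjective (fun i : Fin n => (QuotientGroup.mk (π ^ (i : ℕ)) : kˣ ⧸ (P ⊔ U p k)))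
    intro q
    obtain ⟨x, rfl⟩ := QuotientGroup.mk_surjective q
    have hn' : (0 : ℤ) < n := by omega
    have e1 := Int.emod_nonneg (v p k x) hn'.ne'
    have e2 := Int.emod_lt_of_pos (v p k x) hn'
    refine ⟨⟨(v p k x % n).toNat, by omega⟩, ?_⟩
    rw [QuotientGroup.eq]
    have : (π ^ (v p k x % n).toNat)⁻¹ * x = (π ^ (v p k x / n)) ^ n * ((π ^ (v p k x))⁻¹ * x) := by
      rw [← mul_assoc]
      congr 1
      rw [← zpow_natCast, ← zpow_natCast, ← zpow_mul, ← zpow_neg, ← zpow_neg, ← zpow_add]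
      congr 1
      have := Int.emod_add_mul_ediv (v p k x) n
      rw [Int.toNat_of_nonneg e1]
      linarith
    rw [this]
    refine Subgroup.mul_mem_sup ⟨_, rfl⟩ ?_
    rw [mem_U_v, v_mul, v_inv, v_zpow, hπ]
    ring
  exact Subgroup.index_ne_zero_of_finite

theorem kummer_exists (p : ℕ) [Fact p.Prime] {k Ω : Type}
  [Field k] [Algebra ℚ_[p] k] [FiniteDimensional ℚ_[p] k]
  [Field Ω] [Algebra ℚ_[p] Ω] [IsAlgClosed Ω]
  [Algebra k Ω] [IsScalarTower ℚ_[p] k Ω] {n : ℕ} (hn : n ≠ 0) {ζ : k} (hζ : IsPrimitiveRoot ζ n) :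
    ∃ (L : IntermediateField k Ω) (_ : FiniteDimensional k L) (_ : IsAbelianGalois k L), NG k L ≤ (powMonoidHom n : kˣ →* kˣ).range := by
  haveI := charZero' p k
  set P := (powMonoidHom n : kˣ →* kˣ).range with hP
  have hi := index_pow p (k := k) hn
  haveI : P.FiniteIndex := ⟨hi⟩
  have hroot : ∀ q : kˣ ⧸ P, ∃ r : Ω, r ^ n = algebraMap k Ω (q.out : kˣ) := fun q =>
    IsAlgClosed.exists_pow_nat_eq _ (Nat.pos_of_ne_zero hn)
  choose r hr using hroot
  obtain ⟨i1, i2, hexp⟩ := kummer_abelian hn hζ (Set.range r) (Set.finite_range r) (by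
    rintro _ ⟨q, rfl⟩
    exact ⟨_, hr q⟩)
  set L := IntermediateField.adjoin k (Set.range r) with hL
  refine ⟨L, i1, i2, ?_⟩
  have hmem : ∀ q, r q ∈ L := fun q => IntermediateField.subset_adjoin _ _ ⟨q, rfl⟩
  have hr' : ∀ q, (⟨r q, hmem q⟩ : L) ^ n = algebraMap k L (q.out : kˣ) := fun q => Subtype.ext (hr q)
  have hr0 : ∀ q, (⟨r q, hmem q⟩ : L) ≠ 0 := by
    intro q h
    have := hr' q
    rw [h, zero_pow hn] at this
    exact q.out.ne_zero ((map_eq_zero _).1 this.symm)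
  choose c hc1 hc using fun q (σ : L ≃ₐ[k] L) => kscale hn hζ σ (hr' q)
  have hcinj : ∀ a b : kˣ, algebraMap k L a = algebraMap k L b → a = b := fun a b h => Units.ext ((algebraMap k L).injective h)
  let χ : kˣ ⧸ P → ((L ≃ₐ[k] L) →* kˣ) := fun q =>
    MonoidHom.mk' (c q) (by
      intro σ τ
      apply hcinj
      apply mul_right_cancel₀ (hr0 q)
      rw [← hc, AlgEquiv.mul_apply, hc, map_mul, AlgEquiv.commutes, hc, Units.val_mul, map_mul]
      ring)
  have hχ : Function.Injective χ := by
    intro q q' h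
    have hfix : ∀ σ : L ≃ₐ[k] L, σ (⟨r q, hmem q⟩ / ⟨r q', hmem q'⟩) = (⟨r q, hmem q⟩ / ⟨r q', hmem q'⟩) := by
      intro σ
      have h1 : c q σ = c q' σ := DFunLike.congr_fun h σ
      rw [map_div₀, hc, hc, h1, mul_div_mul_left]
      exact (map_ne_zero _).2 (c q' σ).ne_zero
    obtain ⟨z, hz⟩ := (IsGalois.mem_range_algebraMap_iff_fixed _).2 hfix
    have hz0 : z ≠ 0 := by
      rintro rfl
      rw [map_zero] at hz
      exact div_ne_zero (hr0 q) (hr0 q') hz.symm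
    have h2 : (q.out : kˣ) = (Units.mk0 z hz0) ^ n * q'.out := by
      apply hcinj
      rw [Units.val_mul, Units.val_pow_eq_pow_val, Units.val_mk0, map_mul, map_pow, hz, ← hr', ← hr', div_pow, div_mul_cancel₀ _ (pow_ne_zero _ (hr0 q'))]
    rw [← Quotient.out_eq' q, ← Quotient.out_eq' q']
    change (QuotientGroup.mk (Quotient.out q) : kˣ ⧸ P) = QuotientGroup.mk (Quotient.out q')
    rw [QuotientGroup.eq, h2]
    refine ⟨(Units.mk0 z hz0)⁻¹, ?_⟩
    rw [powMonoidHom_apply, mul_inv, inv_pow, inv_mul_cancel_right]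
  haveI : NeZero n := ⟨hn⟩
  haveI : HasEnoughRootsOfUnity k n := ⟨⟨ζ, hζ⟩, inferInstance⟩
  haveI : HasEnoughRootsOfUnity k (Monoid.exponent (L ≃ₐ[k] L)) := HasEnoughRootsOfUnity.of_dvd k (Monoid.exponent_dvd_of_forall_pow_eq_one hexp)
  have hcard := CommGroup.card_monoidHom_of_hasEnoughRootsOfUnity (L ≃ₐ[k] L) k
  haveI : Finite ((L ≃ₐ[k] L) →* kˣ) := Nat.finite_of_card_ne_zero (by rw [hcard]; exact Nat.card_pos.ne')
  have hle : P.index ≤ (NG k L).index := by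
    rw [← art_ker p L, Subgroup.index_ker, MonoidHom.range_eq_top.2 (art_surj p L), Subgroup.card_top, ← hcard, Subgroup.index]
    exact Nat.card_le_card_of_injective χ hχ
  have hPN : P ≤ NG k L := by
    rintro _ ⟨x, rfl⟩
    rw [← art_ker p L, MonoidHom.mem_ker, powMonoidHom_apply, map_pow, hexp]
  by_contra hne
  have hlt : P < NG k L := lt_of_le_not_ge hPN hne
  have := Subgroup.index_strictAnti hlt
  omega
end kex
end LCFT

namespace LCFT
open Module

section closure
variable {k K Ω : Type} [Field k] [Field K] [Field Ω] [CharZero k] [CharZero K] [Algebra k K] [Algebra k Ω] [Algebra K Ω] [IsScalarTower k K Ω]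
  [FiniteDimensional k K] [IsGalois k K] [Normal k Ω]

lemma conj_K (T : Ω ≃ₐ[k] Ω) (x : K) : T (algebraMap K Ω x) = algebraMap K Ω (T.restrictNormal K x) :=
  (AlgEquiv.restrictNormal_commutes T K x).symm

lemma exists_N (L₀ : IntermediateField k Ω) [FiniteDimensional k L₀] : ∃ (N : IntermediateField k Ω) (_ : L₀ ≤ N) (_ : FiniteDimensional k N) (_ : Normal k N),
    ∀ R : IntermediateField k Ω, (∀ (T : Ω ≃ₐ[k] Ω), ∀ y ∈ L₀, T y ∈ R) → N ≤ R := by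
  refine ⟨IntermediateField.normalClosure k L₀ Ω, IntermediateField.le_normalClosure _, inferInstance, inferInstance, ?_⟩
  intro R hR
  rw [IntermediateField.normalClosure_def'']
  apply iSup_le
  intro T x hx
  obtain ⟨y, hy, rfl⟩ := hx
  exact hR T y hy

theorem stable_closure (L : IntermediateField K Ω) [FiniteDimensional K L] [IsAbelianGalois K L] :
    ∃ (M : IntermediateField K Ω) (_ : L ≤ M) (_ : FiniteDimensional K M) (_ : IsAbelianGalois K M), ∀ (T : Ω ≃ₐ[k] Ω), ∀ x ∈ M, T x ∈ M := by
  haveI : FiniteDimensional k L := FiniteDimensional.trans k K L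
  haveI : FiniteDimensional k (L.restrictScalars k) := inferInstanceAs (FiniteDimensional k L)
  obtain ⟨N, hLN, iN1, iN2, hN⟩ := exists_N (L.restrictScalars k)
  obtain ⟨M, hM⟩ : ∃ M : IntermediateField K Ω, M.restrictScalars k = N := ⟨
    { N.toSubfield with
      algebraMap_mem' := fun x => hLN (IntermediateField.algebraMap_mem L x) }, rfl⟩
  subst hM
  haveI : Normal k M := iN2
  haveI : FiniteDimensional k M := iN1
  haveI : IsScalarTower k K M := IsScalarTower.of_algebraMap_eq (fun x => Subtype.ext (IsScalarTower.algebraMap_apply k K Ω x))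
  haveI i1 : FiniteDimensional K M := FiniteDimensional.right k K M
  haveI : Normal K M := Normal.tower_top_of_normal k K M
  haveI : Normal K Ω := Normal.tower_top_of_normal k K Ω
  haveI : IsGalois K M := IsGalois.mk
  have hstab : ∀ (T : Ω ≃ₐ[k] Ω), ∀ x ∈ M, T x ∈ M := by
    intro T x hx
    exact IntermediateField.normal_iff_forall_map_le'.1 (iN2) T ⟨x, hx, rfl⟩
  refine ⟨M, hLN, i1, { is_comm := ⟨fun σ τ => ?_⟩ }, hstab⟩
  have hcL : ∀ (S R : Ω ≃ₐ[K] Ω) (y : Ω), y ∈ L → S (R y) = R (S y) := by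
    intro S R y hy
    have h1 := AlgEquiv.restrictNormal_commutes (S * R) L ⟨y, hy⟩
    have h2 := AlgEquiv.restrictNormal_commutes (R * S) L ⟨y, hy⟩
    have h3 : AlgEquiv.restrictNormalHom L (S * R) = AlgEquiv.restrictNormalHom L (R * S) := by
      rw [map_mul, map_mul, mul_comm]
    have h4 : (S * R).restrictNormal L = (R * S).restrictNormal L := h3
    rw [h4, h2] at h1
    exact h1.symm
  have hcT : ∀ (T : Ω ≃ₐ[k] Ω) (S R : Ω ≃ₐ[K] Ω) (y : Ω), y ∈ L → S (R (T y)) = R (S (T y)) := by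
    intro T S R y hy
    have cj : ∀ S : Ω ≃ₐ[K] Ω, ∃ S' : Ω ≃ₐ[K] Ω, ∀ y, T (S' y) = S (T y) := by
      intro S
      refine ⟨AlgEquiv.ofRingEquiv (f := (T.toRingEquiv.trans S.toRingEquiv).trans T.symm.toRingEquiv) (fun x => ?_), fun y => ?_⟩
      · change T.symm (S (T (algebraMap K Ω x))) = _
        rw [conj_K, AlgEquiv.commutes, ← conj_K, AlgEquiv.symm_apply_apply]
      · change T (T.symm (S (T y))) = _
        rw [AlgEquiv.apply_symm_apply]
    obtain ⟨S', hS⟩ := cj S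
    obtain ⟨R', hR⟩ := cj R
    rw [← hR, ← hS, hcL S' R' y hy, hR, hS]
  rw [← mul_inv_eq_one]
  apply gal_ext_of _ (⋃ T : Ω ≃ₐ[k] Ω, T '' (L : Set Ω))
  · intro x hx
    have h1 : M.restrictScalars k ≤ (IntermediateField.adjoin K (⋃ T : Ω ≃ₐ[k] Ω, T '' (L : Set Ω))).restrictScalars k := by
      apply hN
      intro T y hy
      rw [IntermediateField.mem_restrictScalars]
      apply IntermediateField.subset_adjoin
      exact Set.mem_iUnion.2 ⟨T, y, hy, rfl⟩
    exact h1 hx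
  · intro x hx
    obtain ⟨T, y, hy, rfl⟩ := Set.mem_iUnion.1 hx
    refine ⟨hstab T y (hLN hy), ?_⟩
    obtain ⟨S, hS⟩ := AlgEquiv.restrictNormalHom_surjective (F := K) (K₁ := M) Ω σ
    obtain ⟨R, hR⟩ := AlgEquiv.restrictNormalHom_surjective (F := K) (K₁ := M) Ω τ
    rw [← hS, ← hR, ← map_mul, ← map_mul, ← map_inv, ← map_mul]
    apply Subtype.ext
    have := AlgEquiv.restrictNormal_commutes (S * R * (R * S)⁻¹) M ⟨T y, hstab T y (hLN hy)⟩
    refine this.trans ?_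
    change S (R ((R * S)⁻¹ (T y))) = T y
    let Q : Ω ≃ₐ[K] Ω := (R * S)⁻¹
    let Qk : Ω ≃ₐ[k] Ω := Q.restrictScalars k
    have h5 := hcT (Qk * T) S R y hy
    change S (R ((R * S)⁻¹ (T y))) = R (S ((R * S)⁻¹ (T y))) at h5
    rw [h5]
    change ((R * S) * (R * S)⁻¹) (T y) = T y
    rw [mul_inv_cancel]; rfl

end closure
end LCFT

namespace LCFT
open Module

section descent
variable (p : ℕ) [Fact p.Prime] {k K Ω : Type}
  [Field k] [Algebra ℚ_[p] k] [FiniteDimensional ℚ_[p] k]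
  [Field K] [Algebra ℚ_[p] K] [FiniteDimensional ℚ_[p] K]
  [Field Ω] [Algebra ℚ_[p] Ω] [IsAlgClosed Ω]
  [Algebra k K] [IsScalarTower ℚ_[p] k K] [FiniteDimensional k K]
  [Algebra k Ω] [IsScalarTower ℚ_[p] k Ω] [Algebra K Ω] [IsScalarTower ℚ_[p] K Ω] [IsScalarTower k K Ω]

lemma equi_k [IsGalois k K] (T : Ω ≃ₐ[k] Ω) (M : IntermediateField K Ω) [FiniteDimensional K M] [IsAbelianGalois K M] 
    (hM : ∀ (T : Ω ≃ₐ[k] Ω), ∀ x ∈ M, T x ∈ M) (z : Kˣ) (x : Ω) (hx : x ∈ M) :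
    (art p M (act (T.restrictNormal K) z) ⟨T x, hM T x hx⟩ : Ω) = T (art p M z ⟨x, hx⟩) :=
  equi_art p (T.restrictScalars ℚ_[p]) ((T.restrictNormal K).restrictScalars ℚ_[p])
    (fun x => (AlgEquiv.restrictNormal_commutes T K x).symm) M (hM T) (hM T.symm) z x hx

lemma exists_fixed (M : IntermediateField K Ω) [FiniteDimensional K M] [IsAbelianGalois K M] (A : Subgroup (M ≃ₐ[K] M)) :
    ∃ (F : IntermediateField K Ω) (_ : F ≤ M), (∀ x (hx : x ∈ M), x ∈ F ↔ ∀ g ∈ A, g ⟨x, hx⟩ = ⟨x, hx⟩) ∧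
      (∀ g : M ≃ₐ[K] M, (∀ x (hx : x ∈ M), x ∈ F → g ⟨x, hx⟩ = ⟨x, hx⟩) → g ∈ A) := by
  refine ⟨IntermediateField.lift (IntermediateField.fixedField A), IntermediateField.lift_le _, ?_, ?_⟩
  · intro x hx
    have := IntermediateField.mem_lift (⟨x, hx⟩ : M) (F := M) (E := IntermediateField.fixedField A)
    refine this.trans ?_
    rw [IntermediateField.mem_fixedField_iff]
  · intro g hg
    rw [← IntermediateField.fixingSubgroup_fixedField A, IntermediateField.mem_fixingSubgroup_iff]
    intro y hy
    exact hg y y.2 ((IntermediateField.mem_lift y).2 hy)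

theorem descent (p : ℕ) [Fact p.Prime] {k K Ω : Type}
  [Field k] [Algebra ℚ_[p] k] [FiniteDimensional ℚ_[p] k]
  [Field K] [Algebra ℚ_[p] K] [FiniteDimensional ℚ_[p] K]
  [Field Ω] [Algebra ℚ_[p] Ω] [IsAlgClosed Ω]
  [Algebra k K] [IsScalarTower ℚ_[p] k K] [FiniteDimensional k K]
  [Algebra k Ω] [IsScalarTower ℚ_[p] k Ω] [Algebra K Ω] [IsScalarTower ℚ_[p] K Ω] [IsScalarTower k K Ω] [IsGalois k K] [IsCyclic (K ≃ₐ[k] K)] [Normal k Ω] (L : IntermediateField K Ω) [FiniteDimensional K L] [IsAbelianGalois K L] :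
    ∃ (F : IntermediateField k Ω) (_ : FiniteDimensional k F) (_ : IsAbelianGalois k F), ∀ a ∈ NG k F, ∃ b ∈ NG K L, nrm k K b = a := by
  haveI := charZero' p k
  haveI := charZero' p K
  obtain ⟨M, hLM, i1, i2, hM⟩ := stable_closure (k := k) L
  obtain ⟨F, hFM, hF, hFA⟩ := exists_fixed M ((nrm k K).ker.map (art p M))
  have hF' : ∀ x (hx : x ∈ M), x ∈ F ↔ ∀ z, nrm k K z = 1 → art p M z ⟨x, hx⟩ = ⟨x, hx⟩ := by
    intro x hx
    rw [hF x hx]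
    constructor
    · intro h z hz
      exact h _ ⟨z, hz, rfl⟩
    · rintro h _ ⟨z, hz, rfl⟩
      exact h z hz
  have hstab : ∀ (T : Ω ≃ₐ[k] Ω), ∀ x ∈ F, T x ∈ F := by
    intro T x hx
    rw [hF' _ (hM T x (hFM hx))]
    intro z hz
    have hz' : nrm k K (act (T.restrictNormal K)⁻¹ z) = 1 := by rw [nrm_act, hz]
    have h1 := equi_k p T M hM (act (T.restrictNormal K)⁻¹ z) x (hFM hx)
    have h2 : act (T.restrictNormal K) (act (T.restrictNormal K)⁻¹ z) = z := by
      ext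
      rw [act_coe, act_coe, ← AlgEquiv.mul_apply, mul_inv_cancel]; rfl
    rw [h2, (hF' x (hFM hx)).1 hx _ hz'] at h1
    exact Subtype.ext h1
  haveI : FiniteDimensional K F := FiniteDimensional.of_injective (IntermediateField.inclusion hFM).toLinearMap (IntermediateField.inclusion hFM).injective
  haveI : IsAbelianGalois K F := abelian_le hFM
  haveI : IsScalarTower k K F := IsScalarTower.of_algebraMap_eq (fun x => Subtype.ext (IsScalarTower.algebraMap_apply k K Ω x))
  haveI : FiniteDimensional k F := FiniteDimensional.trans k K F
  haveI : Normal k F := by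
    have : Normal k (F.restrictScalars k) := by
      rw [IntermediateField.normal_iff_forall_map_le']
      intro T x hx
      obtain ⟨y, hy, rfl⟩ := hx
      exact hstab T y hy
    exact this
  haveI : IsScalarTower k F Ω := IsScalarTower.of_algebraMap_eq (fun x => rfl)
  haveI : IsGalois k F := IsGalois.mk
  have hres : ∀ z x (hx : x ∈ F), (art p F z ⟨x, hx⟩ : Ω) = art p M z ⟨x, hFM hx⟩ := by
    intro z x hx
    rw [art_le p hFM, MonoidHom.comp_apply, res_coe]
  have hker : (AlgEquiv.restrictNormalHom K : (F ≃ₐ[k] F) →* (K ≃ₐ[k] K)).ker ≤ Subgroup.center _ := by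
    intro σ hσ
    rw [Subgroup.mem_center_iff]
    intro τ
    have hσK : ∀ x : K, σ (algebraMap K F x) = algebraMap K F x := by
      intro x
      have h1 := AlgEquiv.restrictNormal_commutes σ K x
      have h2 : σ.restrictNormal K = 1 := hσ
      rw [h2] at h1
      exact h1.symm
    let σK : F ≃ₐ[K] F := AlgEquiv.ofRingEquiv (f := σ.toRingEquiv) hσK
    obtain ⟨z, hz⟩ := art_surj p F σK
    obtain ⟨T, hT⟩ := AlgEquiv.restrictNormalHom_surjective (F := k) (K₁ := F) Ω τ
    have hTx : ∀ x : F, ((τ x : F) : Ω) = T x := by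
      intro x
      rw [← hT]
      exact AlgEquiv.restrictNormal_commutes T F x
    have hσx : ∀ x : F, ((σ x : F) : Ω) = art p M z ⟨x, hFM x.2⟩ := by
      intro x
      rw [← hres z x x.2]
      have : σ x = σK x := rfl
      rw [this, ← hz]
    ext x
    change ((τ (σ x) : F) : Ω) = (σ (τ x) : F)
    rw [hTx, hσx, hσx, ← equi_k p T M hM z x (hFM x.2)]
    have h3 : act (T.restrictNormal K) z = z * (z⁻¹ * act (T.restrictNormal K) z) := by rw [mul_inv_cancel_left]
    have h4 : nrm k K (z⁻¹ * act (T.restrictNormal K) z) = 1 := by rw [map_mul, nrm_act, map_inv, inv_mul_cancel]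
    have h5 := (hF' (T x) (hM T x (hFM x.2))).1 (hstab T x x.2) _ h4
    rw [h3, map_mul, AlgEquiv.mul_apply, h5]
    congr 2
    exact Subtype.ext (hTx x).symm
  have hab : IsAbelianGalois k F := { is_comm := ⟨commutative_of_cyclic_center_quotient _ hker⟩ }
  refine ⟨F.restrictScalars k, inferInstanceAs (FiniteDimensional k F), hab, ?_⟩
  intro a ha
  have ha' : a ∈ NG k F := ha
  obtain ⟨y, rfl⟩ := ha'
  rw [NG_trans (k := k) (L := F) K, MonoidHom.comp_apply]
  have hb : nrm K F y ∈ (art p F).ker := by rw [art_ker]; exact ⟨y, rfl⟩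
  obtain ⟨z, hz, hz2⟩ := hFA (art p M (nrm K F y)) (by
    intro x hx hxF
    apply Subtype.ext
    rw [← hres _ x hxF, MonoidHom.mem_ker.1 hb]; rfl)
  refine ⟨nrm K F y * z⁻¹, ?_, ?_⟩
  · have h6 : nrm K F y * z⁻¹ ∈ (art p M).ker := by
      rw [MonoidHom.mem_ker, map_mul, map_inv, ← hz2, mul_inv_cancel]
    rw [← art_ker p L, MonoidHom.mem_ker, art_le p hLM, MonoidHom.comp_apply, MonoidHom.mem_ker.1 h6, map_one]
  · have : nrm k K z = 1 := hz
    rw [map_mul, map_inv, this, inv_one, mul_one]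

end descent
end LCFT

namespace LCFT
open Module

/-- the existence property -/
def Ex (n : ℕ) (k Ω : Type) [Field k] [Field Ω] [Algebra k Ω] : Prop :=
  ∃ (F : IntermediateField k Ω) (_ : FiniteDimensional k F) (_ : IsAbelianGalois k F), NG k F ≤ (powMonoidHom n : kˣ →* kˣ).range

lemma ex_cyclic (p : ℕ) [Fact p.Prime] {k K Ω : Type}
  [Field k] [Algebra ℚ_[p] k] [FiniteDimensional ℚ_[p] k]
  [Field K] [Algebra ℚ_[p] K] [FiniteDimensional ℚ_[p] K]
  [Field Ω] [Algebra ℚ_[p] Ω] [IsAlgClosed Ω]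
  [Algebra k K] [IsScalarTower ℚ_[p] k K] [FiniteDimensional k K]
  [Algebra k Ω] [IsScalarTower ℚ_[p] k Ω] [Algebra K Ω] [IsScalarTower ℚ_[p] K Ω] [IsScalarTower k K Ω]
  [IsGalois k K] [IsCyclic (K ≃ₐ[k] K)] [Normal k Ω] {n : ℕ} (h : Ex n K Ω) : Ex n k Ω := by
  obtain ⟨L, i1, i2, hL⟩ := h
  obtain ⟨F, i3, i4, hF⟩ := descent p (k := k) L
  refine ⟨F, i3, i4, ?_⟩
  intro a ha
  obtain ⟨b, hb, rfl⟩ := hF a ha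
  obtain ⟨c, rfl⟩ := hL hb
  exact ⟨nrm k K c, by simp [powMonoidHom_apply]⟩

lemma ex_abelian (p : ℕ) [Fact p.Prime] {Ω : Type}
  [Field Ω] [Algebra ℚ_[p] Ω] [IsAlgClosed Ω] {n : ℕ} (d : ℕ) : ∀ {k K : Type}
  [Field k] [Algebra ℚ_[p] k] [FiniteDimensional ℚ_[p] k]
  [Field K] [Algebra ℚ_[p] K] [FiniteDimensional ℚ_[p] K]
  [Algebra k K] [IsScalarTower ℚ_[p] k K] [FiniteDimensional k K]
  [Algebra k Ω] [IsScalarTower ℚ_[p] k Ω] [Algebra K Ω] [IsScalarTower ℚ_[p] K Ω] [IsScalarTower k K Ω]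
  [IsAbelianGalois k K] [Normal k Ω] (hd : finrank k K = d) (h : Ex n K Ω), Ex n k Ω := by
  induction d using Nat.strong_induction_on with
  | _ d ih =>
  intro k K _ _ _ _ _ _ _ _ _ _ _ _ _ _ _ _ hd h
  by_cases htriv : ∀ σ : K ≃ₐ[k] K, σ = 1
  · haveI : Subsingleton (K ≃ₐ[k] K) := ⟨fun a b => by rw [htriv a, htriv b]⟩
    exact ex_cyclic p h
  · push Not at htriv
    obtain ⟨σ, hσ⟩ := htriv
    let F := IntermediateField.fixedField (Subgroup.zpowers σ)
    haveI hc : IsCyclic (K ≃ₐ[F] K) := cyclic_fixed _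
    have hmul : finrank k F * finrank F K = finrank k K := finrank_mul_finrank k F K
    have hF1 : finrank F K ≠ 1 := by
      intro h
      have : finrank F K = Nat.card (Subgroup.zpowers σ) := IntermediateField.finrank_fixedField_eq_card _
      rw [h] at this
      have h2 := Subgroup.card_eq_one.1 this.symm
      exact hσ (Subgroup.zpowers_eq_bot.1 h2)
    have hlt : finrank k F < d := by
      have h1 : 0 < finrank F K := finrank_pos
      have h2 : 0 < finrank k F := finrank_pos
      rw [← hd, ← hmul]
      exact lt_mul_right h2 (by omega)
    haveI : IsScalarTower ℚ_[p] F Ω := IsScalarTower.of_algebraMap_eq (fun x => by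
      rw [IsScalarTower.algebraMap_apply ℚ_[p] K Ω]; rfl)
    haveI : IsScalarTower k F Ω := IsScalarTower.of_algebraMap_eq (fun x => by
      rw [IsScalarTower.algebraMap_apply k K Ω]; rfl)
    haveI : IsScalarTower F K Ω := IsScalarTower.of_algebraMap_eq (fun x => rfl)
    haveI : Normal F Ω := Normal.tower_top_of_normal k F Ω
    exact ih _ hlt (k := k) (K := F) rfl (ex_cyclic p (k := F) (K := K) h)

theorem existence (p : ℕ) [Fact p.Prime] {k Ω : Type}
  [Field k] [Algebra ℚ_[p] k] [FiniteDimensional ℚ_[p] k]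
  [Field Ω] [Algebra ℚ_[p] Ω] [IsAlgClosed Ω]
  [Algebra k Ω] [IsScalarTower ℚ_[p] k Ω] [Normal k Ω] {n : ℕ} (hn : n ≠ 0) : Ex n k Ω := by
  haveI := charZero' p Ω
  obtain ⟨ζ, hζ⟩ := exists_zeta (Ω := Ω) n hn
  haveI : NeZero n := ⟨hn⟩
  haveI := hζ.intermediateField_adjoin_isCyclotomicExtension k
  haveI := fd_zeta (k := k) hn hζ
  haveI : IsAbelianGalois k (IntermediateField.adjoin k {ζ}) := IsCyclotomicExtension.isAbelianGalois {n} k _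
  exact ex_abelian p _ (k := k) (K := IntermediateField.adjoin k {ζ}) rfl (kummer_exists p hn (prim_gen (k := k) hζ))
end LCFT

namespace LCFT
open Module Polynomial

section a
variable {k Ω : Type} [Field k] [Field Ω] [Algebra k Ω]

lemma eq_of_fix {S E : IntermediateField k Ω} (hSE : S ≤ E) [FiniteDimensional k E] [IsGalois k E]
    (h : ∀ g : E ≃ₐ[k] E, (∀ x (hx : x ∈ S), g ⟨x, hSE hx⟩ = ⟨x, hSE hx⟩) → g = 1) : E ≤ S := by
  have h1 : (IntermediateField.restrict hSE).fixingSubgroup = ⊥ := by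
    rw [eq_bot_iff]
    intro g hg
    rw [Subgroup.mem_bot]
    apply h
    intro x hx
    rw [IntermediateField.mem_fixingSubgroup_iff] at hg
    exact hg ⟨x, hSE hx⟩ ((IntermediateField.mem_restrict hSE _).2 hx)
  have h2 := IsGalois.fixedField_fixingSubgroup (IntermediateField.restrict hSE)
  rw [h1, IntermediateField.fixedField_bot] at h2
  intro x hx
  have : (⟨x, hx⟩ : E) ∈ IntermediateField.restrict hSE := by rw [← h2]; trivial
  exact (IntermediateField.mem_restrict hSE _).1 this

lemma coeff_mem (K : IntermediateField k Ω) (P : Polynomial Ω) (hP : P.Monic) (hs : P.Splits) (hr : ∀ x ∈ P.roots, x ∈ K) (i : ℕ) :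
    P.coeff i ∈ K := by
  have h1 := hs.mem_lift_of_roots_mem_range hP (algebraMap K Ω) (fun x hx => ⟨⟨x, hr x hx⟩, rfl⟩)
  rw [Polynomial.lifts_iff_coeff_lifts] at h1
  obtain ⟨y, hy⟩ := h1 i
  rw [← hy]; exact y.2

lemma minpoly_coeff [IsAlgClosed Ω] (S K : IntermediateField k Ω) [FiniteDimensional k K] [Normal k K] (θ : K) (i : ℕ) :
    ((minpoly S (θ : Ω)).coeff i : Ω) ∈ K := by
  have hIntg : IsIntegral k (θ : Ω) := (IsIntegral.of_finite k θ).map K.val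
  have := coeff_mem K ((minpoly S (θ:Ω)).map (algebraMap S Ω)) ((minpoly.monic hIntg.tower_top).map _) (IsAlgClosed.splits _) ?_ i
  · rwa [Polynomial.coeff_map] at this
  · intro x hx
    rw [Polynomial.mem_roots', IsRoot.def, eval_map_algebraMap] at hx
    have hx2 : aeval x (minpoly k (θ:Ω)) = 0 := by
      have := minpoly.dvd_map_of_isScalarTower k S (θ : Ω)
      obtain ⟨c, hc⟩ := this
      rw [← Polynomial.aeval_map_algebraMap S, hc, map_mul, hx.2, zero_mul]
    have hn : ((minpoly k θ).map (algebraMap k K)).Splits := Normal.splits inferInstance θ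
    have he : minpoly k (θ : Ω) = minpoly k θ := minpoly.algebraMap_eq (algebraMap K Ω).injective θ
    rw [he] at hx2
    have h3 : (minpoly k θ).map (algebraMap k K) ≠ 0 := Polynomial.map_ne_zero (minpoly.ne_zero (IsIntegral.of_finite k θ))
    have h4 := hn.map (algebraMap K Ω)
    have h5 := hn.roots_map (algebraMap K Ω)
    have : x ∈ (((minpoly k θ).map (algebraMap k K)).map (algebraMap K Ω)).roots := by
      rw [Polynomial.mem_roots (Polynomial.map_ne_zero h3), IsRoot.def, Polynomial.map_map, ← IsScalarTower.algebraMap_eq, eval_map_algebraMap, hx2]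
    rw [h5, Multiset.mem_map] at this
    obtain ⟨y, -, rfl⟩ := this
    exact y.2

lemma orbit_deg [IsAlgClosed Ω] (S K : IntermediateField k Ω) [FiniteDimensional k K] [Normal k K] (θ : K)
    (hθ : ∀ g : K ≃ₐ[k] K, g θ = θ → g = 1) (β : K ≃ₐ[k] K) (hβ : ∀ x (hx : x ∈ K), x ∈ S → β ⟨x,hx⟩ = ⟨x,hx⟩) :
    orderOf β ≤ (minpoly S (θ : Ω)).natDegree := by
  have hIntg : IsIntegral k (θ : Ω) := (IsIntegral.of_finite k θ).map K.val
  set P := minpoly S (θ : Ω) with hP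
  have hP0 : P ≠ 0 := minpoly.ne_zero hIntg.tower_top
  have hdef : P.map (algebraMap S Ω) ∈ Polynomial.lifts (algebraMap K Ω) := by
    rw [Polynomial.lifts_iff_coeff_lifts]
    intro i
    rw [Polynomial.coeff_map]
    exact ⟨⟨_, minpoly_coeff S K θ i⟩, rfl⟩
  rw [Polynomial.mem_lifts] at hdef
  obtain ⟨Q, hQ⟩ := hdef
  have hQc : ∀ i, β (Q.coeff i) = Q.coeff i := by
    intro i
    have h1 : ((Q.coeff i : K) : Ω) = (P.coeff i : Ω) := by
      have := congrArg (fun R => R.coeff i) hQ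
      simpa [Polynomial.coeff_map] using this
    have := hβ (Q.coeff i) (Q.coeff i).2 (by rw [h1]; exact (P.coeff i).2)
    exact this
  have hQβ : Q.map (β : K →+* K) = Q := by
    ext i; rw [Polynomial.coeff_map]; exact congrArg _ (hQc i)
  have hQθ : Q.eval θ = 0 := by
    apply (algebraMap K Ω).injective
    rw [← Polynomial.eval_map_apply, hQ, map_zero, eval_map_algebraMap]
    exact minpoly.aeval _ _
  have hroot : ∀ i : ℕ, Q.eval ((β ^ i) θ) = 0 := by
    intro i
    induction i with
    | zero => simpa using hQθ
    | succ n ih =>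
      have : Q.eval ((β ^ (n+1)) θ) = β (Q.eval ((β ^ n) θ)) := by
        conv_lhs => rw [← hQβ]
        rw [pow_succ', AlgEquiv.mul_apply]
        exact Polynomial.eval_map_apply (f := (β : K →+* K)) (p := Q) ((β ^ n) θ)
      rw [this, ih, map_zero]
  have hQ0 : Q ≠ 0 := by
    rintro rfl
    rw [Polynomial.map_zero] at hQ
    exact Polynomial.map_ne_zero hP0 hQ.symm
  have hdeg : Q.natDegree = P.natDegree := by
    rw [← Polynomial.natDegree_map (algebraMap K Ω), hQ, Polynomial.natDegree_map]
  rw [← hdeg]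
  classical
  have hinj : Set.InjOn (fun i : ℕ => (β ^ i) θ) (Finset.range (orderOf β) : Set ℕ) := by
    intro i hi j hj hij
    have : (β ^ j)⁻¹ * β ^ i = 1 := by
      apply hθ
      rw [AlgEquiv.mul_apply]
      show (β ^ j)⁻¹ ((β ^ i) θ) = θ
      rw [show (β ^ i) θ = (β ^ j) θ from hij]
      exact (β ^ j).symm_apply_apply θ
    have h2 : β ^ i = β ^ j := by rw [inv_mul_eq_one] at this; exact this.symm
    exact pow_injOn_Iio_orderOf (by simpa using hi) (by simpa using hj) h2
  calc orderOf β = ((Finset.range (orderOf β)).image (fun i : ℕ => (β ^ i) θ)).card := by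
        rw [Finset.card_image_of_injOn hinj, Finset.card_range]
    _ ≤ Q.roots.toFinset.card := by
        apply Finset.card_le_card
        intro x hx
        rw [Finset.mem_image] at hx
        obtain ⟨i, -, rfl⟩ := hx
        rw [Multiset.mem_toFinset, Polynomial.mem_roots hQ0]
        exact hroot i
    _ ≤ Q.roots.card := Multiset.toFinset_card_le _
    _ ≤ Q.natDegree := Polynomial.card_roots' Q

end a
end LCFT

namespace LCFT
open Module

section b
variable (p : ℕ) [Fact p.Prime] {k Ω : Type}
  [Field k] [Algebra ℚ_[p] k] [FiniteDimensional ℚ_[p] k]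
  [Field Ω] [Algebra ℚ_[p] Ω] [IsAlgClosed Ω]
  [Algebra k Ω] [IsScalarTower ℚ_[p] k Ω] 

theorem existence' (p : ℕ) [Fact p.Prime] {k Ω : Type}
  [Field k] [Algebra ℚ_[p] k] [FiniteDimensional ℚ_[p] k]
  [Field Ω] [Algebra ℚ_[p] Ω] [IsAlgClosed Ω]
  [Algebra k Ω] [IsScalarTower ℚ_[p] k Ω] {n : ℕ} (hn : n ≠ 0) : Ex n k Ω := by
  haveI hc : IsAlgClosure k (algebraicClosure k Ω) := inferInstance
  haveI : IsAlgClosed (algebraicClosure k Ω) := hc.isAlgClosed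
  haveI : Normal k (algebraicClosure k Ω) := IsAlgClosure.normal k _
  obtain ⟨F, i1, i2, h⟩ := existence p (k := k) (Ω := algebraicClosure k Ω) hn
  let e := IntermediateField.liftAlgEquiv F
  refine ⟨IntermediateField.lift F, e.toLinearEquiv.finiteDimensional, IsAbelianGalois.of_algHom e.symm.toAlgHom, le_trans ?_ h⟩
  rintro _ ⟨y, rfl⟩
  refine ⟨Units.map (e.symm : _ →* _) y, ?_⟩
  ext
  rw [nrm_coe, nrm_coe]
  exact Algebra.norm_eq_of_algEquiv e.symm (y : IntermediateField.lift F)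

theorem exists_unr {m : ℕ} (hm : m ≠ 0) : ∃ (W : IntermediateField k Ω) (_ : FiniteDimensional k W) (_ : IsAbelianGalois k W) (ζ : W),
    IsPrimitiveRoot ζ (qk p k ^ m - 1) ∧ W = IntermediateField.adjoin k {(ζ : Ω)} ∧ finrank k W = m ∧ fres p k W = m ∧
    (∀ g : W ≃ₐ[k] W, g ζ = ζ → g = 1) := by
  haveI := charZero' p Ω
  have h0 := pow_sub_ne_zero (one_lt_qk p k) hm
  obtain ⟨ζ, hζ⟩ := exists_zeta (Ω := Ω) _ h0
  haveI := fd_zeta (k := k) h0 hζ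
  obtain ⟨h1, h2, h3, h4, -⟩ := unram_gen p (k := k) (K := IntermediateField.adjoin k {ζ}) hm (prim_gen hζ) (adjoin_self_top ζ)
  refine ⟨IntermediateField.adjoin k {ζ}, inferInstance, h1, IntermediateField.AdjoinSimple.gen k ζ, prim_gen hζ, rfl, h2, h4, ?_⟩
  intro g hg
  apply gal_ext_of g {ζ} le_rfl
  intro x hx
  rw [Set.mem_singleton_iff] at hx
  subst hx
  exact ⟨IntermediateField.mem_adjoin_simple_self k _, hg⟩

lemma art_sub {E E' : IntermediateField k Ω} [FiniteDimensional k E] [FiniteDimensional k E']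
    [IsAbelianGalois k E] [IsAbelianGalois k E'] (hE : E ≤ E') (a : kˣ) (x : Ω) (hx : x ∈ E) :
    (art p E' a ⟨x, hE hx⟩ : Ω) = art p E a ⟨x, hx⟩ := by
  have := art_func p (k₁ := k) (k₂ := k) (E₁ := E) (E₂ := E') hE a x hx
  rwa [nrm_self] at this

lemma fd_le {F M : IntermediateField k Ω} [FiniteDimensional k M] (h : F ≤ M) : FiniteDimensional k F :=
  FiniteDimensional.of_injective (IntermediateField.inclusion h).toLinearMap (IntermediateField.inclusion h).injective

lemma LT_mem_iff (L : IntermediateField k Ω) (π : kˣ) : L ∈ {L : IntermediateField k Ω | FiniteDimensional k L ∧ IsGalois k L ∧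
      (∀ σ τ : L ≃ₐ[k] L, σ * τ = τ * σ) ∧ ∃ x : L, Algebra.norm k x = π} ↔
     ∃ (_ : FiniteDimensional k L) (_ : IsAbelianGalois k L), π ∈ NG k L := by
  constructor
  · rintro ⟨h1, h2, h3, h4⟩
    exact ⟨h1, { is_comm := ⟨h3⟩ }, mem_NG'.2 h4⟩
  · rintro ⟨h1, h2, h3⟩
    exact ⟨h1, inferInstance, fun s t => mul_comm s t, mem_NG'.1 h3⟩

/-- the Lubin-Tate family -/
def LTfam (k Ω : Type) [Field k] [Field Ω] [Algebra k Ω] (π : kˣ) : Set (IntermediateField k Ω) :=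
  {L | ∃ (_ : FiniteDimensional k L) (_ : IsAbelianGalois k L), π ∈ NG k L}

lemma LT_eq (π : kˣ) : lubinTateExt k Ω (π : k) = ⨆ L : LTfam k Ω π, (L : IntermediateField k Ω) := by
  unfold lubinTateExt
  rw [iSup_subtype']
  have : {L : IntermediateField k Ω | FiniteDimensional k L ∧ IsGalois k L ∧
      (∀ σ τ : L ≃ₐ[k] L, σ * τ = τ * σ) ∧ ∃ x : L, Algebra.norm k x = π} = LTfam k Ω π := by
    ext L; exact LT_mem_iff L π
  rw [this]

lemma LT_abelian [CharZero k] (π : kˣ) : IsAbelianGalois k (lubinTateExt k Ω (π : k)) := by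
  rw [LT_eq]
  exact abelian_iSup _ (fun L => L.2.2.1)

lemma le_LT (L : IntermediateField k Ω) [FiniteDimensional k L] [IsAbelianGalois k L] (π : kˣ) (h : art p L π = 1) :
    L ≤ lubinTateExt k Ω (π : k) := by
  rw [LT_eq]
  refine le_iSup (fun L : LTfam k Ω π => (L : IntermediateField k Ω)) ⟨L, ?_⟩
  refine ⟨inferInstance, inferInstance, ?_⟩
  rw [← art_ker p, MonoidHom.mem_ker, h]

lemma LT_directed (p : ℕ) [Fact p.Prime] {k Ω : Type}
  [Field k] [Algebra ℚ_[p] k] [FiniteDimensional ℚ_[p] k]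
  [Field Ω] [Algebra ℚ_[p] Ω] [IsAlgClosed Ω]
  [Algebra k Ω] [IsScalarTower ℚ_[p] k Ω] (π : kˣ) : Directed (· ≤ ·) (fun L : LTfam k Ω π => (L : IntermediateField k Ω)) := by
  haveI := charZero' p k
  rintro ⟨L, i1, i2, h⟩ ⟨L', i1', i2', h'⟩
  haveI : IsAbelianGalois k (L ⊔ L' : IntermediateField k Ω) := abelian_sup _ _
  refine ⟨⟨L ⊔ L', inferInstance, inferInstance, ?_⟩, le_sup_left, le_sup_right⟩
  rw [← art_ker p, MonoidHom.mem_ker] at h h' ⊢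
  apply gal_ext_of _ (L ∪ L' : Set Ω)
  · rw [IntermediateField.adjoin_union, IntermediateField.adjoin_self, IntermediateField.adjoin_self]
  · rintro x (hx | hx)
    · refine ⟨(le_sup_left : L ≤ L ⊔ L') hx, Subtype.ext ?_⟩
      rw [art_sub p le_sup_left π x hx, h]; rfl
    · refine ⟨(le_sup_right : L' ≤ L ⊔ L') hx, Subtype.ext ?_⟩
      rw [art_sub p le_sup_right π x hx, h']; rfl

lemma LT_cases (π : kˣ) {x : Ω} (hx : x ∈ lubinTateExt k Ω (π : k)) : ∃ (L : IntermediateField k Ω) (_ : FiniteDimensional k L)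
    (_ : IsAbelianGalois k L), art p L π = 1 ∧ x ∈ L := by
  haveI : Nonempty (LTfam k Ω π) := by
    refine ⟨⟨⊥, inferInstance, inferInstance, ?_⟩⟩
    rw [← art_ker p, MonoidHom.mem_ker]
    apply AlgEquiv.ext
    rintro ⟨x, hx⟩
    obtain ⟨y, rfl⟩ := IntermediateField.mem_bot.1 hx
    exact AlgEquiv.commutes _ y
  rw [LT_eq, ← SetLike.mem_coe, IntermediateField.coe_iSup_of_directed (LT_directed p π), Set.mem_iUnion] at hx
  obtain ⟨⟨L, i1, i2, h⟩, hx⟩ := hx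
  rw [← art_ker p, MonoidHom.mem_ker] at h
  exact ⟨L, i1, i2, h, hx⟩

lemma LT_fix (π : kˣ) (E : IntermediateField k Ω) [FiniteDimensional k E] [IsAbelianGalois k E] (x : Ω) (hx : x ∈ E)
    (h : x ∈ lubinTateExt k Ω (π : k)) : art p E π ⟨x, hx⟩ = ⟨x, hx⟩ := by
  haveI := charZero' p k
  obtain ⟨L, i1, i2, hL, hxL⟩ := LT_cases p π h
  haveI : IsAbelianGalois k (E ⊔ L : IntermediateField k Ω) := abelian_sup _ _
  apply Subtype.ext
  rw [← art_sub p (le_sup_left : E ≤ E ⊔ L) π x hx]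
  have := art_sub p (le_sup_right : L ≤ E ⊔ L) π x hxL
  rw [hL] at this
  exact this

/-- fixed field of the Frobenius -/
lemma LT_fixed (π : kˣ) (E : IntermediateField k Ω) [FiniteDimensional k E] [IsAbelianGalois k E] :
    ∃ (F : IntermediateField k Ω) (_ : F ≤ E) (_ : FiniteDimensional k F) (_ : IsAbelianGalois k F), art p F π = 1 ∧
     (∀ g : E ≃ₐ[k] E, (∀ x (hx : x ∈ E), x ∈ F → g ⟨x,hx⟩=⟨x,hx⟩) → g ∈ Subgroup.zpowers (art p E π)) := by
  obtain ⟨F, hF, h1, h2⟩ := exists_fixed E (Subgroup.zpowers (art p E π))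
  haveI := fd_le hF
  haveI := abelian_le hF
  refine ⟨F, hF, inferInstance, inferInstance, ?_, h2⟩
  ext x
  rw [← art_sub p hF π x x.2, (h1 x (hF x.2)).1 x.2 _ (Subgroup.mem_zpowers _)]
  rfl
end b
end LCFT

namespace LCFT
open Module

section c
lemma unr_finrank (p : ℕ) [Fact p.Prime] {k Ω : Type}
  [Field k] [Algebra ℚ_[p] k] [FiniteDimensional ℚ_[p] k]
  [Field Ω] [Algebra ℚ_[p] Ω] [IsAlgClosed Ω]
  [Algebra k Ω] [IsScalarTower ℚ_[p] k Ω] (π : kˣ) (hπ : v p k π = 1) {m : ℕ} (hm : m ≠ 0)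
  (W : IntermediateField k Ω) [FiniteDimensional k W] [IsAbelianGalois k W] (ζ : W) (hζ : IsPrimitiveRoot ζ (qk p k ^ m - 1))
  (hW : W = IntermediateField.adjoin k {(ζ : Ω)}) (hfin : finrank k W = m) (hg : ∀ g : W ≃ₐ[k] W, g ζ = ζ → g = 1)
  (S : IntermediateField k Ω) (hS : S = lubinTateExt k Ω (π : k)) (hM : S ≤ S ⊔ W) :
  FiniteDimensional S (IntermediateField.extendScalars hM) ∧ finrank S (IntermediateField.extendScalars hM) = m := by
  have hIntg : IsIntegral k (ζ : Ω) := (IsIntegral.of_finite k ζ).map W.val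
  have h1 : IntermediateField.extendScalars hM = IntermediateField.adjoin S {(ζ : Ω)} := by
    apply IntermediateField.restrictScalars_injective k
    rw [IntermediateField.extendScalars_restrictScalars, IntermediateField.restrictScalars_adjoin_eq_sup, ← hW]
  have hβ := art_zeta p hm ζ hζ π hπ
  have h2 : orderOf (art p W π) ≤ (minpoly S (ζ : Ω)).natDegree := by
    apply orbit_deg S W ζ hg
    intro x hx hxS
    rw [hS] at hxS
    exact LT_fix p π W x hx hxS
  have h3 : m ≤ orderOf (art p W π) := by
    apply Nat.le_of_dvd (orderOf_pos _)
    have h4 := pow_zeta (q := qk p k) (d := 1) (by rw [pow_one]; exact hβ) (orderOf (art p W π))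
    rw [pow_orderOf_eq_one, one_mul] at h4
    have := (zeta_pow_iff (one_lt_qk p k) hm hζ (orderOf (art p W π)) 0).1 (by simpa using h4.symm)
    rwa [Nat.modEq_zero_iff_dvd] at this
  have h4 : (minpoly S (ζ : Ω)).natDegree ≤ m := by
    rw [← hfin]
    have h5 : finrank k W = (minpoly k (ζ : Ω)).natDegree := by
      have := IntermediateField.adjoin.finrank hIntg
      rw [← hW] at this
      exact this
    rw [h5, ← Polynomial.natDegree_map (algebraMap k S)]
    exact Polynomial.natDegree_le_of_dvd (minpoly.dvd_map_of_isScalarTower k S (ζ : Ω)) (Polynomial.map_ne_zero (minpoly.ne_zero hIntg))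
  rw [h1]
  refine ⟨IntermediateField.adjoin.finiteDimensional hIntg.tower_top, ?_⟩
  rw [IntermediateField.adjoin.finrank hIntg.tower_top]
  omega

variable (p : ℕ) [Fact p.Prime] {k₁ k₂ Ω : Type}
  [Field k₁] [Algebra ℚ_[p] k₁] [FiniteDimensional ℚ_[p] k₁]
  [Field k₂] [Algebra ℚ_[p] k₂] [FiniteDimensional ℚ_[p] k₂]
  [Field Ω] [Algebra ℚ_[p] Ω] [IsAlgClosed Ω]
  [Algebra k₁ Ω] [IsScalarTower ℚ_[p] k₁ Ω] 
  [Algebra k₂ Ω] [IsScalarTower ℚ_[p] k₂ Ω]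
  [Algebra k₁ k₂] [IsScalarTower ℚ_[p] k₁ k₂] [FiniteDimensional k₁ k₂] [IsScalarTower k₁ k₂ Ω]

theorem fwd (p : ℕ) [Fact p.Prime] {k₁ k₂ Ω : Type}
  [Field k₁] [Algebra ℚ_[p] k₁] [FiniteDimensional ℚ_[p] k₁]
  [Field k₂] [Algebra ℚ_[p] k₂] [FiniteDimensional ℚ_[p] k₂]
  [Field Ω] [Algebra ℚ_[p] Ω] [IsAlgClosed Ω]
  [Algebra k₁ Ω] [IsScalarTower ℚ_[p] k₁ Ω] 
  [Algebra k₂ Ω] [IsScalarTower ℚ_[p] k₂ Ω]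
  [Algebra k₁ k₂] [IsScalarTower ℚ_[p] k₁ k₂] [FiniteDimensional k₁ k₂] [IsScalarTower k₁ k₂ Ω]
  (π₁ : k₁ˣ) (π₂ : k₂ˣ) (hπ₂ : v p k₂ π₂ = 1) {m c : ℕ} (hm : m ≠ 0) (h : (nrm k₁ k₂ π₂) ^ m = π₁ ^ c) :
  ∃ (M : IntermediateField k₂ Ω) (hM : lubinTateExt k₂ Ω (π₂ : k₂) ≤ M), IsGalois k₂ M ∧ (∀ σ τ : M ≃ₐ[k₂] M, σ * τ = τ * σ) ∧
    (lubinTateExt k₁ Ω (π₁ : k₁) : Set Ω) ⊆ (M : Set Ω) ∧ FiniteDimensional (lubinTateExt k₂ Ω (π₂ : k₂)) (IntermediateField.extendScalars hM) ∧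
    finrank (lubinTateExt k₂ Ω (π₂ : k₂)) (IntermediateField.extendScalars hM) = m := by
  haveI := charZero' p k₁
  haveI := charZero' p k₂
  obtain ⟨W, i1, i2, ζ, hζ, hW, hfin, -, hg⟩ := exists_unr p (k := k₂) (Ω := Ω) hm
  haveI := LT_abelian (Ω := Ω) π₂
  haveI : IsAbelianGalois k₂ (lubinTateExt k₂ Ω (π₂ : k₂) ⊔ W : IntermediateField k₂ Ω) := abelian_sup _ _
  have hfr := unr_finrank p π₂ hπ₂ hm W ζ hζ hW hfin hg _ rfl le_sup_left
  refine ⟨lubinTateExt k₂ Ω (π₂ : k₂) ⊔ W, le_sup_left, inferInstance, fun s t => mul_comm s t, ?_, hfr.1, hfr.2⟩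
  intro x hx
  rw [SetLike.mem_coe] at hx
  obtain ⟨L, j1, j2, hL, hxL⟩ := LT_cases p π₁ hx
  haveI := base_fd (k₂ := k₂) L
  haveI := base_abelian (k₂ := k₂) L
  haveI : IsAbelianGalois k₂ (IntermediateField.adjoin k₂ (L : Set Ω) ⊔ W : IntermediateField k₂ Ω) := abelian_sup _ _
  obtain ⟨E, hE⟩ : ∃ E : IntermediateField k₂ Ω, E = IntermediateField.adjoin k₂ (L : Set Ω) ⊔ W := ⟨_, rfl⟩
  haveI : FiniteDimensional k₂ E := by rw [hE]; infer_instance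
  haveI : IsAbelianGalois k₂ E := by rw [hE]; infer_instance
  have hWE : W ≤ E := hE ▸ le_sup_right
  have hLE : L ≤ E.restrictScalars k₁ := by
    intro y hy
    rw [IntermediateField.mem_restrictScalars, hE]
    exact (le_sup_left : _ ≤ IntermediateField.adjoin k₂ (L : Set Ω) ⊔ W) (IntermediateField.subset_adjoin _ _ hy)
  obtain ⟨α, hα⟩ : ∃ α, α = art p E π₂ := ⟨_, rfl⟩
  have hζE : (ζ : Ω) ∈ E := hWE ζ.2
  have hζ' : IsPrimitiveRoot (⟨(ζ : Ω), hζE⟩ : E) (qk p k₂ ^ m - 1) := hζ.map_of_injective (f := IntermediateField.inclusion hWE) (IntermediateField.inclusion hWE).injective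
  have hαζ : α ⟨ζ, hζE⟩ = ⟨ζ, hζE⟩ ^ (qk p k₂ ^ 1) := by
    rw [pow_one, hα]
    exact art_zeta p hm _ hζ' π₂ hπ₂
  have hαm : α ^ m = 1 := by
    apply gal_ext_of _ (L ∪ {(ζ : Ω)} : Set Ω)
    · rw [IntermediateField.adjoin_union, ← hW, hE]
    · rintro y (hy | hy)
      · refine ⟨hLE hy, Subtype.ext ?_⟩
        rw [hα, ← map_pow, art_func p hLE (π₂ ^ m) y hy, map_pow, h, map_pow, hL, one_pow]
        rfl
      · rw [Set.mem_singleton_iff] at hy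
        subst hy
        refine ⟨hζE, ?_⟩
        rw [pow_zeta hαζ, one_mul]
        have := (zeta_pow_iff (one_lt_qk p k₂) hm hζ' m 0).2 (by simp [Nat.ModEq])
        simpa using this
  obtain ⟨T, hT, t1, t2, hT1, hT2⟩ := LT_fixed p π₂ E
  have hle : E ≤ T ⊔ W := by
    apply eq_of_fix (sup_le hT hWE)
    intro g hgx
    have := hT2 g (fun y hy hyT => hgx y ((le_sup_left : T ≤ T ⊔ W) hyT))
    rw [← hα, ← mem_powers_iff_mem_zpowers] at this
    obtain ⟨j, hj⟩ := this
    simp only at hj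
    have h1 := hgx ζ ((le_sup_right : W ≤ T ⊔ W) ζ.2)
    rw [← hj, pow_zeta hαζ, one_mul] at h1
    have := (zeta_pow_iff (one_lt_qk p k₂) hm hζ' j 0).1 (by simpa using h1)
    rw [Nat.modEq_zero_iff_dvd] at this
    obtain ⟨d, rfl⟩ := this
    rw [← hj, pow_mul, hαm, one_pow]
  have : T ⊔ W ≤ lubinTateExt k₂ Ω (π₂ : k₂) ⊔ W := sup_le_sup_right (le_LT p T π₂ hT1) W
  exact this (hle (hLE hxL))
end c
end LCFT

namespace LCFT
open Module

section d
lemma order_le (p : ℕ) [Fact p.Prime] {k Ω : Type}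
  [Field k] [Algebra ℚ_[p] k] [FiniteDimensional ℚ_[p] k]
  [Field Ω] [Algebra ℚ_[p] Ω] [IsAlgClosed Ω]
  [Algebra k Ω] [IsScalarTower ℚ_[p] k Ω] (π : kˣ) 
  (S M : IntermediateField k Ω) (hS : S = lubinTateExt k Ω (π : k)) (hM : S ≤ M) 
  [FiniteDimensional S (IntermediateField.extendScalars hM)] 
  (K : IntermediateField k Ω) [FiniteDimensional k K] [IsAbelianGalois k K] (hK : K ≤ M) :
  (art p K π) ^ (Nat.factorial (finrank S (IntermediateField.extendScalars hM))) = 1 := by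
  haveI := charZero' p k
  obtain ⟨θ, hθ⟩ := Field.exists_primitive_element k K
  have h2 : orderOf (art p K π) ≤ (minpoly S (θ : Ω)).natDegree := by
    apply orbit_deg S K θ
    · intro g hg
      have : IntermediateField.adjoin k {θ} ≤ IntermediateField.fixedField (Subgroup.zpowers g) := by
        rw [IntermediateField.adjoin_simple_le_iff, IntermediateField.mem_fixedField_iff]
        intro s hs
        have : s ∈ MulAction.stabilizer (K ≃ₐ[k] K) θ := 
          (Subgroup.zpowers_le.2 (show g ∈ MulAction.stabilizer (K ≃ₐ[k] K) θ from hg)) hs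
        exact this
      rw [hθ] at this
      ext x
      have h3 := (IntermediateField.mem_fixedField_iff _ _).1 (this (IntermediateField.mem_top (x := x))) g (Subgroup.mem_zpowers g)
      rw [h3]; rfl
    · intro x hx hxS
      rw [hS] at hxS
      exact LT_fix p π K x hx hxS
  have h3 : (minpoly S (θ : Ω)).natDegree ≤ finrank S (IntermediateField.extendScalars hM) := by
    have h4 : (θ : Ω) ∈ IntermediateField.extendScalars hM := hK θ.2
    have h5 : minpoly S (θ : Ω) = minpoly S (⟨θ, h4⟩ : IntermediateField.extendScalars hM) :=
      minpoly.algebraMap_eq (algebraMap (IntermediateField.extendScalars hM) Ω).injective ⟨θ, h4⟩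
    rw [h5]
    haveI : Module.Free S (IntermediateField.extendScalars hM) := Module.Free.of_divisionRing S _
    exact minpoly.natDegree_le _
  rw [← orderOf_dvd_iff_pow_eq_one]
  exact Nat.dvd_factorial (orderOf_pos _) (h2.trans h3)

theorem bwd (p : ℕ) [Fact p.Prime] {k₁ k₂ Ω : Type}
  [Field k₁] [Algebra ℚ_[p] k₁] [FiniteDimensional ℚ_[p] k₁]
  [Field k₂] [Algebra ℚ_[p] k₂] [FiniteDimensional ℚ_[p] k₂]
  [Field Ω] [Algebra ℚ_[p] Ω] [IsAlgClosed Ω]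
  [Algebra k₁ Ω] [IsScalarTower ℚ_[p] k₁ Ω] 
  [Algebra k₂ Ω] [IsScalarTower ℚ_[p] k₂ Ω]
  [Algebra k₁ k₂] [IsScalarTower ℚ_[p] k₁ k₂] [FiniteDimensional k₁ k₂] [IsScalarTower k₁ k₂ Ω]
  (π₁ : k₁ˣ) (π₂ : k₂ˣ) (hπ₁ : v p k₁ π₁ = 1) (hπ₂ : v p k₂ π₂ = 1) 
  (S M : IntermediateField k₂ Ω) (hS : S = lubinTateExt k₂ Ω (π₂ : k₂)) (hM : S ≤ M) 
  [FiniteDimensional S (IntermediateField.extendScalars hM)] 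
  (h : (lubinTateExt k₁ Ω (π₁ : k₁) : Set Ω) ⊆ (M : Set Ω)) :
  ∃ n : ℕ, 0 < n ∧ (nrm k₁ k₂ π₂) ^ n = π₁ ^ (fres p k₁ k₂ * n) := by
  haveI := charZero' p k₁
  haveI := charZero' p k₂
  obtain ⟨D, hD⟩ : ∃ D, D = Nat.factorial (finrank S (IntermediateField.extendScalars hM)) := ⟨_, rfl⟩
  obtain ⟨f, hf⟩ : ∃ f, f = fres p k₁ k₂ := ⟨_, rfl⟩
  refine ⟨D, hD ▸ Nat.factorial_pos _, ?_⟩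
  rw [← hf]
  obtain ⟨u, hu⟩ : ∃ u, u = (nrm k₁ k₂ π₂) ^ D * (π₁ ^ (f * D))⁻¹ := ⟨_, rfl⟩
  have huv : v p k₁ u = 0 := by
    rw [hu, v_mul, v_inv, v_pow, v_pow, v_nrm, hπ₁, hπ₂, ← hf]
    push_cast; ring
  rw [← mul_inv_eq_one, ← hu]
  apply eq_one_of_divisible p ((mem_U_v p).2 huv)
  intro n hn
  obtain ⟨F, i1, i2, hF⟩ := existence' p (k := k₁) (Ω := Ω) hn.ne'
  obtain ⟨W, j1, j2, ζ, hζ, hW, hfin, hfW, hg⟩ := exists_unr p (k := k₁) (Ω := Ω) hn.ne'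
  obtain ⟨E, hE⟩ : ∃ E : IntermediateField k₁ Ω, E = F ⊔ W := ⟨_, rfl⟩
  haveI : IsAbelianGalois k₁ (F ⊔ W : IntermediateField k₁ Ω) := abelian_sup _ _
  haveI : FiniteDimensional k₁ E := by rw [hE]; infer_instance
  haveI : IsAbelianGalois k₁ E := by rw [hE]; infer_instance
  have hWE : W ≤ E := hE ▸ le_sup_right
  have hFE : F ≤ E := hE ▸ le_sup_left
  obtain ⟨L, hLE, l1, l2, hL1, hL2⟩ := LT_fixed p π₁ E
  obtain ⟨K, hK⟩ : ∃ K : IntermediateField k₂ Ω, K = IntermediateField.adjoin k₂ (L : Set Ω) := ⟨_, rfl⟩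
  haveI : FiniteDimensional k₂ K := by rw [hK]; exact base_fd (k₂ := k₂) L
  haveI : IsAbelianGalois k₂ K := by rw [hK]; exact base_abelian (k₂ := k₂) L
  have hKM : K ≤ M := by
    rw [hK, IntermediateField.adjoin_le_iff]
    exact fun x hx => h (le_LT p L π₁ hL1 hx)
  have hLK : L ≤ K.restrictScalars k₁ := by
    intro y hy
    rw [IntermediateField.mem_restrictScalars, hK]
    exact IntermediateField.subset_adjoin _ _ hy
  have hβ := order_le p π₂ S M hS hM K hKM
  rw [← hD, ← map_pow] at hβ
  have hLu : art p L u = 1 := by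
    rw [hu, map_mul, map_inv, map_pow _ π₁, hL1, one_pow, inv_one, mul_one]
    ext x
    rw [← map_pow (nrm k₁ k₂), ← art_func p hLK (π₂ ^ D) x x.2, hβ]
    rfl
  have hz : art p E u ∈ Subgroup.zpowers (art p E π₁) := by
    apply hL2
    intro x hx hxL
    apply Subtype.ext
    rw [art_sub p hLE u x hxL, hLu]
    rfl
  rw [Subgroup.mem_zpowers_iff] at hz
  obtain ⟨i, hi⟩ := hz
  have hi2 : u * π₁ ^ (-i) ∈ (art p E).ker := by
    rw [MonoidHom.mem_ker, map_mul, ← hi, map_zpow, ← zpow_add, add_neg_cancel, zpow_zero]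
  have hker : ∀ {E' : IntermediateField k₁ Ω} [FiniteDimensional k₁ E'] [IsAbelianGalois k₁ E'] (hh : E' ≤ E), u * π₁ ^ (-i) ∈ NG k₁ E' := by
    intro E' _ _ hh
    rw [← art_ker p, MonoidHom.mem_ker, art_le p hh, MonoidHom.comp_apply, MonoidHom.mem_ker.1 hi2, map_one]
  obtain ⟨y, hy⟩ := hF (hker hFE)
  obtain ⟨z, hz⟩ := hker hWE
  have hvi : (n : ℤ) ∣ i := by
    have := congrArg (v p k₁) hz
    rw [v_nrm, hfW, v_mul, huv, v_zpow, hπ₁] at this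
    exact ⟨-(v p W z), by linarith⟩
  obtain ⟨j, rfl⟩ := hvi
  refine ⟨y * π₁ ^ j, ?_⟩
  rw [powMonoidHom_apply] at hy
  rw [mul_pow, hy, mul_assoc, ← zpow_natCast, ← zpow_mul, ← zpow_add]
  rw [show -((n : ℤ) * j) + j * n = 0 by ring, zpow_zero, mul_one]
end d
end LCFT

namespace LCFT
open Module

lemma v_unif (p : ℕ) [Fact p.Prime] {k : Type} [Field k] [Algebra ℚ_[p] k] [FiniteDimensional ℚ_[p] k]
    [Algebra ℤ_[p] k] [IsScalarTower ℤ_[p] ℚ_[p] k] {π : k} (h : IsUniformizer p k π) : ∃ u : kˣ, (u : k) = π ∧ v p k u = 1 := by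
  obtain ⟨h, hi⟩ := h
  obtain ⟨h0, hw⟩ := w_unif' p h hi
  refine ⟨Units.mk0 π h0, rfl, ?_⟩
  rw [v_eq_iff p, Units.val_mk0, hw, mul_one]

theorem main (p : ℕ) [Fact p.Prime] (k₁ k₂ Ω : Type) [Field k₁] [Field k₂]
    [Algebra ℚ_[p] k₁] [Algebra ℚ_[p] k₂] [Algebra k₁ k₂] [IsScalarTower ℚ_[p] k₁ k₂]
    [FiniteDimensional ℚ_[p] k₂]
    [Algebra ℤ_[p] k₁] [IsScalarTower ℤ_[p] ℚ_[p] k₁]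
    [Algebra ℤ_[p] k₂] [IsScalarTower ℤ_[p] ℚ_[p] k₂]
    [Field Ω] [IsAlgClosed Ω]
    [Algebra k₁ Ω] [Algebra k₂ Ω]
    [IsScalarTower k₁ k₂ Ω]
    (π₁ : k₁) (π₂ : k₂)
    (hπ₁ : IsUniformizer p k₁ π₁) (hπ₂ : IsUniformizer p k₂ π₂)
    (f : ℕ) (hf : resCard p k₂ = (resCard p k₁) ^ f) :
    ((∃ n : ℕ, 0 < n ∧ (Algebra.norm k₁ π₂) ^ n = π₁ ^ (f * n)) ↔
      (∃ (M : IntermediateField k₂ Ω)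
        (hM : lubinTateExt k₂ Ω π₂ ≤ M),
        FiniteDimensional (lubinTateExt k₂ Ω π₂)
          (IntermediateField.extendScalars hM) ∧
        (lubinTateExt k₁ Ω π₁ : Set Ω) ⊆
          (M : Set Ω))) ∧
    ((∃ n : ℕ, 0 < n ∧ (Algebra.norm k₁ π₂) ^ n = π₁ ^ (f * n)) →
      ∃ (M : IntermediateField k₂ Ω)
        (hM : lubinTateExt k₂ Ω π₂ ≤ M),
        IsGalois k₂ M ∧ (∀ σ τ : M ≃ₐ[k₂] M, σ * τ = τ * σ) ∧
        (lubinTateExt k₁ Ω π₁ : Set Ω) ⊆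
          (M : Set Ω) ∧
        Module.finrank (lubinTateExt k₂ Ω π₂)
          (IntermediateField.extendScalars hM) =
          Nat.card {x : k₁ // ∃ n : ℕ, 0 < n ∧ x ^ n = 1}) := by
  letI : Algebra ℚ_[p] Ω := ((algebraMap k₂ Ω).comp (algebraMap ℚ_[p] k₂)).toAlgebra
  haveI : IsScalarTower ℚ_[p] k₂ Ω := IsScalarTower.of_algebraMap_eq (fun x => rfl)
  haveI : IsScalarTower ℚ_[p] k₁ Ω := IsScalarTower.of_algebraMap_eq (fun x => by
    rw [IsScalarTower.algebraMap_apply k₁ k₂ Ω, ← IsScalarTower.algebraMap_apply ℚ_[p] k₁ k₂]; rfl)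
  haveI : FiniteDimensional ℚ_[p] k₁ := FiniteDimensional.left ℚ_[p] k₁ k₂
  haveI : FiniteDimensional k₁ k₂ := FiniteDimensional.right ℚ_[p] k₁ k₂
  obtain ⟨u₁, rfl, hv₁⟩ := v_unif p hπ₁
  obtain ⟨u₂, rfl, hv₂⟩ := v_unif p hπ₂
  have hff : f = fres p k₁ k₂ := by
    unfold resCard at hf
    rw [resCard_eq', resCard_eq', qk_fres p (k := k₁) (K := k₂)] at hf
    exact (Nat.pow_right_injective (one_lt_qk p k₁) hf).symm
  have key : (∃ n : ℕ, 0 < n ∧ (Algebra.norm k₁ (u₂ : k₂)) ^ n = (u₁ : k₁) ^ (f * n)) → ∃ c,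
      nrm k₁ k₂ u₂ ^ Nat.card {x : k₁ // ∃ n : ℕ, 0 < n ∧ x ^ n = 1} = u₁ ^ (c : ℕ) := by
    rintro ⟨n, hn, h⟩
    have h1 : nrm k₁ k₂ u₂ ^ n = u₁ ^ (f * n) := by ext; push_cast; rw [nrm_coe]; exact h
    have h2 : (((nrm k₁ k₂ u₂ * (u₁ ^ f)⁻¹ : k₁ˣ)) : k₁) ^ n = 1 := by
      rw [← Units.val_pow_eq_pow_val, mul_pow, h1, inv_pow, ← pow_mul, mul_inv_cancel, Units.val_one]
    have h3 := torsion_pow_card p hn h2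
    refine ⟨f * Nat.card {x : k₁ // ∃ n : ℕ, 0 < n ∧ x ^ n = 1}, ?_⟩
    rw [← Units.val_pow_eq_pow_val, Units.val_eq_one, mul_pow, inv_pow, mul_inv_eq_one, ← pow_mul] at h3
    exact h3
  have fw : (∃ n : ℕ, 0 < n ∧ (Algebra.norm k₁ (u₂ : k₂)) ^ n = (u₁ : k₁) ^ (f * n)) → _ := fun h =>
    fwd p (Ω := Ω) u₁ u₂ hv₂ (card_torsion_pos p (k := k₁)).ne' (key h).choose_spec
  refine ⟨⟨fun h => ?_, ?_⟩, fun h => ?_⟩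
  · obtain ⟨M, hM, -, -, h1, h2, -⟩ := fw h
    exact ⟨M, hM, h2, h1⟩
  · rintro ⟨M, hM, h1, h2⟩
    obtain ⟨n, hn, h3⟩ := bwd p u₁ u₂ hv₁ hv₂ _ M rfl hM h2
    refine ⟨n, hn, ?_⟩
    rw [hff]
    have := congrArg (Units.val) h3
    push_cast at this
    rw [← this, nrm_coe]
  · obtain ⟨M, hM, h3, h4, h1, -, h2⟩ := fw h
    exact ⟨M, hM, h3, h4, h1, h2⟩
end LCFT


/-- Let `k₂/k₁` be a finite extension of `p`-adic fields with residual degree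
`f` and uniformizers `π₂, π₁`.  Then `π₁^{-f}·Nr_{k₂/k₁}(π₂)` is a root of unity iff there
is a finite extension `M` of the Lubin-Tate extension `k_{2,π₂}` with `k_{1,π₁} ⊆ M`.
Moreover, in that case `M` can be taken to be a subextension of the maximal abelian
extension of `k₂` (i.e. `M/k₂` abelian) of degree over `k_{2,π₂}` equal to the number of
roots of unity in `k₁`. -/
theorem stmt_8 (p : ℕ) [Fact p.Prime] (k₁ k₂ : Type) [Field k₁] [Field k₂]
    [Algebra ℚ_[p] k₁] [Algebra ℚ_[p] k₂] [Algebra k₁ k₂] [IsScalarTower ℚ_[p] k₁ k₂]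
    [FiniteDimensional ℚ_[p] k₂]
    [Algebra ℤ_[p] k₁] [IsScalarTower ℤ_[p] ℚ_[p] k₁]
    [Algebra ℤ_[p] k₂] [IsScalarTower ℤ_[p] ℚ_[p] k₂]
    [Algebra k₁ (AlgebraicClosure ℚ_[p])] [Algebra k₂ (AlgebraicClosure ℚ_[p])]
    [IsScalarTower k₁ k₂ (AlgebraicClosure ℚ_[p])]
    (π₁ : k₁) (π₂ : k₂)
    (hπ₁ : IsUniformizer p k₁ π₁) (hπ₂ : IsUniformizer p k₂ π₂)
    (f : ℕ) (hf : resCard p k₂ = (resCard p k₁) ^ f) :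
    ((∃ n : ℕ, 0 < n ∧ (Algebra.norm k₁ π₂) ^ n = π₁ ^ (f * n)) ↔
      (∃ (M : IntermediateField k₂ (AlgebraicClosure ℚ_[p]))
        (hM : lubinTateExt k₂ (AlgebraicClosure ℚ_[p]) π₂ ≤ M),
        FiniteDimensional (lubinTateExt k₂ (AlgebraicClosure ℚ_[p]) π₂)
          (IntermediateField.extendScalars hM) ∧
        (lubinTateExt k₁ (AlgebraicClosure ℚ_[p]) π₁ : Set (AlgebraicClosure ℚ_[p])) ⊆
          (M : Set (AlgebraicClosure ℚ_[p])))) ∧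
    ((∃ n : ℕ, 0 < n ∧ (Algebra.norm k₁ π₂) ^ n = π₁ ^ (f * n)) →
      ∃ (M : IntermediateField k₂ (AlgebraicClosure ℚ_[p]))
        (hM : lubinTateExt k₂ (AlgebraicClosure ℚ_[p]) π₂ ≤ M),
        IsGalois k₂ M ∧ (∀ σ τ : M ≃ₐ[k₂] M, σ * τ = τ * σ) ∧
        (lubinTateExt k₁ (AlgebraicClosure ℚ_[p]) π₁ : Set (AlgebraicClosure ℚ_[p])) ⊆
          (M : Set (AlgebraicClosure ℚ_[p])) ∧
        Module.finrank (lubinTateExt k₂ (AlgebraicClosure ℚ_[p]) π₂)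
          (IntermediateField.extendScalars hM) =
          Nat.card {x : k₁ // ∃ n : ℕ, 0 < n ∧ x ^ n = 1}) := by
  exact LCFT.main p k₁ k₂ (AlgebraicClosure ℚ_[p]) π₁ π₂ hπ₁ hπ₂ f hf
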